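/- Let F be an algebraically closed field of characteristic 0 and let g be the simple Lie algebra of type F4 over F (equivalently, a finite-dimensional simple Lie algebra over F with dim g = 52). Then there exists a grading of g by the group (ℤ/3ℤ)^3 such that dim g_α = 2 for every nonzero α ∈ (ℤ/3ℤ)^3 (so necessarily g_0 = 0), and any two such gradings of g are equivalent. -/

import Mathlib

open Module

/-- A grading of the Lie algebra `L` over `F` by the additive group `A`:
a direct sum decomposition into subspaces compatible with the bracket. -/
def IsLieGrading (F : Type*) {A L : Type*} [Field F] [AddCommGroup A] [DecidableEq A]
    [LieRing L] [LieAlgebra F L] (gr : A → Submodule F L) : Prop :=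
  DirectSum.IsInternal gr ∧
    ∀ a b : A, ∀ x ∈ gr a, ∀ y ∈ gr b, ⁅x, y⁆ ∈ gr (a + b)

/-- Two gradings of `L` are equivalent if some automorphism of `L` maps each nonzero
homogeneous component of the first grading onto a homogeneous component of the second. -/
def GradingsEquiv (F : Type*) {A B L : Type*} [Field F] [AddCommGroup A] [AddCommGroup B]
    [LieRing L] [LieAlgebra F L] (gr : A → Submodule F L) (gr' : B → Submodule F L) : Prop :=
  ∃ φ : L ≃ₗ⁅F⁆ L, ∀ a : A, gr a ≠ ⊥ →
    ∃ b : B, (gr a).map φ.toLinearEquiv.toLinearMap = gr' b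

namespace JordanF4

open Finset

/-- The combinatorial shadow of a reduced irreducible crystallographic root system of rank `rank`
not of type `G₂`: Cartan integers, reflections, and squared lengths. -/
structure RootDatum (ι : Type*) [Fintype ι] [DecidableEq ι] (rank : ℕ) where
  p : ι → ι → ℤ
  s : ι → ι → ι
  len : ι → ℤ
  p_self : ∀ i, p i i = 2
  p_s_left : ∀ i j k, p (s i j) k = p j k - p j i * p i k
  p_s_right : ∀ i j k, p k (s i j) = p k j - p i j * p k i
  table : ∀ i j, (p i j = 0 ∧ p j i = 0) ∨ (p i j = 1 ∧ p j i = 1) ∨ (p i j = -1 ∧ p j i = -1) ∨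
    (p i j = 1 ∧ p j i = 2) ∨ (p i j = 2 ∧ p j i = 1) ∨ (p i j = -1 ∧ p j i = -2) ∨
    (p i j = -2 ∧ p j i = -1) ∨ (i = j) ∨ (i = s j j)
  ext : ∀ i j, (∀ k, p i k = p j k) → i = j
  len_pos : ∀ i, 0 < len i
  len_s : ∀ i j, len (s i j) = len j
  p_mul_len : ∀ i j, p i j * len j = p j i * len i
  two_lengths : ∀ i j k, len i ≠ len j → len k = len i ∨ len k = len j
  connected : ∀ i j, ∃ k, len k = len j ∧ p i k ≠ 0
  sum_weight : ∀ O : Finset ι, (∀ i, ∀ j ∈ O, s i j ∈ O) → ∀ b,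
    (rank : ℤ) * ∑ a ∈ O, p a b * p b a = 4 * #O

theorem even_card_of_involution {α : Type*} [DecidableEq α] (S : Finset α) (f : α → α)
    (hf : ∀ a ∈ S, f a ∈ S) (hff : ∀ a ∈ S, f (f a) = a) (hne : ∀ a ∈ S, f a ≠ a) :
    Even #S := by
  have : ∑ a ∈ S, (1 : ZMod 2) = 0 :=
    Finset.sum_involution (fun a _ ↦ f a) (fun a ha ↦ by decide) (fun a ha _ ↦ hne a ha)
      (fun a ha ↦ hf a ha) (fun a ha ↦ hff a ha)
  rw [Finset.sum_const, nsmul_one] at this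
  exact (ZMod.natCast_eq_zero_iff_even).mp this

namespace RootDatum

variable {ι : Type*} [Fintype ι] [DecidableEq ι] {rank : ℕ} (D : RootDatum ι rank)

/-- The index of the opposite root. -/
def neg (i : ι) : ι := D.s i i

theorem p_neg_left (i k : ι) : D.p (D.neg i) k = -D.p i k := by
  rw [neg, p_s_left, p_self]; ring

theorem p_neg_right (i k : ι) : D.p k (D.neg i) = -D.p k i := by
  rw [neg, p_s_right, p_self]; ring

theorem neg_neg (i : ι) : D.neg (D.neg i) = i :=
  D.ext _ _ fun k ↦ by simp [p_neg_left]

theorem neg_ne (i : ι) : D.neg i ≠ i := fun h ↦ by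
  have := D.p_neg_left i i
  rw [h, p_self] at this
  omega

theorem len_neg (i : ι) : D.len (D.neg i) = D.len i := D.len_s i i

theorem p_comm {i j : ι} (h : D.len i = D.len j) : D.p i j = D.p j i := by
  have := D.p_mul_len i j
  rw [h] at this
  exact mul_right_cancel₀ (D.len_pos j).ne' this

theorem table_of_len {i j : ι} (h : D.len i = D.len j) :
    D.p i j = 0 ∨ D.p i j = 1 ∨ D.p i j = -1 ∨ i = j ∨ i = D.neg j := by
  have := D.p_comm h
  have := D.table i j
  rw [neg]
  grind

/-- In a root subsystem with all roots of the same length, the number of roots making an acute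
angle with a given root is even, and bounded in terms of the number of roots. -/
theorem card_of_same_length (O : Finset ι) (hO : ∀ i, ∀ j ∈ O, D.s i j ∈ O) (hne : O.Nonempty)
    (hlen : ∀ i ∈ O, ∀ j ∈ O, D.len i = D.len j) (hrank : 0 < rank) :
    ∃ k : ℕ, rank * (2 + k) = #O ∧ 6 * k ≤ #O ∧ Even #O := by
  have hneg : ∀ j ∈ O, D.neg j ∈ O := fun j hj ↦ hO j j hj
  have hcomm : ∀ i ∈ O, ∀ j ∈ O, D.p i j = D.p j i := fun i hi j hj ↦ D.p_comm (hlen i hi j hj)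
  have htab : ∀ i ∈ O, ∀ j ∈ O, D.p i j = 0 ∨ D.p i j = 1 ∨ D.p i j = -1 ∨ i = j ∨ i = D.neg j :=
    fun i hi j hj ↦ D.table_of_len (hlen i hi j hj)
  have heven : Even #O := even_card_of_involution O D.neg hneg (fun a _ ↦ D.neg_neg a)
    fun a _ ↦ D.neg_ne a
  let pos : ι → Finset ι := fun b ↦ O.filter fun a ↦ D.p a b = 1
  let orth : ι → Finset ι := fun b ↦ O.filter fun a ↦ D.p a b = 0
  have hposneg : ∀ b ∈ O, #(O.filter fun a ↦ D.p a b = -1) = #(pos b) := fun b hb ↦ by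
    apply Finset.card_bij' (fun a _ ↦ D.neg a) (fun a _ ↦ D.neg a)
    · intro a ha
      simp only [pos, mem_filter] at ha ⊢
      exact ⟨hneg a ha.1, by rw [p_neg_left, ha.2]; rfl⟩
    · intro a ha
      simp only [pos, mem_filter] at ha ⊢
      exact ⟨hneg a ha.1, by rw [p_neg_left, ha.2]⟩
    · intro a _; exact D.neg_neg a
    · intro a _; exact D.neg_neg a
  have hcases : ∀ (f : ι → ℤ) (b), b ∈ O → ∑ a ∈ O, f a =
      f b + f (D.neg b) + ∑ a ∈ pos b, f a + ∑ a ∈ O.filter (fun a ↦ D.p a b = -1), f a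
        + ∑ a ∈ orth b, f a := fun f b hb ↦ by
    have h1 : f b = ∑ a ∈ O, if a = b then f a else 0 := by simp [hb]
    have h2 : f (D.neg b) = ∑ a ∈ O, if a = D.neg b then f a else 0 := by simp [hneg b hb]
    simp only [pos, orth, sum_filter]
    rw [h1, h2, ← sum_add_distrib, ← sum_add_distrib, ← sum_add_distrib, ← sum_add_distrib]
    refine sum_congr rfl fun a ha ↦ ?_
    have e1 : a = b → D.p a b = 2 := fun h ↦ by rw [h, p_self]
    have e2 : a = D.neg b → D.p a b = -2 := fun h ↦ by rw [h, p_neg_left, p_self]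
    have := htab a ha b hb
    by_cases c1 : a = b <;> by_cases c2 : a = D.neg b <;> grind
  have hcard : ∀ b ∈ O, #O = 2 + 2 * #(pos b) + #(orth b) := fun b hb ↦ by
    have := hcases (fun _ ↦ 1) b hb
    simp only [sum_const, nsmul_eq_mul, mul_one, hposneg b hb] at this
    omega
  have hweight : ∀ b ∈ O, rank * (4 + #(pos b)) = 2 * #O := fun b hb ↦ by
    have h1 := hcases (fun a ↦ D.p a b * D.p b a) b hb
    have h2 := D.sum_weight O hO b
    have h3 : ∑ a ∈ pos b, D.p a b * D.p b a = #(pos b) := by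
      rw [card_eq_sum_ones, Nat.cast_sum]
      refine sum_congr rfl fun a ha ↦ ?_
      simp only [pos, mem_filter] at ha
      rw [hcomm b hb a ha.1, ha.2]; rfl
    have h4 : ∑ a ∈ O.filter (fun a ↦ D.p a b = -1), D.p a b * D.p b a = #(pos b) := by
      rw [← hposneg b hb, card_eq_sum_ones, Nat.cast_sum]
      refine sum_congr rfl fun a ha ↦ ?_
      simp only [mem_filter] at ha
      rw [hcomm b hb a ha.1, ha.2]; rfl
    have h5 : ∑ a ∈ orth b, D.p a b * D.p b a = 0 := by
      refine sum_eq_zero fun a ha ↦ ?_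
      simp only [orth, mem_filter] at ha
      rw [ha.2, zero_mul]
    rw [h3, h4, h5, p_self, p_neg_left, p_neg_right, p_self] at h1
    rw [h1] at h2
    zify
    linarith
  obtain ⟨b, hb⟩ := hne
  have hdiff : ∀ a ∈ pos b, D.s a b ∈ pos b ∧ ∀ k, D.p (D.s a b) k = D.p b k - D.p a k := by
    intro a ha
    simp only [pos, mem_filter] at ha ⊢
    have hba : D.p b a = 1 := by rw [hcomm b hb a ha.1, ha.2]
    have h : ∀ k, D.p (D.s a b) k = D.p b k - D.p a k := fun k ↦ by
      rw [p_s_left, hba, one_mul]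
    exact ⟨⟨hO a b hb, by rw [h, p_self, ha.2]; rfl⟩, h⟩
  have hevpos : Even #(pos b) := by
    refine even_card_of_involution _ (fun a ↦ D.s a b) (fun a ha ↦ (hdiff a ha).1)
      (fun a ha ↦ D.ext _ _ fun k ↦ ?_) fun a ha h ↦ ?_
    · rw [(hdiff _ (hdiff a ha).1).2, (hdiff a ha).2]; ring
    · have h1 := (hdiff a ha).2 a
      simp only [pos, mem_filter] at ha
      rw [h, p_self, hcomm b hb a ha.1, ha.2] at h1
      omega
  obtain ⟨k, hk⟩ := hevpos
  refine ⟨k, ?_, ?_, heven⟩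
  · have := hweight b hb
    rw [hk] at this
    linarith
  rcases Nat.eq_zero_or_pos k with rfl | hkpos
  · simp
  obtain ⟨a, ha⟩ : (pos b).Nonempty := card_pos.mp (by omega)
  have haO : a ∈ O := (mem_filter.mp ha).1
  have hab : D.p a b = 1 := (mem_filter.mp ha).2
  have hm : #(pos a) = #(pos b) := by
    have h1 := hweight a haO
    have h2 := hweight b hb
    have := Nat.eq_of_mul_eq_mul_left hrank (h1.trans h2.symm)
    omega
  let Z := (pos b).filter fun c ↦ D.p c a = 0
  have hZ1 : #((pos b).filter fun c ↦ D.p c a = 1) = #Z := by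
    apply Finset.card_bij' (fun c _ ↦ D.s c b) (fun c _ ↦ D.s c b)
    · intro c hc
      rw [mem_filter] at hc
      refine mem_filter.mpr ⟨(hdiff c hc.1).1, ?_⟩
      rw [(hdiff c hc.1).2, hc.2, hcomm b hb a haO, hab]; rfl
    · intro c hc
      rw [mem_filter] at hc
      refine mem_filter.mpr ⟨(hdiff c hc.1).1, ?_⟩
      rw [(hdiff c hc.1).2, hc.2, hcomm b hb a haO, hab]; rfl
    all_goals
      intro c hc
      have hc' := (mem_filter.mp hc).1
      refine D.ext _ _ fun k ↦ ?_
      rw [(hdiff _ (hdiff c hc').1).2, (hdiff c hc').2]; ring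
  have hsplit : pos b ⊆ {a, D.s a b} ∪ (Z ∪ (pos b).filter fun c ↦ D.p c a = 1) := by
    intro c hc
    have hcO : c ∈ O := (mem_filter.mp hc).1
    have hcb : D.p c b = 1 := (mem_filter.mp hc).2
    simp only [mem_union, mem_insert, mem_singleton, Z, mem_filter]
    rcases htab c hcO a haO with h | h | h | h | h
    · tauto
    · tauto
    · left; right
      have h1 : D.p (D.s c b) a = 2 := by
        rw [(hdiff c hc).2, hcomm b hb a haO, hab, h]; rfl
      have h2 : D.s c b = a := by
        have := htab _ (hO c b hb) a haO
        have e2 : D.s c b = D.neg a → D.p (D.s c b) a = -2 := fun h ↦ by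
          rw [h, p_neg_left, p_self]
        grind
      refine D.ext _ _ fun k ↦ ?_
      rw [(hdiff a ha).2, ← h2, (hdiff c hc).2]; ring
    · tauto
    · rw [h, p_neg_left, hab] at hcb; omega
  have hcardZ : #(pos b) ≤ 2 + (#Z + #Z) := by
    calc _ ≤ _ := card_le_card hsplit
      _ ≤ _ := (card_union_le _ _).trans (add_le_add (card_le_two) (card_union_le _ _))
      _ = _ := by rw [hZ1]
  have horth : #Z + #Z ≤ #(orth a) := by
    have hZneg : #(Z.image D.neg) = #Z :=
      card_image_of_injective _ fun x y h ↦ by rw [← D.neg_neg x, h, D.neg_neg]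
    have hdisj : Disjoint Z (Z.image D.neg) := by
      rw [disjoint_left]
      intro c hc hc'
      obtain ⟨d, hd, rfl⟩ := mem_image.mp hc'
      simp only [Z, pos, mem_filter, p_neg_left] at hc hd
      omega
    calc #Z + #Z = #(Z ∪ Z.image D.neg) := by rw [card_union_of_disjoint hdisj, hZneg]
      _ ≤ _ := card_le_card ?_
    intro c hc
    rw [mem_union, mem_image] at hc
    simp only [Z, pos, mem_filter] at hc
    rw [mem_filter]
    rcases hc with hc | ⟨d, hd, rfl⟩
    · exact ⟨hc.1.1, hc.2⟩
    · exact ⟨hneg d hd.1.1, by rw [p_neg_left, hd.2]; rfl⟩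
  have := hcard a haO
  omega

end RootDatum
end JordanF4

namespace JordanF4

open Finset
namespace RootDatum

variable {ι : Type*} [Fintype ι] [DecidableEq ι] {rank : ℕ} (D : RootDatum ι rank)

/-- If a root is orthogonal to all other roots of its length, the count of roots excludes
`#roots + rank = 52`. -/
theorem exists_acute (hcard : Fintype.card ι + rank = 52) (hrank : 0 < rank) (a b : ι)
    (hab : D.len a ≠ D.len b) : ∃ c, D.len c = D.len a ∧ D.p c a = -1 := by
  by_contra! hcon
  let O := univ.filter fun i ↦ D.len i = D.len a
  let O' := univ.filter fun i ↦ D.len i = D.len b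
  have hO : ∀ i, ∀ j ∈ O, D.s i j ∈ O := fun i j hj ↦ by
    simp only [O, mem_filter, mem_univ, true_and] at hj ⊢
    rw [len_s, hj]
  have hO' : ∀ i, ∀ j ∈ O', D.s i j ∈ O' := fun i j hj ↦ by
    simp only [O', mem_filter, mem_univ, true_and] at hj ⊢
    rw [len_s, hj]
  have hsum : #O + #O' = Fintype.card ι := by
    rw [← card_union_of_disjoint, ← card_univ]
    · congr 1
      ext i
      simpa [O, O'] using D.two_lengths a b i hab
    · rw [disjoint_left]
      intro i hi hi'
      simp only [O, O', mem_filter] at hi hi'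
      exact hab (hi.2.symm.trans hi'.2)
  have h8 : ∑ i ∈ O, D.p i a * D.p a i = 8 := by
    rw [← sum_subset (s₁ := {a, D.neg a})]
    · rw [sum_pair (D.neg_ne a).symm, p_neg_left, p_neg_right, p_self]; norm_num
    · intro i hi
      simp only [mem_insert, mem_singleton] at hi
      rcases hi with rfl | rfl <;> simp [O, len_neg]
    · intro i hi hi'
      simp only [mem_insert, mem_singleton, O, mem_filter, mem_univ, true_and] at hi hi'
      have h1 := D.table_of_len hi
      have h2 := hcon i hi
      have h3 : D.p i a ≠ 1 := fun h ↦ hcon (D.neg i) (by rw [len_neg, hi]) (by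
        rw [p_neg_left, h])
      have : D.p i a = 0 := by tauto
      rw [this, zero_mul]
  have h9 := D.sum_weight O hO a
  rw [h8] at h9
  obtain ⟨k, hk1, hk2, hk3⟩ := D.card_of_same_length O' hO' ⟨b, by simp [O']⟩ (fun i hi j hj ↦ by
    simp only [O', mem_filter] at hi hj
    rw [hi.2, hj.2]) hrank
  have h10 : #O = 2 * rank := by omega
  have h11 : rank ≤ 52 := by omega
  have h12 : rank * (2 + k) = 52 - 3 * rank := by omega
  have hk4 : 6 * k ≤ 52 - 3 * rank := by omega
  clear_value O O'
  clear hcon hO hO' h8 h9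
  interval_cases rank <;> omega

/-- A quadruple of roots with the Cartan integers of `F₄`. -/
def IsF4Quad (α : Fin 4 → ι) : Prop := ∀ i j, D.p (α i) (α j) = CartanMatrix.F₄ i j

theorem isF4Quad_of (a b c d : ι) (hba : D.p b a = -1) (hab : D.p a b = -1)
    (hbc : D.p b c = -2) (hcb : D.p c b = -1) (hcd : D.p c d = -1) (hdc : D.p d c = -1)
    (hac : D.p a c = 0) (hca : D.p c a = 0) (had : D.p a d = 0) (hda : D.p d a = 0)
    (hbd : D.p b d = 0) (hdb : D.p d b = 0) : D.IsF4Quad ![a, b, c, d] := by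
  intro i j
  fin_cases i <;> fin_cases j <;> simp [p_self, CartanMatrix.F₄, *]

theorem exists_isF4Quad (hcard : Fintype.card ι + rank = 52) (hrank : 0 < rank) [Nonempty ι] :
    ∃ α : Fin 4 → ι, D.IsF4Quad α := by
  by_cases hlen : ∀ i j, D.len i = D.len j
  · obtain ⟨k, hk1, hk2, hk3⟩ := D.card_of_same_length univ (by simp) univ_nonempty
      (fun i _ j _ ↦ hlen i j) hrank
    rw [card_univ] at hk1 hk2 hk3
    have h11 : rank ≤ 52 := by omega
    have h12 : rank * (2 + k) = 52 - rank := by omega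
    have hk4 : 6 * k ≤ 52 - rank := by omega
    rw [show Fintype.card ι = 52 - rank by omega, Nat.even_iff] at hk3
    clear hk1 hk2 hcard
    interval_cases rank <;> omega
  have hmix : ∃ b c, D.p b c = -2 ∧ D.p c b = -1 := by
    push Not at hlen
    obtain ⟨i, j, hij⟩ := hlen
    obtain ⟨k, hk, hik⟩ := D.connected i j
    rw [← hk] at hij
    have h0 : D.p i k ≠ D.p k i := fun h ↦ hij <| by
      have := D.p_mul_len i k
      rw [← h] at this
      exact (mul_left_cancel₀ hik this).symm
    rcases D.table i k with h | h | h | h | h | h | h | h | h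
    · omega
    · omega
    · omega
    · exact ⟨D.neg k, i, by simp [p_neg_left, h], by simp [p_neg_right, h]⟩
    · exact ⟨D.neg i, k, by simp [p_neg_left, h], by simp [p_neg_right, h]⟩
    · exact ⟨k, i, h.2, h.1⟩
    · exact ⟨i, k, h.1, h.2⟩
    · rw [h] at hij; exact (hij rfl).elim
    · rw [h, len_s] at hij; exact (hij rfl).elim
  obtain ⟨b, c, hbc, hcb⟩ := hmix
  have hlenbc : D.len b = 2 * D.len c := by
    have := D.p_mul_len b c
    rw [hbc, hcb] at this
    linarith
  have hne : D.len b ≠ D.len c := by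
    have := D.len_pos c
    omega
  have hneg_two : ∀ i j, D.p i j = 2 * D.p j i ∨ D.len i ≠ 2 * D.len j := fun i j ↦ by
    by_cases h : D.len i = 2 * D.len j
    · left
      have h1 := D.p_mul_len i j
      rw [h, ← mul_assoc] at h1
      have := mul_right_cancel₀ (D.len_pos j).ne' h1
      linarith
    · exact .inr h
  have hls : ∀ {i j}, D.len i = D.len b → D.len j = D.len c →
      D.p i j = 2 * D.p j i ∧ (D.p j i = 0 ∨ D.p j i = 1 ∨ D.p j i = -1) := fun {i j} hi hj ↦ by
    have h1 := (hneg_two i j).resolve_right (by rw [hi, hj]; simpa using hlenbc)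
    refine ⟨h1, ?_⟩
    have hii := D.p_self i
    have h2 := D.table i j
    rcases h2 with h | h | h | h | h | h | h | h | h
    all_goals try omega
    · rw [h, hj] at hi; exact (hne hi.symm).elim
    · rw [h, len_s, hj] at hi; exact (hne hi.symm).elim
  have hexd : ∃ d, D.len d = D.len c ∧ D.p d c = -1 ∧ D.p d b = 0 := by
    obtain ⟨d, hd, hdc⟩ := D.exists_acute hcard hrank c b hne.symm
    have hcd : D.p c d = -1 := by rw [← D.p_comm hd, hdc]
    rcases (hls rfl hd).2 with h | h | h
    · exact ⟨d, hd, hdc, h⟩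
    · refine ⟨D.neg (D.s c d), by rw [len_neg, len_s, hd], ?_, ?_⟩
      · rw [p_neg_left, p_s_left, hdc, p_self]; norm_num
      · rw [p_neg_left, p_s_left, hdc, hcb, h]; norm_num
    · have := (hls (j := D.s c d) rfl (by rw [len_s, hd])).2
      rw [p_s_left, hdc, hcb, h] at this
      omega
  obtain ⟨d, hd, hdc, hdb⟩ := hexd
  have hexa : ∃ a, D.len a = D.len b ∧ D.p a b = -1 ∧ D.p c a = 0 := by
    obtain ⟨a, ha, hab⟩ := D.exists_acute hcard hrank b c hne
    have hba : D.p b a = -1 := by rw [← D.p_comm ha, hab]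
    rcases (hls ha rfl).2 with h | h | h
    · exact ⟨a, ha, hab, h⟩
    · refine ⟨D.neg (D.s b a), by rw [len_neg, len_s, ha], ?_, ?_⟩
      · rw [p_neg_left, p_s_left, hab, p_self]; norm_num
      · rw [p_neg_right, p_s_right, hba, hcb, h]; norm_num
    · have := (hls (i := D.s b a) (by rw [len_s, ha]) rfl).2
      rw [p_s_right, hba, hcb, h] at this
      omega
  obtain ⟨a, ha, hab, hca⟩ := hexa
  have hba : D.p b a = -1 := by rw [← D.p_comm ha, hab]
  have hcd : D.p c d = -1 := by rw [← D.p_comm hd, hdc]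
  have hac : D.p a c = 0 := by rw [(hls ha rfl).1, hca]; rfl
  have hbd : D.p b d = 0 := by rw [(hls rfl hd).1, hdb]; rfl
  have key : ∀ d', D.len d' = D.len c → D.p d' c = -1 → D.p d' b = 0 → D.p d' a = 0 →
      ∃ α : Fin 4 → ι, D.IsF4Quad α := fun d' hd' h1 h2 h3 ↦
    ⟨_, D.isF4Quad_of a b c d' hba hab hbc hcb (by rw [← D.p_comm hd', h1]) h1 hac hca
      (by rw [(hls ha hd').1, h3]; rfl) h3 (by rw [(hls rfl hd').1, h2]; rfl) h2⟩
  -- the root `d + 2 * c + b`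
  let e := D.s c (D.s b (D.s c d))
  have he : ∀ k, D.p e k = D.p d k + 2 * D.p c k + D.p b k := fun k ↦ by
    simp only [e, p_s_left, hdc, hdb, hcb, hbc, p_self]; ring
  have hlene : D.len e = D.len c := by simp only [e, len_s, hd]
  rcases (hls ha hd).2 with h | h | h
  · exact key d hd hdc hdb h
  · exact key (D.neg e) (by rw [len_neg, hlene])
      (by rw [p_neg_left, he, hdc, hbc, p_self]; norm_num)
      (by rw [p_neg_left, he, hdb, hcb, p_self]; norm_num)
      (by rw [p_neg_left, he, h, hca, hba]; norm_num)
  · have := (hls ha hlene).2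
    rw [he, h, hca, hba] at this
    omega

end RootDatum
end JordanF4

namespace JordanF4

open Finset

/-- The positive roots of `F₄`, as vectors of coefficients with respect to simple roots. -/
def posRoots : List (Fin 4 → ℤ) :=
  [![1, 0, 0, 0], ![0, 1, 0, 0], ![0, 0, 1, 0], ![0, 0, 0, 1], ![1, 1, 0, 0], ![0, 1, 2, 0],
   ![0, 1, 1, 0], ![0, 0, 1, 1], ![1, 1, 2, 0], ![1, 1, 1, 0], ![0, 1, 1, 1], ![0, 1, 2, 2],
   ![1, 2, 2, 0], ![1, 1, 1, 1], ![1, 1, 2, 2], ![0, 1, 2, 1], ![1, 2, 2, 2], ![1, 1, 2, 1],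
   ![1, 2, 2, 1], ![1, 2, 3, 1], ![1, 2, 4, 2], ![1, 3, 4, 2], ![2, 3, 4, 2], ![1, 2, 3, 2]]

/-- The roots of `F₄`, as vectors of coefficients with respect to simple roots. -/
def roots : List (Fin 4 → ℤ) := posRoots ++ posRoots.map fun v ↦ -v

/-- The Cartan integer of a vector and a simple root. -/
def cartanInt (v : Fin 4 → ℤ) (m : Fin 4) : ℤ := ∑ j, v j * CartanMatrix.F₄ j m

/-- The reflection in a simple root. -/
def simpleReflection (m : Fin 4) (v : Fin 4 → ℤ) : Fin 4 → ℤ :=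
  fun j ↦ v j - if j = m then cartanInt v m else 0

/-- The invariant form for which short roots have length `2` and long roots have length `4`. -/
def form (u v : Fin 4 → ℤ) : ℤ := ∑ j, ∑ m, u j * v m * CartanMatrix.F₄ j m * ![2, 2, 1, 1] m

theorem posRoots_eq_reflection : ∀ v ∈ posRoots, (∃ m, v = Pi.single m 1) ∨
    ∃ u ∈ posRoots, ∑ j, u j < ∑ j, v j ∧ ∃ m, v = simpleReflection m u := by
  decide +kernel

theorem posRoots_eq_add : ∀ v ∈ posRoots, (∃ m, v = Pi.single m 1) ∨
    ∃ u ∈ posRoots, ∑ j, u j < ∑ j, v j ∧ ∃ m, v = u + Pi.single m 1 := by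
  decide +kernel

theorem sum_pos_of_mem_posRoots : ∀ v ∈ posRoots, 0 < ∑ j, v j := by
  decide +kernel

theorem roots_nodup : roots.Nodup := by
  decide +kernel

theorem zero_notMem_roots : 0 ∉ roots := by
  decide +kernel

theorem neg_mem_roots : ∀ v ∈ roots, -v ∈ roots := by
  decide +kernel

theorem exists_adapted_short_root : ∀ b ∈ roots, form b b = 4 → form b (Pi.single 1 1) = -2 →
    ∃ s ∈ roots, form s s = 2 ∧ form s (Pi.single 1 1) = -2 ∧ form s b = 2 := by
  decide +kernel

theorem single_mem_roots : ∀ m, Pi.single m 1 ∈ roots := by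
  decide +kernel

theorem length_roots : roots.length = 48 := by
  decide +kernel

theorem single_mem_posRoots : ∀ m : Fin 4, Pi.single m 1 ∈ posRoots := by decide +kernel

theorem posRoots_induction {p : (Fin 4 → ℤ) → Prop} (hs : ∀ m, p (Pi.single m 1))
    (ha : ∀ u ∈ posRoots, ∀ m, u + Pi.single m 1 ∈ posRoots → p u → p (u + Pi.single m 1)) :
    ∀ v ∈ posRoots, p v := by
  have key : ∀ n : ℕ, ∀ v ∈ posRoots, ∑ j, v j < n → p v := by
    intro n
    induction n with
    | zero =>
      intro v hv hn
      have := sum_pos_of_mem_posRoots v hv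
      push_cast at hn
      omega
    | succ n ih =>
      intro v hv hn
      rcases posRoots_eq_add v hv with ⟨m, rfl⟩ | ⟨u, hu, huv, m, rfl⟩
      · exact hs m
      · exact ha u hu m hv (ih u hu (by push_cast at hn; omega))
  intro v hv
  have h0 := sum_pos_of_mem_posRoots v hv
  exact key ((∑ j, v j).toNat + 1) v hv (by push_cast; omega)

end JordanF4

namespace JordanF4

open Finset
namespace RootDatum

variable {ι : Type*} [Fintype ι] [DecidableEq ι] {rank : ℕ} (D : RootDatum ι rank)

/-- `v` is the vector of coefficients of the root `i` with respect to the roots `α`. -/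
def IsCoeff (α : Fin 4 → ι) (i : ι) (v : Fin 4 → ℤ) : Prop :=
  ∀ k, D.p i k = ∑ j, v j * D.p (α j) k

variable {D} {α : Fin 4 → ι}

theorem isCoeff_single (m : Fin 4) : D.IsCoeff α (α m) (Pi.single m 1) := fun k ↦ by
  simp [Pi.single_apply]

theorem IsCoeff.p_eq_cartanInt (hα : D.IsF4Quad α) {i : ι} {v : Fin 4 → ℤ}
    (h : D.IsCoeff α i v) (m : Fin 4) : D.p i (α m) = cartanInt v m := by
  rw [h, cartanInt]
  simp only [hα _ _]

theorem IsCoeff.reflection (hα : D.IsF4Quad α) {i : ι} {v : Fin 4 → ℤ} (h : D.IsCoeff α i v)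
    (m : Fin 4) : D.IsCoeff α (D.s (α m) i) (simpleReflection m v) := fun k ↦ by
  simp only [p_s_left, simpleReflection, sub_mul, sum_sub_distrib, ite_mul, zero_mul,
    sum_ite_eq', mem_univ, if_true, ← h k, h.p_eq_cartanInt hα]

theorem IsCoeff.neg {i : ι} {v : Fin 4 → ℤ} (h : D.IsCoeff α i v) :
    D.IsCoeff α (D.neg i) (-v) := fun k ↦ by
  simp only [p_neg_left, h k, Pi.neg_apply, neg_mul, sum_neg_distrib]

theorem IsCoeff.eq {i : ι} (hα : D.IsF4Quad α) {u v : Fin 4 → ℤ} (h : D.IsCoeff α i u)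
    (h' : D.IsCoeff α i v) : u = v := by
  have := fun m ↦ (h.p_eq_cartanInt hα m).symm.trans (h'.p_eq_cartanInt hα m)
  have h0 := this 0
  have h1 := this 1
  have h2 := this 2
  have h3 := this 3
  simp [cartanInt, Fin.sum_univ_four, CartanMatrix.F₄] at h0 h1 h2 h3
  ext j
  fin_cases j <;> simp only [Fin.zero_eta, Fin.mk_one, Fin.reduceFinMk] <;> omega

theorem exists_isCoeff (hα : D.IsF4Quad α) (v : Fin 4 → ℤ) (hv : v ∈ roots) :
    ∃ i, D.IsCoeff α i v := by
  have hpos : ∀ n : ℕ, ∀ v ∈ posRoots, ∑ j, v j < n → ∃ i, D.IsCoeff α i v := by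
    intro n
    induction n with
    | zero => intro v hv h; have := sum_pos_of_mem_posRoots v hv; simp at h; omega
    | succ n ih =>
      intro v hv h
      rcases posRoots_eq_reflection v hv with ⟨m, rfl⟩ | ⟨u, hu, hlt, m, rfl⟩
      · exact ⟨α m, isCoeff_single m⟩
      · obtain ⟨i, hi⟩ := ih u hu (by push_cast at h; omega)
        exact ⟨_, hi.reflection hα m⟩
  have hpos' : ∀ v ∈ posRoots, ∃ i, D.IsCoeff α i v := fun v hv ↦
    hpos (∑ j, v j + 1).toNat v hv (by have := sum_pos_of_mem_posRoots v hv; omega)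
  rw [roots, List.mem_append, List.mem_map] at hv
  rcases hv with hv | ⟨u, hu, rfl⟩
  · exact hpos' v hv
  · obtain ⟨i, hi⟩ := hpos' u hu
    exact ⟨_, hi.neg⟩

theorem exists_mem_roots (hα : D.IsF4Quad α) (hcard : Fintype.card ι ≤ 48) (i : ι) :
    ∃ v ∈ roots, D.IsCoeff α i v := by
  choose f hf using exists_isCoeff hα
  have hinj : Function.Injective fun v : {v // v ∈ roots.toFinset} ↦
      f v (List.mem_toFinset.mp v.2) := fun u v h ↦ by
    have h1 := hf u (List.mem_toFinset.mp u.2)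
    have h2 := hf v (List.mem_toFinset.mp v.2)
    simp only at h
    rw [h] at h1
    exact Subtype.ext (h1.eq hα h2)
  have hc : Fintype.card {v // v ∈ roots.toFinset} = 48 := by
    rw [Fintype.card_coe, List.toFinset_card_of_nodup roots_nodup, length_roots]
  have hbij := (Fintype.bijective_iff_injective_and_card _).mpr
    ⟨hinj, le_antisymm (Fintype.card_le_of_injective _ hinj) (by rw [hc]; exact hcard)⟩
  obtain ⟨v, rfl⟩ := hbij.2 i
  exact ⟨v, List.mem_toFinset.mp v.2, hf _ _⟩

theorem card_eq (hα : D.IsF4Quad α) (hcard : Fintype.card ι ≤ 48) : Fintype.card ι = 48 := by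
  refine le_antisymm hcard ?_
  choose f hf using exists_isCoeff hα
  have hinj : Function.Injective fun v : {v // v ∈ roots.toFinset} ↦
      f v (List.mem_toFinset.mp v.2) := fun u v h ↦ by
    have h1 := hf u (List.mem_toFinset.mp u.2)
    have h2 := hf v (List.mem_toFinset.mp v.2)
    simp only at h
    rw [h] at h1
    exact Subtype.ext (h1.eq hα h2)
  have hc : Fintype.card {v // v ∈ roots.toFinset} = 48 := by
    rw [Fintype.card_coe, List.toFinset_card_of_nodup roots_nodup, length_roots]
  rw [← hc]
  exact Fintype.card_le_of_injective _ hinj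

theorem IsCoeff.p_mul_form (hα : D.IsF4Quad α) {i j : ι} {u v : Fin 4 → ℤ}
    (hi : D.IsCoeff α i u) (hj : D.IsCoeff α j v) : D.p i j * form v v = 2 * form u v := by
  have hl : ∀ k, D.len (α k) = ![2, 2, 1, 1] k * D.len (α 3) := by
    have h01 := D.p_mul_len (α 0) (α 1)
    have h12 := D.p_mul_len (α 1) (α 2)
    have h23 := D.p_mul_len (α 2) (α 3)
    simp only [hα _ _] at h01 h12 h23
    simp [CartanMatrix.F₄] at h01 h12 h23
    intro k
    fin_cases k <;> simp <;> linarith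
  have key : ∀ {i : ι} {u}, D.IsCoeff α i u → D.p i j * D.len j = form u v * D.len (α 3) := by
    intro i u hi
    rw [hi j, sum_mul, form, sum_mul]
    refine sum_congr rfl fun k _ ↦ ?_
    rw [mul_assoc, D.p_mul_len, hj, sum_mul, mul_sum, sum_mul]
    refine sum_congr rfl fun m _ ↦ ?_
    have := D.p_mul_len (α m) (α k)
    rw [mul_assoc (v m), this, hα, hl]
    ring
  have h1 := key hi
  have h2 := key hj
  rw [p_self] at h2
  have h3 : (D.p i j * form v v) * D.len (α 3) = (2 * form u v) * D.len (α 3) := by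
    rw [mul_assoc, ← h2, ← mul_assoc, mul_comm (D.p i j), mul_assoc, h1, mul_assoc]
  exact mul_right_cancel₀ (D.len_pos _).ne' h3

/-- An isometry of order three without fixed vectors has a standard form with respect to some
system of simple roots. -/
theorem exists_adapted_quad (hα : D.IsF4Quad α) (hcard : Fintype.card ι ≤ 48) (w : ι → ι)
    (hw : ∀ i j, D.p (w i) (w j) = D.p i j)
    (hw2 : ∀ i k, D.p (w (w i)) k + D.p (w i) k + D.p i k = 0) :
    ∃ β : Fin 4 → ι, D.IsF4Quad β ∧ (∀ k, D.p (w (β 1)) k = D.p (β 0) k + D.p (β 1) k +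
      2 * D.p (β 2) k) ∧ w (β 2) = β 3 := by
  have hself : ∀ i, D.p i (w i) = -1 ∧ D.p (w i) i = -1 := fun i ↦ by
    have h1 := hw2 i i
    have h2 := hw2 i (w i)
    have h3 := hw2 i (w (w i))
    rw [hw, p_self] at h2
    rw [p_self, hw] at h3
    rw [p_self] at h1
    rcases D.table i (w i) with h | h | h | h | h | h | h | h | h
    all_goals try omega
    · rw [← h, p_self] at h2; omega
    · have h4 := D.p_neg_left (w i) (w i)
      have h5 := D.p_neg_right (w i) (w i)
      rw [RootDatum.neg, ← h, p_self] at h4 h5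
      omega
  set a := α 1 with ha
  obtain ⟨vb, hvb, hb⟩ := exists_mem_roots hα hcard (w a)
  have hca : D.IsCoeff α a (Pi.single 1 1) := isCoeff_single 1
  have hfa : form (Pi.single 1 1) (Pi.single 1 1) = 4 := by decide +kernel
  have h1 := hb.p_mul_form hα hca
  have h2 := hca.p_mul_form hα hb
  have hsymm : ∀ u v, form u v = form v u := fun u v ↦ by
    simp [form, Fin.sum_univ_four, CartanMatrix.F₄]; ring
  rw [(hself a).2, hfa] at h1
  rw [(hself a).1, hsymm (Pi.single 1 1)] at h2
  obtain ⟨vc, hvc, hcc, hc1, hcb⟩ := exists_adapted_short_root vb hvb (by omega) (by omega)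
  obtain ⟨c, hc⟩ := exists_isCoeff hα vc hvc
  have hca1 : D.p c a = -1 := by
    have := hc.p_mul_form hα hca
    rw [hfa, hc1] at this; omega
  have hac : D.p a c = -2 := by
    have := hca.p_mul_form hα hc
    rw [hcc, hsymm (Pi.single 1 1), hc1] at this; omega
  have hcb1 : D.p c (w a) = 1 := by
    have := hc.p_mul_form hα hb
    rw [hcb, (by omega : form vb vb = 4)] at this; omega
  have hbc : D.p (w a) c = 2 := by
    have := hb.p_mul_form hα hc
    rw [hcc, hsymm, hcb] at this; omega
  -- `wa - a - 2 * c`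
  let e := D.s a (D.s c (w a))
  have he : ∀ k, D.p e k = D.p (w a) k - D.p a k - 2 * D.p c k := fun k ↦ by
    simp only [e, p_s_left, hbc, hca1, (hself a).2]; ring
  have he' : ∀ k, D.p k e = D.p k (w a) - D.p k a - D.p k c := fun k ↦ by
    simp only [e, p_s_right, hcb1, hac, (hself a).1]; ring
  have hwca : D.p (w c) a = 0 := by
    have h3 := hw2 c (w a)
    rw [hw, hw, hca1, hcb1] at h3
    omega
  have hawc : D.p a (w c) = 0 := by
    have := D.table a (w c)
    rcases this with h | h | h | h | h | h | h | h | h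
    all_goals try omega
    · rw [← h, p_self] at hwca; omega
    · rw [h, p_s_right, p_self] at hwca; omega
  have hawc' : D.p (w a) (w c) = -2 := by rw [hw, hac]
  have hwca' : D.p (w c) (w a) = -1 := by rw [hw, hca1]
  refine ⟨![e, a, c, w c], D.isF4Quad_of e a c (w c) ?_ ?_ hac hca1 (hself c).1 (hself c).2
    ?_ ?_ ?_ ?_ hawc hwca, fun k ↦ ?_, rfl⟩
  · rw [he', (hself a).1, p_self, hac]; norm_num
  · rw [he, (hself a).2, p_self, hca1]; norm_num
  · rw [he, hbc, hac, p_self]; norm_num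
  · rw [he', hcb1, hca1, p_self]; norm_num
  · rw [he, hawc', hawc, (hself c).1]; norm_num
  · rw [he', hwca', hwca, (hself c).2]; norm_num
  · change D.p (w a) k = D.p e k + D.p a k + 2 * D.p c k
    rw [he]; ring

end RootDatum
end JordanF4

namespace JordanF4

open Finset Module

section

variable {ι F M N : Type*} [Field F] [CharZero F] [AddCommGroup M] [Module F M]
  [AddCommGroup N] [Module F N] [Fintype ι] (P : RootPairing ι F M N)
  [P.IsCrystallographic] [P.IsReduced] [P.IsIrreducible]

omit [Fintype ι] [P.IsReduced] in
theorem finrank_mul_sum_weight [FiniteDimensional F M] (O : Finset ι)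
    (hO : ∀ i, ∀ j ∈ O, P.reflectionPerm i j ∈ O) (b : ι) :
    (finrank F M : ℤ) * ∑ a ∈ O, P.pairingIn ℤ a b * P.pairingIn ℤ b a = 4 * #O := by
  let T : M →ₗ[F] M := ∑ a ∈ O, (P.coroot' a).smulRight (P.root a)
  have hT : ∀ x, T x = ∑ a ∈ O, P.coroot' a x • P.root a := fun x ↦ by
    simp [T, LinearMap.sum_apply]
  have hcomm : ∀ i x, T (P.reflection i x) = P.reflection i (T x) := fun i x ↦ by
    rw [hT, hT, map_sum]
    refine Finset.sum_bij' (fun a _ ↦ P.reflectionPerm i a) (fun a _ ↦ P.reflectionPerm i a)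
      (fun a ha ↦ hO i a ha) (fun a ha ↦ hO i a ha) (by simp) (by simp) fun a _ ↦ ?_
    rw [map_smul, P.root_reflectionPerm, P.reflection_same, P.coroot'_reflectionPerm]
    simp
  have hTb : (2 : F) • T (P.root b) = P.coroot' b (T (P.root b)) • P.root b := by
    have h1 := hcomm b (P.root b)
    rw [P.reflection_apply_self, map_neg, P.reflection_apply] at h1
    rw [two_smul]
    rw [eq_sub_iff_add_eq, neg_add_eq_sub] at h1
    rw [← sub_eq_iff_eq_add.mp h1] at *
  set c : F := P.coroot' b (T (P.root b)) / 2 with hc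
  have hTb' : T (P.root b) = c • P.root b := by
    rw [hc, div_eq_inv_mul, mul_smul, ← hTb, inv_smul_smul₀ two_ne_zero]
  have hker : LinearMap.ker (T - c • LinearMap.id) = ⊤ := by
    refine RootPairing.IsIrreducible.eq_top_of_invtSubmodule_reflection (P := P) _
      (fun i x hx ↦ ?_) fun h ↦ ?_
    · simp only [LinearMap.mem_ker, LinearMap.sub_apply, LinearMap.smul_apply, LinearMap.id_apply,
        Submodule.mem_comap, sub_eq_zero] at hx ⊢
      rw [LinearEquiv.coe_coe, hcomm, hx, map_smul]
    · have : P.root b ∈ LinearMap.ker (T - c • LinearMap.id) := by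
        simp [hTb']
      rw [h, Submodule.mem_bot] at this
      exact P.ne_zero b this
  have hTc : T = c • LinearMap.id := by
    rw [LinearMap.ker_eq_top, sub_eq_zero] at hker
    exact hker
  have htr : LinearMap.trace F M T = 2 * #O := by
    simp [T, map_sum, LinearMap.trace_smulRight, mul_comm]
  rw [hTc, map_smul, LinearMap.trace_id, smul_eq_mul, hc, hT, map_sum] at htr
  have : (finrank F M : F) * ∑ a ∈ O, P.pairing a b * P.pairing b a = 4 * #O := by
    simp only [map_smul, RootPairing.root_coroot'_eq_pairing, smul_eq_mul] at htr
    rw [sum_congr rfl fun a _ ↦ mul_comm (P.pairing a b) _]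
    linear_combination 2 * htr
  simp only [← P.algebraMap_pairingIn ℤ, algebraMap_int_eq, eq_intCast] at this
  exact_mod_cast this

theorem algebraMap_int_injective (F : Type*) [Field F] [CharZero F] :
    Function.Injective (algebraMap ℤ F) :=
  FaithfulSMul.algebraMap_injective ℤ F

/-- The combinatorial data of a root system not of type `G₂`. -/
noncomputable def rootDatum [DecidableEq ι] [FiniteDimensional F M]
    (h3 : ∀ i j, P.pairingIn ℤ i j ∈ ({-2, -1, 0, 1, 2} : Set ℤ)) :
    RootDatum ι (finrank F M) where
  p := P.pairingIn ℤ
  s := fun i j ↦ P.reflectionPerm i j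
  len := (P.posRootForm ℤ).rootLength
  p_self i := by simp
  p_s_left i j k := by
    apply algebraMap_int_injective F
    simp only [map_sub, map_mul, P.algebraMap_pairingIn ℤ]
    rw [← P.root_coroot_eq_pairing, P.root_reflectionPerm, P.reflection_apply]
    simp
  p_s_right i j k := by
    apply algebraMap_int_injective F
    simp only [map_sub, map_mul, P.algebraMap_pairingIn ℤ]
    rw [← P.root_coroot_eq_pairing, P.coroot_reflectionPerm, P.coreflection_apply]
    simp
  table i j := by
    have h := P.pairingIn_pairingIn_mem_set_of_isCrystal_of_isRed i j
    have h1 := h3 i j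
    have h2 := h3 j i
    have h4 := P.pairingIn_two_two_iff ℤ i j
    have h5 := P.pairingIn_neg_two_neg_two_iff ℤ i j
    rw [P.root_eq_neg_iff] at h5
    simp only [Set.mem_insert_iff, Set.mem_singleton_iff, Prod.mk.injEq] at h h1 h2
    rw [← h4, ← h5]
    clear h4 h5
    generalize P.pairingIn ℤ i j = x at *
    generalize P.pairingIn ℤ j i = y at *
    rcases h with h | h | h | h | h | h | h | h | h | h | h | h | h <;>
      obtain ⟨rfl, rfl⟩ := h <;> simp at h1 h2 ⊢
  ext i j h := by
    have h1 : P.pairingIn ℤ i j = 2 := by rw [h]; simp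
    have h2 : P.pairingIn ℤ j i = 2 := by rw [← h]; simp
    exact (P.pairingIn_two_two_iff ℤ i j).mp ⟨h1, h2⟩
  len_pos := RootPairing.RootPositiveForm.rootLength_pos _
  len_s i j := by
    apply algebraMap_int_injective F
    rw [RootPairing.RootPositiveForm.algebraMap_rootLength,
      RootPairing.RootPositiveForm.algebraMap_rootLength, P.root_reflectionPerm]
    exact (P.posRootForm ℤ).isOrthogonal_reflection _ _ _
  p_mul_len i j := RootPairing.RootPositiveForm.pairingIn_mul_eq_pairingIn_mul_swap _ _ _
  two_lengths i j k h := by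
    have hinj := algebraMap_int_injective F
    have := (P.posRootForm ℤ).toInvariantForm.apply_eq_or_of_apply_ne (i := i) (j := j)
    simp only [RootPairing.RootPositiveForm.toInvariantForm_form,
      ← RootPairing.RootPositiveForm.algebraMap_rootLength, hinj.eq_iff, ne_eq] at this
    exact this h k
  connected i j := by
    have hinj := algebraMap_int_injective F
    obtain ⟨k, h1, h2⟩ := P.exists_form_eq_form_and_form_ne_zero
      (P.posRootForm ℤ).toInvariantForm i j
    refine ⟨k, ?_, fun h ↦ h2 ?_⟩
    · simpa only [RootPairing.RootPositiveForm.toInvariantForm_form,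
        ← RootPairing.RootPositiveForm.algebraMap_rootLength, hinj.eq_iff] using h1
    · rw [RootPairing.InvariantForm.apply_root_root_zero_iff, ← P.algebraMap_pairingIn ℤ, h,
        map_zero]
  sum_weight O hO b := finrank_mul_sum_weight P O hO b

theorem pairingIn_mem_of_card [FiniteDimensional F M]
    (hcard : Fintype.card ι + finrank F M = 52) :
    ∀ i j, P.pairingIn ℤ i j ∈ ({-2, -1, 0, 1, 2} : Set ℤ) := by
  rw [← P.isNotG2_iff, ← P.not_isG2_iff_isNotG2]
  intro h
  let _ := RootPairing.IsG2.toEmbeddedG2 P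
  have h1 := RootPairing.EmbeddedG2.card_index_eq_twelve P
  have h2 := Module.finrank_eq_card_basis (RootPairing.EmbeddedG2.basis P)
  rw [Nat.card_eq_fintype_card] at h1
  rw [Fintype.card_fin] at h2
  omega

end
end JordanF4

namespace JordanF4

section Isomorphism

variable {K L : Type*} [Field K] [LieRing L] [LieAlgebra K L]

theorem trans_symm_apply_of_graph {P : LieSubalgebra K (L × L)} (E₁ E₂ : P ≃ₗ⁅K⁆ L)
    (x : L × L) (hx : x ∈ P) (h₁ : E₁ ⟨x, hx⟩ = x.1) (h₂ : E₂ ⟨x, hx⟩ = x.2) :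
    E₁.symm.trans E₂ x.1 = x.2 := by
  rw [LieEquiv.trans_apply, ← h₂, ← h₁, LieEquiv.symm_apply_apply]

/-- Two bases of a simple Lie algebra with the same Cartan matrix are conjugate. -/
theorem exists_lieEquiv_of_basis {ι : Type*} [Finite ι] [CharZero K] [FiniteDimensional K L]
    [LieAlgebra.IsSimple K L] {H H' : LieSubalgebra K L} (b : LieAlgebra.Basis ι H)
    (b' : LieAlgebra.Basis ι H') (hA : b.A = b'.A) :
    ∃ φ : L ≃ₗ⁅K⁆ L, ∀ i, φ (b.e i) = b'.e i ∧ φ (b.f i) = b'.f i ∧ φ (b.h i) = b'.h i := by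
  refine ⟨LieAlgebra.Basis.equivOfReindex (Equiv.refl ι) b b' (by simpa using hA), fun i ↦
    ⟨?_, ?_, ?_⟩⟩
  · exact trans_symm_apply_of_graph _ _ (b.e i, b'.e i)
      (LieSubalgebra.subset_lieSpan (Or.inl (Or.inr ⟨i, rfl⟩))) rfl rfl
  · exact trans_symm_apply_of_graph _ _ (b.f i, b'.f i)
      (LieSubalgebra.subset_lieSpan (Or.inr ⟨i, rfl⟩)) rfl rfl
  · exact trans_symm_apply_of_graph _ _ (b.h i, b'.h i)
      (LieSubalgebra.subset_lieSpan (Or.inl (Or.inl ⟨i, rfl⟩))) rfl rfl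

end Isomorphism
end JordanF4

namespace JordanF4

section Killing

open LieAlgebra LieAlgebra.IsKilling LieModule

variable {F L : Type*} [Field F] [CharZero F] [LieRing L] [LieAlgebra F L]
  [FiniteDimensional F L] [IsKilling F L] {H : LieSubalgebra F L} [H.IsCartanSubalgebra]
  [IsTriangularizable F H L]

theorem eq_smul_of_mem_rootSpace {α : Weight F H L} (hα : α.IsNonZero) {x y : L}
    (hx : x ∈ rootSpace H α) (hx0 : x ≠ 0) (hy : y ∈ rootSpace H α) : ∃ c : F, y = c • x := by
  obtain ⟨c, hc⟩ := (finrank_eq_one_iff_of_nonzero' (⟨x, hx⟩ : rootSpace H α)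
    (by simpa using hx0)).mp (finrank_rootSpace_eq_one α hα) ⟨y, hy⟩
  exact ⟨c, by simpa using (congrArg Subtype.val hc).symm⟩

theorem exists_isSl2Triple_coroot {α : Weight F H L} (hα : α.IsNonZero) {e : L}
    (he : e ∈ rootSpace H α) (he0 : e ≠ 0) :
    ∃ f ∈ rootSpace H (-α), IsSl2Triple (coroot α : L) e f := by
  obtain ⟨h, e', f, ht, he', hf⟩ := exists_isSl2Triple_of_weight_isNonZero hα
  obtain ⟨c, rfl⟩ := eq_smul_of_mem_rootSpace hα he' ht.e_ne_zero he
  have hc : c ≠ 0 := by rintro rfl; simp at he0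
  have hh := ht.h_eq_coroot hα he' hf
  refine ⟨c⁻¹ • f, (rootSpace H (-α)).smul_mem _ hf, ?_⟩
  rw [← hh]
  exact
    { h_ne_zero := ht.h_ne_zero
      lie_e_f := by simp [smul_smul, hc, ht.lie_e_f]
      lie_h_e_nsmul := by rw [lie_smul, ht.lie_h_e_nsmul, smul_comm]
      lie_h_f_nsmul := by rw [lie_smul, ht.lie_h_f_nsmul, smul_neg, smul_comm] }

theorem lie_ne_zero_of_mem_rootSpace {α β : Weight F H L} (hα : α.IsNonZero) (hβ : β.IsNonZero)
    (hαβ : rootSpace H (α + β : H → F) ≠ ⊥) {x y : L} (hx : x ∈ rootSpace H α) (hx0 : x ≠ 0)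
    (hy : y ∈ rootSpace H β) (hy0 : y ≠ 0) : ⁅x, y⁆ ≠ 0 := by
  intro h0
  obtain ⟨f, hf, t⟩ := exists_isSl2Triple_coroot hα hx hx0
  have hy1 : ⁅(coroot α : L), y⁆ = β (coroot α) • y := lie_eq_smul_of_mem_rootSpace hy (coroot α)
  obtain ⟨n, hn⟩ := IsSl2Triple.HasPrimitiveVectorWith.exists_nat (R := F) (t := t)
    ⟨hy0, hy1, h0⟩
  obtain ⟨z, hz, hz0⟩ : ∃ z ∈ rootSpace H (α + β : H → F), z ≠ 0 := by
    rw [Ne, LieSubmodule.eq_bot_iff] at hαβ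
    push Not at hαβ
    exact hαβ
  have hα0 : (α : H → F) ≠ 0 := hα
  have hnil : ∃ k, ((toEnd F L L x) ^ k) z = 0 := by
    obtain ⟨k, hk⟩ := LieModule.isNilpotent_toEnd_of_mem_rootSpace (M := L) H hα0 hx
    exact ⟨k, by rw [hk]; rfl⟩
  obtain ⟨k, hk1, hk2⟩ := Nat.exists_not_and_succ_of_not_zero_of_exists (by simpa using hz0) hnil
  set v := ((toEnd F L L x) ^ k) z with hv
  have hvm : v ∈ rootSpace H ((k + 1) • α + β : H → F) := by
    have := toEnd_pow_apply_mem hx hz k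
    rwa [← add_assoc, ← succ_nsmul] at this
  have hvh : ⁅(coroot α : L), v⁆ = (2 * (k + 1) + n : F) • v := by
    have := lie_eq_smul_of_mem_rootSpace hvm (coroot α)
    rw [LieSubalgebra.coe_bracket_of_module] at this
    rw [this]
    simp [root_apply_coroot hα, hn]
    congr 1; ring
  have P : t.HasPrimitiveVectorWith v (2 * (k + 1) + n : F) := ⟨hk1, hvh, by
    rw [pow_succ', Module.End.mul_apply] at hk2; exact hk2⟩
  have key : ∀ i ≤ k + 1, ((toEnd F L L f) ^ i) v ≠ 0 := fun i hi ↦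
    P.pow_toEnd_f_ne_zero_of_eq_nat (n := 2 * (k + 1) + n) (by push_cast; ring) (by omega)
  have hm := toEnd_pow_apply_mem hf hvm (k + 1)
  have hsum : (k + 1) • (-α : H → F) + ((k + 1) • α + β : H → F) = β := by
    rw [smul_neg]; abel
  rw [hsum] at hm
  obtain ⟨c, hc⟩ := eq_smul_of_mem_rootSpace hβ hy hy0 hm
  have h1 := P.lie_e_pow_succ_toEnd_f k
  rw [hc, lie_smul, h0, smul_zero, eq_comm, smul_eq_zero] at h1
  rcases h1 with h1 | h1
  · have : ((k + 1) * (2 * (k + 1) + n - k) : ℤ) = 0 := by exact_mod_cast (by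
      push_cast; linear_combination h1 : (((k + 1) * (2 * (k + 1) + n - k) : ℤ) : F) = 0)
    rcases mul_eq_zero.mp this with h | h <;> omega
  · exact key k (by omega) h1

end Killing
end JordanF4

namespace JordanF4

section Killing

open LieAlgebra LieAlgebra.IsKilling LieModule Module

variable {F L : Type*} [Field F] [CharZero F] [LieRing L] [LieAlgebra F L]
  [FiniteDimensional F L] [IsKilling F L] (H : LieSubalgebra F L) [H.IsCartanSubalgebra]
  [IsTriangularizable F H L]

theorem finrank_eq_card_root_add [Nontrivial L] :
    finrank F L = Fintype.card H.root + finrank F H := by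
  classical
  have h_internal : DirectSum.IsInternal fun χ : Weight F H L ↦ (genWeightSpace L χ).toSubmodule := by
    rw [DirectSum.isInternal_submodule_iff_iSupIndep_and_iSup_eq_top]
    refine ⟨LieSubmodule.iSupIndep_toSubmodule.mpr (iSupIndep_genWeightSpace' F H L), ?_⟩
    rw [← LieSubmodule.iSup_toSubmodule, iSup_genWeightSpace_eq_top' F H L]
    rfl
  rw [← (LinearEquiv.ofBijective (DirectSum.coeLinearMap _) h_internal).finrank_eq,
    Module.finrank_directSum, ← Finset.sum_filter_add_sum_filter_not _ fun χ ↦ χ.IsNonZero]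
  congr 1
  · have h1 : ∀ χ ∈ Finset.univ.filter fun χ : Weight F H L ↦ χ.IsNonZero,
        finrank F (genWeightSpace L χ).toSubmodule = 1 := fun χ hχ ↦
      finrank_rootSpace_eq_one χ (Finset.mem_filter.mp hχ).2
    rw [Finset.sum_congr rfl h1, Finset.sum_const, smul_eq_mul, mul_one, Fintype.card_coe]
  · have h0 : (Finset.univ.filter fun χ : Weight F H L ↦ ¬ χ.IsNonZero) = {0} := by
      ext χ
      rw [Finset.mem_filter_univ, not_not, Finset.mem_singleton]
      exact ⟨fun h ↦ DFunLike.coe_injective h, fun h ↦ congrArg DFunLike.coe h⟩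
    have h1 : (genWeightSpace L (0 : Weight F H L)).toSubmodule = H.toSubmodule :=
      congrArg LieSubmodule.toSubmodule (rootSpace_zero_eq F L H)
    rw [h0, Finset.sum_singleton, h1]
    rfl

end Killing
end JordanF4

namespace JordanF4

section RootSystem

open Module

variable {ι F M N : Type*} [Field F] [AddCommGroup M] [Module F M] [AddCommGroup N] [Module F N]
  (P : RootPairing ι F M N) [P.IsCrystallographic] {α : Fin 4 → ι}

theorem pairing_of_quad (hα : ∀ i j, P.pairingIn ℤ (α i) (α j) = CartanMatrix.F₄ i j)
    (i j : Fin 4) : P.pairing (α i) (α j) = (CartanMatrix.F₄ i j : F) := by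
  rw [← hα, ← P.algebraMap_pairingIn ℤ]; simp

theorem eq_zero_of_sum_F₄ {R : Type*} [CommRing R] (c : Fin 4 → R)
    (h : ∀ j, ∑ i, c i * (CartanMatrix.F₄ i j : R) = 0) : c = 0 := by
  have h0 := h 0
  have h1 := h 1
  have h2 := h 2
  have h3 := h 3
  simp [Fin.sum_univ_four, CartanMatrix.F₄] at h0 h1 h2 h3
  ext j
  fin_cases j
  · simp; linear_combination 2 * h0 + 3 * h1 + 2 * h2 + h3
  · simp; linear_combination 3 * h0 + 6 * h1 + 4 * h2 + 2 * h3
  · simp; linear_combination 4 * h0 + 8 * h1 + 6 * h2 + 3 * h3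
  · simp; linear_combination 2 * h0 + 4 * h1 + 3 * h2 + 2 * h3

theorem eq_zero_of_F₄_sum {R : Type*} [CommRing R] (c : Fin 4 → R)
    (h : ∀ j, ∑ i, c i * (CartanMatrix.F₄ j i : R) = 0) : c = 0 := by
  have h0 := h 0
  have h1 := h 1
  have h2 := h 2
  have h3 := h 3
  simp [Fin.sum_univ_four, CartanMatrix.F₄] at h0 h1 h2 h3
  ext j
  fin_cases j
  · simp; linear_combination 2 * h0 + 3 * h1 + 4 * h2 + 2 * h3
  · simp; linear_combination 3 * h0 + 6 * h1 + 8 * h2 + 4 * h3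
  · simp; linear_combination 2 * h0 + 4 * h1 + 6 * h2 + 3 * h3
  · simp; linear_combination h0 + 2 * h1 + 3 * h2 + 2 * h3

theorem linearIndependent_root_of_quad
    (hα : ∀ i j, P.pairingIn ℤ (α i) (α j) = CartanMatrix.F₄ i j) :
    LinearIndependent F fun i ↦ P.root (α i) := by
  rw [Fintype.linearIndependent_iff]
  intro c hc i
  refine congrFun (eq_zero_of_sum_F₄ c fun j ↦ ?_) i
  have := congrArg (fun x ↦ P.toLinearMap x (P.coroot (α j))) hc
  simpa [pairing_of_quad P hα] using this

theorem linearIndependent_coroot_of_quad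
    (hα : ∀ i j, P.pairingIn ℤ (α i) (α j) = CartanMatrix.F₄ i j) :
    LinearIndependent F fun i ↦ P.coroot (α i) := by
  rw [Fintype.linearIndependent_iff]
  intro c hc i
  refine congrFun (eq_zero_of_F₄_sum c fun j ↦ ?_) i
  have := congrArg (fun x ↦ P.toLinearMap (P.root (α j)) x) hc
  simpa [pairing_of_quad P hα] using this

theorem root_eq_sum [P.IsRootSystem] {v : Fin 4 → ℤ} {i : ι}
    (h : ∀ k, P.pairingIn ℤ i k = ∑ j, v j * P.pairingIn ℤ (α j) k) :
    P.root i = ∑ j, v j • P.root (α j) := by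
  rw [← sub_eq_zero]
  apply P.toPerfPair.injective
  rw [map_zero]
  apply LinearMap.ext_on_range (v := P.coroot) RootPairing.IsRootSystem.span_coroot_eq_top
  intro k
  have := congrArg (algebraMap ℤ F) (h k)
  rw [map_sum, P.algebraMap_pairingIn] at this
  simp only [map_mul, P.algebraMap_pairingIn] at this
  simp [this]

variable [Fintype ι] [DecidableEq ι] [CharZero F] [FiniteDimensional F M] [P.IsReduced]
  [P.IsIrreducible]

theorem card_eq_of_quad (hcard : Fintype.card ι + finrank F M = 52)
    (hα : ∀ i j, P.pairingIn ℤ (α i) (α j) = CartanMatrix.F₄ i j) : Fintype.card ι = 48 := by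
  have := (linearIndependent_root_of_quad P hα).fintype_card_le_finrank
  rw [Fintype.card_fin] at this
  exact RootDatum.card_eq (D := rootDatum P (pairingIn_mem_of_card P hcard)) hα (by omega)

theorem exists_quad (hcard : Fintype.card ι + finrank F M = 52) (hrank : 0 < finrank F M)
    [Nonempty ι] : ∃ α : Fin 4 → ι, ∀ i j, P.pairingIn ℤ (α i) (α j) = CartanMatrix.F₄ i j :=
  RootDatum.exists_isF4Quad (rootDatum P (pairingIn_mem_of_card P hcard)) hcard hrank

end RootSystem
end JordanF4

namespace JordanF4

section Frame

open Module

variable {F L : Type*} [Field F] [LieRing L] [LieAlgebra F L]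

/-- The simultaneous eigenspace of `h` for the weight with coefficients `v` with respect to
simple roots. -/
def wt (h : Fin 4 → L) (v : Fin 4 → ℤ) : Submodule F L where
  carrier := {x | ∀ i, ⁅h i, x⁆ = (cartanInt v i : F) • x}
  add_mem' hx hy i := by rw [lie_add, hx i, hy i, smul_add]
  zero_mem' i := by simp
  smul_mem' c x hx i := by rw [lie_smul, hx i, smul_comm]

variable (F) in
/-- The family `h` consists of the simple coroots of a split Lie algebra of type `F₄`. -/
structure IsFrame (h : Fin 4 → L) : Prop where
  linInd : LinearIndependent F h
  wt_zero : wt (F := F) h 0 = Submodule.span F (Set.range h)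
  finrank_wt : ∀ v ∈ roots, finrank F (wt (F := F) h v) = 1
  iSup_wt : wt (F := F) h 0 ⊔ ⨆ v ∈ roots, wt (F := F) h v = ⊤
  lie_ne_zero : ∀ u ∈ roots, ∀ v ∈ roots, u + v ∈ roots → ∀ x ∈ wt (F := F) h u,
    ∀ y ∈ wt (F := F) h v, x ≠ 0 → y ≠ 0 → ⁅x, y⁆ ≠ 0
  exists_sl2 : ∀ i, ∀ e ∈ wt (F := F) h (Pi.single i 1), e ≠ 0 →
    ∃ f ∈ wt (F := F) h (-Pi.single i 1), IsSl2Triple (h i) e f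

end Frame

section Killing

open LieAlgebra LieAlgebra.IsKilling LieModule Module

variable {F L : Type*} [Field F] [CharZero F] [LieRing L] [LieAlgebra F L]
  [FiniteDimensional F L] [IsKilling F L] {H : LieSubalgebra F L} [H.IsCartanSubalgebra]
  [IsTriangularizable F H L]

/-- The coroots of a family of roots. -/
noncomputable def corootFamily (α : Fin 4 → H.root) (i : Fin 4) : L := (coroot (α i).1 : H)

variable {α : Fin 4 → H.root}

theorem mem_wt_corootFamily (hα : ∀ i j, (rootSystem H).pairingIn ℤ (α i) (α j) =
    CartanMatrix.F₄ i j) {v : Fin 4 → ℤ} {x : L}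
    (hx : x ∈ rootSpace H (∑ j, v j • ((α j).1 : H → F))) : x ∈ wt (F := F) (corootFamily α) v := by
  intro i
  have := lie_eq_smul_of_mem_rootSpace hx (coroot (α i).1)
  rw [LieSubalgebra.coe_bracket_of_module] at this
  rw [corootFamily, this]
  congr 1
  rw [Finset.sum_apply, cartanInt, Int.cast_sum]
  refine Finset.sum_congr rfl fun j _ ↦ ?_
  rw [Int.cast_mul, ← pairing_of_quad _ hα, rootSystem_pairing_apply]
  simp

theorem linearIndependent_corootFamily (hα : ∀ i j, (rootSystem H).pairingIn ℤ (α i) (α j) =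
    CartanMatrix.F₄ i j) : LinearIndependent F (corootFamily α) := by
  have : LinearIndependent F fun i ↦ coroot (α i).1 :=
    linearIndependent_coroot_of_quad (rootSystem H) hα
  exact this.map' H.toSubmodule.subtype (Submodule.ker_subtype _)

theorem span_corootFamily (hα : ∀ i j, (rootSystem H).pairingIn ℤ (α i) (α j) =
    CartanMatrix.F₄ i j) (hH : finrank F H = 4) :
    Submodule.span F (Set.range (corootFamily α)) = H.toSubmodule := by
  refine Submodule.eq_of_le_of_finrank_eq ?_ ?_
  · rw [Submodule.span_le]
    rintro _ ⟨i, rfl⟩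
    exact (coroot (α i).1).2
  · rw [finrank_span_eq_card (linearIndependent_corootFamily hα), Fintype.card_fin]
    exact hH.symm

theorem wt_corootFamily (hα : ∀ i j, (rootSystem H).pairingIn ℤ (α i) (α j) =
    CartanMatrix.F₄ i j) (hH : finrank F H = 4) (v : Fin 4 → ℤ) :
    wt (F := F) (corootFamily α) v =
      (rootSpace H (∑ j, v j • ((α j).1 : H → F))).toSubmodule := by
  refine le_antisymm (fun x hx ↦ ?_) fun x hx ↦ mem_wt_corootFamily hα hx
  suffices h : ∀ y (hy : y ∈ H.toSubmodule),
      ⁅y, x⁆ = (∑ j, v j • ((α j).1 : H → F)) ⟨y, hy⟩ • x by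
    refine LieModule.weightSpace_le_genWeightSpace L _ ?_
    rw [LieModule.mem_weightSpace]
    exact fun y ↦ h y y.2
  obtain ⟨l, hl⟩ : ∃ l : H →ₗ[F] F, ∀ y, (∑ j, v j • ((α j).1 : H → F)) y = l y :=
    ⟨∑ j, v j • Weight.toLinear F H L (α j).1, fun y ↦ by simp⟩
  intro y hy
  have hy' := hy
  rw [← span_corootFamily hα hH] at hy'
  induction hy' using Submodule.span_induction with
  | mem y h =>
    obtain ⟨i, rfl⟩ := h
    rw [hx i]
    congr 1
    rw [Finset.sum_apply, cartanInt, Int.cast_sum]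
    refine Finset.sum_congr rfl fun j _ ↦ ?_
    rw [Int.cast_mul, ← pairing_of_quad _ hα, rootSystem_pairing_apply]
    simp [corootFamily]
  | zero =>
    have : (⟨0, hy⟩ : H) = 0 := rfl
    rw [hl, this, map_zero, zero_lie, zero_smul]
  | add y z h1 h2 ih1 ih2 =>
    rw [span_corootFamily hα hH] at h1 h2
    have : (⟨y + z, hy⟩ : H) = ⟨y, h1⟩ + ⟨z, h2⟩ := rfl
    rw [hl, this, map_add, add_lie, ih1 h1, ih2 h2, hl, hl, add_smul]
  | smul c y h1 ih1 =>
    rw [span_corootFamily hα hH] at h1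
    have : (⟨c • y, hy⟩ : H) = c • ⟨y, h1⟩ := rfl
    rw [hl, this, map_smul, smul_lie, ih1 h1, hl, smul_smul, smul_eq_mul]

end Killing
end JordanF4

namespace JordanF4

section RootSystem

open Module

variable {ι F M N : Type*} [Fintype ι] [DecidableEq ι] [Field F] [CharZero F]
  [AddCommGroup M] [Module F M] [AddCommGroup N] [Module F N] (P : RootPairing ι F M N)
  [P.IsRootSystem] [P.IsCrystallographic] [P.IsReduced] [P.IsIrreducible] [FiniteDimensional F M]
  {α : Fin 4 → ι}

theorem exists_root_eq_sum (hcard : Fintype.card ι + finrank F M = 52)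
    (hα : ∀ i j, P.pairingIn ℤ (α i) (α j) = CartanMatrix.F₄ i j) {v : Fin 4 → ℤ}
    (hv : v ∈ roots) : ∃ i, P.root i = ∑ j, v j • P.root (α j) := by
  obtain ⟨i, hi⟩ := RootDatum.exists_isCoeff (D := rootDatum P (pairingIn_mem_of_card P hcard))
    hα v hv
  exact ⟨i, root_eq_sum P hi⟩

theorem exists_mem_roots_root_eq_sum (hcard : Fintype.card ι + finrank F M = 52)
    (hα : ∀ i j, P.pairingIn ℤ (α i) (α j) = CartanMatrix.F₄ i j) (i : ι) :
    ∃ v ∈ roots, P.root i = ∑ j, v j • P.root (α j) := by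
  obtain ⟨v, hv, hi⟩ := RootDatum.exists_mem_roots
    (D := rootDatum P (pairingIn_mem_of_card P hcard)) hα (card_eq_of_quad P hcard hα).le i
  exact ⟨v, hv, root_eq_sum P hi⟩

end RootSystem

section Root

open LieAlgebra LieModule

variable {F L : Type*} [Field F] [LieRing L] [LieAlgebra F L] [FiniteDimensional F L]
  {H : LieSubalgebra F L} [H.IsCartanSubalgebra]

theorem isNonZero_of_mem_root (i : H.root) : (i.1).IsNonZero :=
  (Finset.mem_filter.mp i.2).2

end Root

section Killing

open LieAlgebra LieAlgebra.IsKilling LieModule Module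

variable {F L : Type*} [Field F] [CharZero F] [LieRing L] [LieAlgebra F L]
  [FiniteDimensional F L] [IsKilling F L] (H : LieSubalgebra F L)
  [H.IsCartanSubalgebra] [IsTriangularizable F H L]

theorem card_root_add_finrank_dual (hdim : finrank F L = 52) :
    Fintype.card H.root + finrank F (Dual F H) = 52 := by
  have : Nontrivial L := nontrivial_of_finrank_pos (R := F) (by omega)
  rw [Subspace.dual_finrank_eq, ← hdim, finrank_eq_card_root_add H]

variable [IsSimple F L] {H} {α : Fin 4 → H.root}

theorem finrank_cartan_eq_four (hdim : finrank F L = 52)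
    (hα : ∀ i j, (rootSystem H).pairingIn ℤ (α i) (α j) = CartanMatrix.F₄ i j) :
    finrank F H = 4 := by
  classical
  have h := card_root_add_finrank_dual H hdim
  have := card_eq_of_quad (rootSystem H) h hα
  rw [Subspace.dual_finrank_eq] at h
  omega

theorem exists_weight_eq_sum (hdim : finrank F L = 52)
    (hα : ∀ i j, (rootSystem H).pairingIn ℤ (α i) (α j) = CartanMatrix.F₄ i j)
    {v : Fin 4 → ℤ} (hv : v ∈ roots) :
    ∃ i : H.root, (i.1 : H → F) = ∑ j, v j • ((α j).1 : H → F) := by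
  classical
  obtain ⟨i, hi⟩ := exists_root_eq_sum (rootSystem H) (card_root_add_finrank_dual H hdim) hα hv
  refine ⟨i, funext fun y ↦ ?_⟩
  simpa using congr($hi y)

theorem exists_mem_roots_weight_eq_sum (hdim : finrank F L = 52)
    (hα : ∀ i j, (rootSystem H).pairingIn ℤ (α i) (α j) = CartanMatrix.F₄ i j) (i : H.root) :
    ∃ v ∈ roots, (i.1 : H → F) = ∑ j, v j • ((α j).1 : H → F) := by
  classical
  obtain ⟨v, hv, hi⟩ := exists_mem_roots_root_eq_sum (rootSystem H)
    (card_root_add_finrank_dual H hdim) hα i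
  refine ⟨v, hv, funext fun y ↦ ?_⟩
  simpa using congr($hi y)

theorem isFrame_corootFamily (hdim : finrank F L = 52)
    (hα : ∀ i j, (rootSystem H).pairingIn ℤ (α i) (α j) = CartanMatrix.F₄ i j) :
    IsFrame F (corootFamily α) := by
  have hH := finrank_cartan_eq_four hdim hα
  have hw := wt_corootFamily hα hH
  have h0 : wt (F := F) (corootFamily α) 0 = H.toSubmodule := by
    rw [hw]
    simp
  refine ⟨linearIndependent_corootFamily hα, ?_, fun v hv ↦ ?_, ?_, ?_, ?_⟩
  · rw [h0, span_corootFamily hα hH]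
  · obtain ⟨i, hi⟩ := exists_weight_eq_sum hdim hα hv
    rw [hw, ← hi]
    exact finrank_rootSpace_eq_one i.1 (isNonZero_of_mem_root i)
  · rw [eq_top_iff]
    have htop : (⊤ : Submodule F L) = ⨆ χ : Weight F H L, (genWeightSpace L χ).toSubmodule := by
      rw [← LieSubmodule.iSup_toSubmodule, iSup_genWeightSpace_eq_top' F H L]
      rfl
    rw [htop, iSup_le_iff]
    intro χ
    by_cases hχ : χ.IsNonZero
    · obtain ⟨v, hv, h⟩ := exists_mem_roots_weight_eq_sum hdim hα ⟨χ, by simpa using hχ⟩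
      refine le_trans ?_ le_sup_right
      refine le_trans ?_ (le_iSup₂ v hv)
      rw [hw, ← h]
    · refine le_trans ?_ le_sup_left
      have : (χ : H → F) = 0 := not_not.mp hχ
      rw [h0, this]
      exact (congrArg LieSubmodule.toSubmodule (rootSpace_zero_eq F L H)).le
  · intro u hu v hv huv x hx y hy hx0 hy0
    obtain ⟨i, hi⟩ := exists_weight_eq_sum hdim hα hu
    obtain ⟨j, hj⟩ := exists_weight_eq_sum hdim hα hv
    obtain ⟨k, hk⟩ := exists_weight_eq_sum hdim hα huv
    rw [hw, ← hi] at hx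
    rw [hw, ← hj] at hy
    refine lie_ne_zero_of_mem_rootSpace (isNonZero_of_mem_root i) (isNonZero_of_mem_root j) ?_
      hx hx0 hy hy0
    have : (i.1 : H → F) + j.1 = k.1 := by
      rw [hi, hj, hk, ← Finset.sum_add_distrib]
      simp [add_smul]
    rw [this]
    exact k.1.genWeightSpace_ne_bot
  · intro i e he he0
    have h1 : ∀ (c : ℤ), ∑ j, (c • Pi.single i 1 : Fin 4 → ℤ) j • ((α j).1 : H → F) =
        c • ((α i).1 : H → F) := fun c ↦ by
      simp [Pi.single_apply, ite_smul]
    have h2 := h1 1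
    have h3 := h1 (-1)
    rw [one_smul, one_smul] at h2
    rw [neg_one_smul, neg_one_smul] at h3
    rw [hw, h2] at he
    rw [hw, h3]
    exact exists_isSl2Triple_coroot (isNonZero_of_mem_root (α i)) he he0

end Killing
end JordanF4

namespace JordanF4

/-- The action on coefficients of a fixed-point-free automorphism of order three of the root
system of type `F₄`. -/
def rot (v : Fin 4 → ℤ) : Fin 4 → ℤ :=
  ![-2 * v 0 + v 1, -3 * v 0 + v 1, -4 * v 0 + 2 * v 1 - v 3, -2 * v 0 + v 2 - v 3]

theorem rot_mem_roots : ∀ v ∈ roots, rot v ∈ roots := by decide +kernel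

theorem rot_rot_add (v : Fin 4 → ℤ) : rot (rot v) + rot v + v = 0 := by
  ext i
  fin_cases i <;> simp [rot] <;> ring

theorem rot_rot_rot (v : Fin 4 → ℤ) : rot (rot (rot v)) = v := by
  ext i
  fin_cases i <;> simp [rot] <;> ring

theorem form_rot_single (i j : Fin 4) : form (rot (Pi.single i 1)) (rot (Pi.single j 1)) =
    form (Pi.single i 1) (Pi.single j 1) := by decide +revert +kernel

section RootSystem

open Module

variable {ι F M N : Type*} [Fintype ι] [Field F] [CharZero F]
  [AddCommGroup M] [Module F M] [AddCommGroup N] [Module F N] (P : RootPairing ι F M N)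
  [P.IsRootSystem] [P.IsCrystallographic] [P.IsReduced] [P.IsIrreducible] [FiniteDimensional F M]
  {α : Fin 4 → ι}

theorem exists_quad_rot (hcard : Fintype.card ι + finrank F M = 52)
    (hα : ∀ i j, P.pairingIn ℤ (α i) (α j) = CartanMatrix.F₄ i j) :
    ∃ β : Fin 4 → ι, (∀ i j, P.pairingIn ℤ (β i) (β j) = CartanMatrix.F₄ i j) ∧
      ∀ i, P.root (β i) = ∑ j, rot (Pi.single i 1) j • P.root (α j) := by
  classical
  let D := rootDatum P (pairingIn_mem_of_card P hcard)
  have hs : ∀ i : Fin 4, rot (Pi.single i 1) ∈ roots := fun i ↦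
    rot_mem_roots _ (single_mem_roots i)
  choose β hβ using fun i ↦ RootDatum.exists_isCoeff (D := D) hα _ (hs i)
  refine ⟨β, fun i j ↦ ?_, fun i ↦ root_eq_sum P (hβ i)⟩
  have h1 := RootDatum.IsCoeff.p_mul_form (D := D) hα (hβ i) (hβ j)
  have h2 := RootDatum.IsCoeff.p_mul_form (D := D) hα (RootDatum.isCoeff_single i)
    (RootDatum.isCoeff_single j)
  rw [form_rot_single, form_rot_single, ← h2] at h1
  rw [← hα]
  refine mul_right_cancel₀ ?_ h1
  exact (by decide +kernel : ∀ j : Fin 4, form (Pi.single j 1) (Pi.single j 1) ≠ 0) j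

end RootSystem

section Killing

open LieAlgebra LieAlgebra.IsKilling LieModule Module

variable {F L : Type*} [Field F] [LieRing L] [LieAlgebra F L] [FiniteDimensional F L]

section Map

variable {H : LieSubalgebra F L} [LieRing.IsNilpotent H]

theorem map_mem_genWeightSpace [CharZero F] [IsKilling F L] [H.IsCartanSubalgebra]
    [IsTriangularizable F H L] (θ : L ≃ₗ⁅F⁆ L) (T : H →ₗ[F] H) (hT : ∀ y, (T y : L) = θ y)
    (hT3 : ∀ y, T (T (T y)) = y) {χ ψ : H → F} (hψ : ∀ y, ψ y = χ (T (T y))) {x : L}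
    (hx : x ∈ rootSpace H χ) : θ x ∈ rootSpace H ψ := by
  refine LieModule.weightSpace_le_genWeightSpace L _ ?_
  rw [LieModule.mem_weightSpace]
  intro y
  have := lie_eq_smul_of_mem_rootSpace hx (T (T y))
  rw [LieSubalgebra.coe_bracket_of_module] at this ⊢
  rw [hψ, ← map_smul, ← this, LieEquiv.map_lie, ← hT, hT3]

end Map

variable [CharZero F] [IsKilling F L]

theorem exists_root_map [Nontrivial L] {H : LieSubalgebra F L} [H.IsCartanSubalgebra]
    [IsTriangularizable F H L] (θ : L ≃ₗ⁅F⁆ L) (T : H →ₗ[F] H) (hT : ∀ y, (T y : L) = θ y)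
    (hT3 : ∀ y, T (T (T y)) = y) (i : H.root) : ∃ j : H.root, (∀ y, j.1 y = i.1 (T (T y))) ∧
      coroot j.1 = T (coroot i.1) := by
  obtain ⟨e, he, he0⟩ := i.1.exists_ne_zero
  obtain ⟨f, hf, t⟩ := exists_isSl2Triple_coroot (isNonZero_of_mem_root i) he he0
  obtain ⟨ψ, hψ⟩ : ∃ ψ : H → F, ∀ y, ψ y = i.1 (T (T y)) := ⟨_, fun _ ↦ rfl⟩
  have hψe : θ e ∈ rootSpace H ψ := map_mem_genWeightSpace θ T hT hT3 hψ he
  have hψf : θ f ∈ rootSpace H (-ψ) :=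
    map_mem_genWeightSpace θ T hT hT3 (fun y ↦ congrArg Neg.neg (hψ y)) hf
  have hθe : θ e ≠ 0 := by simpa using he0
  let j : Weight F H L := ⟨ψ, fun h ↦ hθe ((LieSubmodule.mem_bot _).mp (h.le hψe))⟩
  have hj : j.IsNonZero := by
    intro h
    refine isNonZero_of_mem_root i (funext fun y ↦ ?_)
    have := congrFun (show ψ = 0 from h) (T y)
    rw [hψ, hT3] at this
    exact this
  refine ⟨⟨j, Finset.mem_filter.mpr ⟨Finset.mem_univ _, hj⟩⟩, hψ, ?_⟩
  have ht : IsSl2Triple (θ (coroot i.1 : H)) (θ e) (θ f) := by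
    refine ⟨by simp, ?_, ?_, ?_⟩
    · rw [← LieEquiv.map_lie, t.lie_e_f]
    · rw [← LieEquiv.map_lie, t.lie_h_e_nsmul, map_nsmul]
    · rw [← LieEquiv.map_lie, t.lie_h_f_nsmul, map_neg, map_nsmul]
  have := ht.h_eq_coroot hj hψe hψf
  rw [← hT] at this
  exact (Subtype.ext this).symm

variable [IsSimple F L]

theorem exists_quad_cartan {H : LieSubalgebra F L} [H.IsCartanSubalgebra]
    [IsTriangularizable F H L] (hdim : finrank F L = 52) :
    ∃ α : Fin 4 → H.root, ∀ i j, (rootSystem H).pairingIn ℤ (α i) (α j) =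
      CartanMatrix.F₄ i j := by
  classical
  have : Nontrivial (Dual F H) := RootPairing.IsIrreducible.nontrivial (P := rootSystem H)
  have : Nonempty H.root := by
    by_contra hn
    rw [not_nonempty_iff] at hn
    have := RootPairing.IsRootSystem.span_root_eq_top (P := rootSystem H)
    rw [Set.range_eq_empty, Submodule.span_empty] at this
    exact bot_ne_top this
  exact exists_quad (rootSystem H) (card_root_add_finrank_dual H hdim) finrank_pos

theorem exists_isFrame_rot [IsAlgClosed F] (hdim : finrank F L = 52) :
    ∃ h h' : Fin 4 → L, IsFrame F h ∧ IsFrame F h' ∧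
      ∀ v, wt (F := F) h' v = wt h (rot v) := by
  obtain ⟨x, hx⟩ := exists_isCartanSubalgebra_engel F L
  set H := LieSubalgebra.engel F x
  obtain ⟨α, hα⟩ := exists_quad_cartan hdim (H := H)
  obtain ⟨β, hβ, hβα⟩ := exists_quad_rot (rootSystem H) (card_root_add_finrank_dual H hdim) hα
  refine ⟨_, _, isFrame_corootFamily hdim hα, isFrame_corootFamily hdim hβ, fun v ↦ ?_⟩
  rw [wt_corootFamily hα (finrank_cartan_eq_four hdim hα),
    wt_corootFamily hβ (finrank_cartan_eq_four hdim hβ)]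
  congr 2
  funext y
  have h1 : ∀ i, (β i).1 y = ∑ j, (rot (Pi.single i 1) j : F) * (α j).1 y := fun i ↦ by
    simpa using congr($(hβα i) y)
  simp only [Finset.sum_apply, Pi.smul_apply, h1, Fin.sum_univ_four]
  simp [rot]
  ring

theorem exists_isFrame_map {H : LieSubalgebra F L} [H.IsCartanSubalgebra]
    [IsTriangularizable F H L] (hdim : finrank F L = 52) (θ : L ≃ₗ⁅F⁆ L) (T : H →ₗ[F] H)
    (hT : ∀ y, (T y : L) = θ y) (hT2 : ∀ y, T (T y) + T y + y = 0) :
    ∃ h : Fin 4 → L, IsFrame F h ∧ Submodule.span F (Set.range h) = H.toSubmodule ∧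
      ∀ v, ∀ x ∈ wt (F := F) h v, θ x ∈ wt (F := F) h (rot v) := by
  classical
  have hT3 : ∀ y, T (T (T y)) = y := fun y ↦ by
    have h1 := hT2 (T y)
    have h2 := hT2 y
    rw [← sub_eq_zero, ← sub_eq_zero.mpr (h1.trans h2.symm)]
    abel
  have : Nontrivial L := nontrivial_of_finrank_pos (R := F) (by omega)
  choose w hw hw' using exists_root_map θ T hT hT3
  let P := rootSystem H
  have hp : ∀ i j, P.pairingIn ℤ (w i) (w j) = P.pairingIn ℤ i j := fun i j ↦ by
    refine algebraMap_int_injective F ?_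
    rw [P.algebraMap_pairingIn ℤ, P.algebraMap_pairingIn ℤ, rootSystem_pairing_apply,
      rootSystem_pairing_apply, hw, hw', hT3]
  have hlin : ∀ (i : H.root) y, i.1 (T (T y)) = - i.1 (T y) - i.1 y := fun i y ↦ by
    have h := congrArg (Weight.toLinear F H L i.1) (hT2 y)
    rw [map_add, map_add, map_zero] at h
    change i.1 _ + i.1 _ + i.1 _ = 0 at h
    linear_combination h
  have hww : ∀ i y, (w (w i)).1 y + (w i).1 y + i.1 y = 0 := fun i y ↦ by
    rw [hw, hw, hw, hT3, hlin]
    ring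
  obtain ⟨α, hα⟩ := exists_quad_cartan hdim (H := H)
  have hcard := card_root_add_finrank_dual H hdim
  obtain ⟨β, hβ, h1, h2⟩ := RootDatum.exists_adapted_quad
    (D := rootDatum P (pairingIn_mem_of_card P hcard)) hα (card_eq_of_quad P hcard hα).le w hp
    fun i k ↦ algebraMap_int_injective F (by
      change algebraMap ℤ F (P.pairingIn ℤ _ _ + P.pairingIn ℤ _ _ + P.pairingIn ℤ _ _) = _
      rw [map_add, map_add, P.algebraMap_pairingIn ℤ, P.algebraMap_pairingIn ℤ,
        P.algebraMap_pairingIn ℤ, map_zero]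
      simpa [P] using hww i (coroot k.1))
  have hw1 : ∀ y, (β 1).1 (T (T y)) = (β 0).1 y + (β 1).1 y + 2 * (β 2).1 y := fun y ↦ by
    have := root_eq_sum P (α := β) (i := w (β 1)) (v := ![1, 1, 2, 0]) fun k ↦ by
      rw [Fin.sum_univ_four]
      have : P.pairingIn ℤ (w (β 1)) k = P.pairingIn ℤ (β 0) k + P.pairingIn ℤ (β 1) k +
        2 * P.pairingIn ℤ (β 2) k := h1 k
      simpa using this
    rw [← hw]
    have := congr($this y)
    simpa [Fin.sum_univ_four, P] using this
  have hw2 : ∀ y, (β 2).1 (T (T y)) = (β 3).1 y := fun y ↦ by rw [← hw, h2]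
  have hw2' : ∀ y, (β 2).1 (T y) = - (β 2).1 y - (β 3).1 y := fun y ↦ by
    linear_combination hlin (β 2) y - hw2 y
  have hw3 : ∀ y, (β 3).1 (T (T y)) = - (β 2).1 y - (β 3).1 y := fun y ↦ by
    rw [← hw2, hT3, hw2']
  have hw0 : ∀ y, (β 0).1 (T (T y)) =
      - 2 * (β 0).1 y - 3 * (β 1).1 y - 4 * (β 2).1 y - 2 * (β 3).1 y := fun y ↦ by
    have h3 := hw1 (T (T y))
    rw [hT3] at h3
    linear_combination - h3 + hlin (β 1) y - 2 * hw1 y - 2 * hw2 y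
  have hH := finrank_cartan_eq_four hdim hβ
  refine ⟨_, isFrame_corootFamily hdim hβ, span_corootFamily hβ hH, fun v x hx ↦ ?_⟩
  rw [wt_corootFamily hβ hH] at hx ⊢
  refine map_mem_genWeightSpace θ T hT hT3 (fun y ↦ ?_) hx
  simp only [Finset.sum_apply, Pi.smul_apply, Fin.sum_univ_four, hw0, hw1, hw2, hw3]
  simp [rot]
  ring

end Killing

end JordanF4

namespace JordanF4

section Eigen

variable {F V ι κ : Type*} [Field F] [AddCommGroup V] [Module F V]

theorem iSupIndep_of_eigen (T : κ → V →ₗ[F] V) (χ : ι → κ → F) (hχ : Function.Injective χ)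
    (p : ι → Submodule F V) (hp : ∀ i k, ∀ x ∈ p i, T k x = χ i k • x) : iSupIndep p := by
  classical
  rw [iSupIndep_iff_finsetSum_eq_zero_imp_eq_zero]
  intro s
  induction s using Finset.induction_on with
  | empty => simp
  | insert a s ha ih =>
    intro v hv h
    have hs : ∀ i ∈ s, v i = 0 := fun i hi ↦ by
      have hne : χ i ≠ χ a := fun h ↦ ha (hχ h ▸ hi)
      obtain ⟨k, hk⟩ := Function.ne_iff.mp hne
      have h1 := ih (fun j ↦ (χ j k - χ a k) • v j)
        (fun j hj ↦ (p j).smul_mem _ (hv j (Finset.mem_insert_of_mem hj))) (by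
          have h2 := congrArg (fun x ↦ T k x - χ a k • x) h
          simp only [map_sum, Finset.smul_sum, ← Finset.sum_sub_distrib, map_zero, smul_zero,
            sub_zero] at h2
          rw [Finset.sum_insert ha, hp a k _ (hv a (Finset.mem_insert_self _ _)), sub_self,
            zero_add] at h2
          rw [← h2]
          refine Finset.sum_congr rfl fun j hj ↦ ?_
          rw [hp j k _ (hv j (Finset.mem_insert_of_mem hj)), sub_smul]) i hi
      exact (smul_eq_zero.mp h1).resolve_left (sub_ne_zero.mpr hk)
    rw [Finset.sum_insert ha, Finset.sum_eq_zero hs, add_zero] at h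
    intro i hi
    rcases Finset.mem_insert.mp hi with rfl | hi
    exacts [h, hs i hi]

theorem iSupIndep_fiber {p : ι → Submodule F V} (hp : iSupIndep p) (f : ι → κ) :
    iSupIndep fun k ↦ ⨆ i, ⨆ _ : f i = k, p i := by
  intro k
  have h1 : Disjoint {i | f i = k} {i | f i ≠ k} :=
    Set.disjoint_left.mpr fun i h1 h2 ↦ h2 h1
  refine (hp.disjoint_biSup_biSup h1).mono_right ?_
  refine iSup₂_le fun j hj ↦ iSup₂_le fun i hi ↦ ?_
  exact le_iSup₂_of_le (f := fun i (_ : i ∈ {i | f i ≠ k}) ↦ p i) i (by simpa [hi] using hj) le_rfl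

end Eigen

theorem cartanInt_add (u v : Fin 4 → ℤ) (i : Fin 4) :
    cartanInt (u + v) i = cartanInt u i + cartanInt v i := by
  simp [cartanInt, add_mul, Finset.sum_add_distrib]

theorem cartanInt_neg (v : Fin 4 → ℤ) (i : Fin 4) : cartanInt (-v) i = -cartanInt v i := by
  simp [cartanInt]

theorem cartanInt_single (i j : Fin 4) : cartanInt (Pi.single i 1) j = CartanMatrix.F₄ i j := by
  simp [cartanInt, Pi.single_apply]

theorem cartanInt_injective : Function.Injective cartanInt := fun u v h ↦ by
  rw [← sub_eq_zero]
  refine eq_zero_of_sum_F₄ _ fun j ↦ ?_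
  have := congrFun h j
  simp only [cartanInt] at this
  simp [sub_mul, this]

section Frame

open Module

variable {F L : Type*} [Field F] [LieRing L] [LieAlgebra F L]

theorem lie_mem_wt {h : Fin 4 → L} {u v : Fin 4 → ℤ} {x y : L} (hx : x ∈ wt (F := F) h u)
    (hy : y ∈ wt (F := F) h v) : ⁅x, y⁆ ∈ wt (F := F) h (u + v) := fun i ↦ by
  rw [leibniz_lie, hx i, hy i, smul_lie, lie_smul, ← add_smul, cartanInt_add, Int.cast_add]

theorem map_mem_wt {h h' : Fin 4 → L} (φ : L ≃ₗ⁅F⁆ L) (hφ : ∀ i, φ (h i) = h' i)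
    {v : Fin 4 → ℤ} {x : L} (hx : x ∈ wt (F := F) h v) : φ x ∈ wt (F := F) h' v := fun i ↦ by
  rw [← hφ, ← LieEquiv.map_lie, hx i, map_smul]

theorem killingForm_eq_zero_of_mem_wt [CharZero F] {h : Fin 4 → L} {u v : Fin 4 → ℤ}
    (huv : u + v ≠ 0) {x y : L} (hx : x ∈ wt (F := F) h u) (hy : y ∈ wt (F := F) h v) :
    killingForm F L x y = 0 := by
  obtain ⟨i, hi⟩ : ∃ i, cartanInt (u + v) i ≠ 0 := by
    by_contra! hc
    refine huv (cartanInt_injective (funext fun i ↦ ?_))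
    rw [hc]
    simp [cartanInt]
  have h1 : killingForm F L ⁅h i, x⁆ y = - killingForm F L x ⁅h i, y⁆ :=
    LieModule.traceForm_apply_lie_apply' F L L _ _ _
  rw [hx i, hy i, map_smul, map_smul, LinearMap.smul_apply, smul_eq_mul, smul_eq_mul] at h1
  have h2 : (cartanInt (u + v) i : F) * killingForm F L x y = 0 := by
    rw [cartanInt_add, Int.cast_add]
    linear_combination h1
  exact (mul_eq_zero.mp h2).resolve_left (by exact_mod_cast hi)

theorem iSupIndep_wt [CharZero F] (h : Fin 4 → L) : iSupIndep (wt (F := F) h) := by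
  refine iSupIndep_of_eigen (fun i ↦ LieAlgebra.ad F L (h i))
    (fun v i ↦ (cartanInt v i : F)) (fun u v huv ↦ cartanInt_injective (funext fun i ↦ ?_)) _ ?_
  · have := congrFun huv i
    simpa using this
  · exact fun v i x hx ↦ hx i

namespace IsFrame

variable {h h' : Fin 4 → L} (hh : IsFrame F h)

include hh

theorem mem_wt_zero (i : Fin 4) : h i ∈ wt (F := F) h 0 := by
  rw [hh.wt_zero]
  exact Submodule.subset_span ⟨i, rfl⟩

theorem lie_h_h (i j : Fin 4) : ⁅h i, h j⁆ = 0 := by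
  rw [hh.mem_wt_zero j i]
  simp [cartanInt]

theorem exists_ne_zero {v : Fin 4 → ℤ} (hv : v ∈ roots) : ∃ x ∈ wt (F := F) h v, x ≠ 0 := by
  by_contra! hc
  have h1 := hh.finrank_wt v hv
  rw [(Submodule.eq_bot_iff _).mpr hc, finrank_bot] at h1
  exact zero_ne_one h1

theorem exists_eq_smul {v : Fin 4 → ℤ} (hv : v ∈ roots) {x y : L} (hx : x ∈ wt (F := F) h v)
    (hx0 : x ≠ 0) (hy : y ∈ wt (F := F) h v) : ∃ c : F, y = c • x := by
  obtain ⟨c, hc⟩ := (finrank_eq_one_iff_of_nonzero' (⟨x, hx⟩ : wt (F := F) h v)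
    (by simpa using hx0)).mp (hh.finrank_wt v hv) ⟨y, hy⟩
  exact ⟨c, by simpa using (congrArg Subtype.val hc).symm⟩

theorem wt_le_of_mem {v : Fin 4 → ℤ} (hv : v ∈ roots) {x : L} (hx : x ∈ wt (F := F) h v)
    (hx0 : x ≠ 0) {p : Submodule F L} (hp : x ∈ p) : wt h v ≤ p := fun y hy ↦ by
  obtain ⟨c, rfl⟩ := hh.exists_eq_smul hv hx hx0 hy
  exact p.smul_mem c hp

theorem wt_eq_bot [CharZero F] {v : Fin 4 → ℤ} (hv : v ∉ roots) (hv0 : v ≠ 0) :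
    wt (F := F) h v = ⊥ := by
  have h1 := iSupIndep_wt (F := F) h v
  have h2 : (⊤ : Submodule F L) ≤ ⨆ u, ⨆ _ : u ≠ v, wt (F := F) h u := by
    rw [← hh.iSup_wt]
    refine sup_le (le_iSup₂_of_le 0 hv0.symm le_rfl) (iSup₂_le fun u hu ↦ ?_)
    exact le_iSup₂_of_le u (fun h ↦ hv (h ▸ hu)) le_rfl
  rw [top_le_iff.mp h2, disjoint_top] at h1
  exact h1

theorem wt_posRoots_le {e : Fin 4 → L} (σ : ℤ) (hσ : σ = 1 ∨ σ = -1)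
    (he : ∀ i, e i ∈ wt (F := F) h (σ • Pi.single i 1))
    (he0 : ∀ i, e i ≠ 0) {S : LieSubalgebra F L} (hS : ∀ i, e i ∈ S) :
    ∀ v ∈ posRoots, wt h (σ • v) ≤ S.toSubmodule := by
  have hroot : ∀ v ∈ posRoots, σ • v ∈ roots := fun v hv ↦ by
    have h1 : v ∈ roots := List.mem_append_left _ hv
    rcases hσ with rfl | rfl
    · rwa [one_smul]
    · rw [neg_one_smul]
      exact neg_mem_roots v h1
  refine posRoots_induction (fun m ↦ ?_) fun u hu m hum ih ↦ ?_
  · exact hh.wt_le_of_mem (hroot _ (single_mem_posRoots m)) (he m) (he0 m) (hS m)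
  · obtain ⟨x, hx, hx0⟩ := hh.exists_ne_zero (hroot u hu)
    have hr := hroot _ hum
    rw [smul_add] at hr ⊢
    exact hh.wt_le_of_mem hr (lie_mem_wt hx (he m))
      (hh.lie_ne_zero _ (hroot u hu) _ (hroot _ (single_mem_posRoots m)) hr _ hx _ (he m) hx0
        (he0 m)) (S.lie_mem (ih hx) (hS m))

theorem eq_top_of_mem {e f : Fin 4 → L} (he : ∀ i, e i ∈ wt (F := F) h (Pi.single i 1))
    (hf : ∀ i, f i ∈ wt (F := F) h (-Pi.single i 1)) (ht : ∀ i, IsSl2Triple (h i) (e i) (f i))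
    {S : LieSubalgebra F L} (heS : ∀ i, e i ∈ S) (hfS : ∀ i, f i ∈ S) : S = ⊤ := by
  have hpos := hh.wt_posRoots_le 1 (.inl rfl) (by simpa using he) (fun i ↦ (ht i).e_ne_zero) heS
  have hneg := hh.wt_posRoots_le (-1) (.inr rfl) (by simpa using hf) (fun i ↦ (ht i).f_ne_zero) hfS
  rw [← LieSubalgebra.toSubmodule_inj, LieSubalgebra.top_toSubmodule, eq_top_iff, ← hh.iSup_wt]
  refine sup_le ?_ (iSup₂_le fun v hv ↦ ?_)
  · rw [hh.wt_zero, Submodule.span_le]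
    rintro _ ⟨i, rfl⟩
    rw [← (ht i).lie_e_f]
    exact S.lie_mem (heS i) (hfS i)
  · rcases List.mem_append.mp hv with hv | hv
    · simpa using hpos v hv
    · obtain ⟨u, hu, rfl⟩ := List.mem_map.mp hv
      simpa using hneg u hu

theorem exists_basis [CharZero F] {e : Fin 4 → L} (he : ∀ i, e i ∈ wt (F := F) h (Pi.single i 1))
    (he0 : ∀ i, e i ≠ 0) :
    ∃ b : LieAlgebra.Basis (Fin 4) (LieSubalgebra.lieSpan F L (Set.range h)),
      b.A = CartanMatrix.F₄ ∧ b.h = h ∧ b.e = e := by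
  choose f hf ht using fun i ↦ hh.exists_sl2 i (e i) (he i) (he0 i)
  have hne : ∀ i j : Fin 4, i ≠ j → (Pi.single i 1 + -Pi.single j 1 : Fin 4 → ℤ) ∉ roots ∧
      (Pi.single i 1 + -Pi.single j 1 : Fin 4 → ℤ) ≠ 0 := by decide +kernel
  refine ⟨⟨CartanMatrix.F₄, h, e, f, rfl, ?_, hh.linInd, ?_, ht, hh.lie_h_h, fun i j ↦ ?_,
    fun i j ↦ ?_, fun i j hij ↦ ?_⟩, rfl, rfl, rfl⟩
  · exact hh.eq_top_of_mem he hf ht (fun i ↦ LieSubalgebra.subset_lieSpan (.inl ⟨i, rfl⟩))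
      fun i ↦ LieSubalgebra.subset_lieSpan (.inr ⟨i, rfl⟩)
  · exact Matrix.nondegenerate_of_det_ne_zero (by decide +kernel)
  · rw [he i j, cartanInt_single, Int.cast_smul_eq_zsmul]
  · rw [hf i j, cartanInt_neg, cartanInt_single, Int.cast_smul_eq_zsmul]
  · have h1 := lie_mem_wt (he i) (hf j)
    rwa [hh.wt_eq_bot (hne i j hij).1 (hne i j hij).2, Submodule.mem_bot] at h1

theorem exists_lieEquiv [CharZero F] [FiniteDimensional F L] [LieAlgebra.IsSimple F L]
    (hh' : IsFrame F h') {e e' : Fin 4 → L}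
    (he : ∀ i, e i ∈ wt (F := F) h (Pi.single i 1)) (he0 : ∀ i, e i ≠ 0)
    (he' : ∀ i, e' i ∈ wt (F := F) h' (Pi.single i 1)) (he0' : ∀ i, e' i ≠ 0) :
    ∃ φ : L ≃ₗ⁅F⁆ L, (∀ i, φ (h i) = h' i) ∧ ∀ i, φ (e i) = e' i := by
  obtain ⟨b, hA, hb, hbe⟩ := hh.exists_basis he he0
  obtain ⟨b', hA', hb', hbe'⟩ := hh'.exists_basis he' he0'
  obtain ⟨φ, hφ⟩ := exists_lieEquiv_of_basis b b' (hA.trans hA'.symm)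
  rw [hb, hbe, hb', hbe'] at hφ
  exact ⟨φ, fun i ↦ (hφ i).2.2, fun i ↦ (hφ i).1⟩

theorem lieEquiv_ext {e : Fin 4 → L} (he : ∀ i, e i ∈ wt (F := F) h (Pi.single i 1))
    (he0 : ∀ i, e i ≠ 0) {φ ψ : L ≃ₗ⁅F⁆ L} (hφh : ∀ i, φ (h i) = ψ (h i))
    (hφe : ∀ i, φ (e i) = ψ (e i)) : φ = ψ := by
  choose f hf ht using fun i ↦ hh.exists_sl2 i (e i) (he i) (he0 i)
  let χ := φ.trans ψ.symm
  have hχh : ∀ i, χ (h i) = h i := fun i ↦ by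
    simp [χ, LieEquiv.trans_apply, hφh]
  have hχe : ∀ i, χ (e i) = e i := fun i ↦ by
    simp [χ, LieEquiv.trans_apply, hφe]
  have hχf : ∀ i, χ (f i) = f i := fun i ↦ by
    obtain ⟨c, hc⟩ := hh.exists_eq_smul (neg_mem_roots _ (single_mem_roots i)) (hf i)
      (ht i).f_ne_zero (map_mem_wt χ hχh (hf i))
    have h1 := congrArg χ (ht i).lie_e_f
    rw [LieEquiv.map_lie, hχe, hχh, hc, lie_smul, (ht i).lie_e_f] at h1
    have h2 : (c - 1) • h i = 0 := by rw [sub_smul, h1, one_smul, sub_self]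
    rw [hc, sub_eq_zero.mp ((smul_eq_zero.mp h2).resolve_right (ht i).h_ne_zero), one_smul]
  let S : LieSubalgebra F L :=
    { LinearMap.eqLocus χ.toLinearEquiv.toLinearMap LinearMap.id with
      lie_mem' := fun {x y} hx hy ↦ by
        change χ ⁅x, y⁆ = ⁅x, y⁆
        rw [LieEquiv.map_lie, show χ x = x from hx, show χ y = y from hy] }
  have hS : S = ⊤ := hh.eq_top_of_mem he hf ht hχe hχf
  ext x
  have hx : x ∈ S := by rw [hS]; exact LieSubalgebra.mem_top x
  have h1 : ψ (ψ.symm (φ x)) = ψ x := congrArg ψ hx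
  rwa [LieEquiv.apply_symm_apply] at h1

end IsFrame

end Frame

end JordanF4

namespace JordanF4

section Frame

open Module

variable {F L : Type*} [Field F] [LieRing L] [LieAlgebra F L]

namespace IsFrame

variable {h h' : Fin 4 → L} (hh : IsFrame F h)

include hh

theorem induction_on {p : L → Prop} (h0 : ∀ x ∈ wt (F := F) h 0, p x)
    (hr : ∀ v ∈ roots, ∀ x ∈ wt (F := F) h v, p x) (hadd : ∀ x y, p x → p y → p (x + y))
    (x : L) : p x := by
  have hz : p 0 := h0 0 (Submodule.zero_mem _)
  have hx : x ∈ wt (F := F) h 0 ⊔ ⨆ v ∈ roots, wt (F := F) h v := by rw [hh.iSup_wt]; trivial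
  obtain ⟨y, hy, z, hz', rfl⟩ := Submodule.mem_sup.mp hx
  refine hadd _ _ (h0 y hy) ?_
  induction hz' using Submodule.iSup_induction' with
  | mem v z hz' =>
    by_cases hv : v ∈ roots
    · rw [iSup_pos hv] at hz'
      exact hr v hv z hz'
    · rw [iSup_neg hv, Submodule.mem_bot] at hz'
      rwa [hz']
  | zero => exact hz
  | add a b _ _ ha hb => exact hadd a b (ha (by simp [hh.iSup_wt])) (hb (by simp [hh.iSup_wt]))

theorem exists_eigenvalue {x : L} (hx : x ∈ wt (F := F) h 0) :
    ∃ c : (Fin 4 → ℤ) →+ F, ∀ v, ∀ y ∈ wt (F := F) h v, ⁅x, y⁆ = c v • y := by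
  rw [hh.wt_zero] at hx
  induction hx using Submodule.span_induction with
  | mem x hx =>
    obtain ⟨i, rfl⟩ := hx
    refine ⟨⟨⟨fun v ↦ (cartanInt v i : F), by simp [cartanInt]⟩, fun u v ↦ ?_⟩,
      fun v y hy ↦ hy i⟩
    simp [cartanInt_add]
  | zero => exact ⟨0, fun v y _ ↦ by simp⟩
  | add a b _ _ ha hb =>
    obtain ⟨c, hc⟩ := ha
    obtain ⟨d, hd⟩ := hb
    exact ⟨c + d, fun v y hy ↦ by rw [add_lie, hc v y hy, hd v y hy, ← add_smul]; rfl⟩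
  | smul t a _ ha =>
    obtain ⟨c, hc⟩ := ha
    exact ⟨(AddMonoidHom.mulLeft t).comp c, fun v y hy ↦ by
      rw [smul_lie, hc v y hy, smul_smul]; rfl⟩

end IsFrame

theorem eq_zero_of_killingForm [LieAlgebra.IsKilling F L] {x : L}
    (h : ∀ y, killingForm F L x y = 0) : x = 0 := by
  have : x ∈ (killingForm F L).ker := LinearMap.mem_ker.mpr (LinearMap.ext h)
  rwa [LieAlgebra.IsKilling.ker_killingForm_eq_bot, Submodule.mem_bot] at this

variable [LieAlgebra.IsKilling F L]

namespace IsFrame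

variable {h h' : Fin 4 → L} (hh : IsFrame F h)

include hh

theorem killingForm_ne_zero [CharZero F] {v : Fin 4 → ℤ} (hv : v ∈ roots) {x y : L}
    (hx : x ∈ wt (F := F) h v) (hx0 : x ≠ 0) (hy : y ∈ wt (F := F) h (-v)) (hy0 : y ≠ 0) :
    killingForm F L x y ≠ 0 := by
  intro hxy
  refine hx0 (eq_zero_of_killingForm (F := F) fun z ↦ ?_)
  have hv0 : v ≠ 0 := fun h ↦ zero_notMem_roots (h ▸ hv)
  induction z using hh.induction_on with
  | h0 z hz => exact killingForm_eq_zero_of_mem_wt (by simpa using hv0) hx hz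
  | hr u hu z hz =>
    by_cases huv : v + u = 0
    · rw [← neg_eq_of_add_eq_zero_right huv] at hz
      obtain ⟨c, rfl⟩ := hh.exists_eq_smul (neg_mem_roots v hv) hy hy0 hz
      rw [map_smul, hxy, smul_zero]
    · exact killingForm_eq_zero_of_mem_wt huv hx hz
  | hadd a b ha hb => rw [map_add, ha, hb, add_zero]

theorem eq_zero_of_forall_lie [FiniteDimensional F L] {x : L}
    (h1 : ∀ v, ∀ y ∈ wt (F := F) h v, ⁅x, y⁆ = 0) : x = 0 := by
  have : x ∈ LieAlgebra.center F L := by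
    rw [LieModule.mem_maxTrivSubmodule]
    intro y
    rw [← lie_skew, neg_eq_zero]
    induction y using hh.induction_on with
    | h0 z hz => exact h1 0 z hz
    | hr u hu z hz => exact h1 u z hz
    | hadd a b ha hb => rw [lie_add, ha, hb, add_zero]
  rwa [LieAlgebra.center_eq_bot, LieSubmodule.mem_bot] at this

end IsFrame

theorem add_rot_mem_roots : ∀ v ∈ roots, v + rot v ∈ roots := by decide +kernel

theorem exists_rot_equiv [CharZero F] [FiniteDimensional F L] [IsAlgClosed F]
    [LieAlgebra.IsSimple F L] (hdim : finrank F L = 52) :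
    ∃ h : Fin 4 → L, IsFrame F h ∧ ∃ θ : L ≃ₗ⁅F⁆ L,
      (∀ v, ∀ x ∈ wt (F := F) h v, θ x ∈ wt (F := F) h (rot v)) ∧ (∀ x, θ (θ (θ x)) = x) ∧
      ∀ x ∈ wt (F := F) h 0, θ (θ x) + θ x + x = 0 := by
  obtain ⟨h, h', hh, hh', hw⟩ := exists_isFrame_rot (F := F) (L := L) hdim
  choose e he he0 using fun i ↦ hh.exists_ne_zero (single_mem_roots i)
  choose e' he' he0' using fun i ↦ hh'.exists_ne_zero (single_mem_roots i)
  obtain ⟨θ, hθh, -⟩ := hh.exists_lieEquiv hh' he he0 he' he0'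
  have hθ : ∀ v, ∀ x ∈ wt (F := F) h v, θ x ∈ wt (F := F) h (rot v) := fun v x hx ↦ by
    rw [← hw]
    exact map_mem_wt θ hθh hx
  have hθs : ∀ v, ∀ x ∈ wt (F := F) h (rot v), θ.symm x ∈ wt (F := F) h v := fun v x hx ↦ by
    rw [← hw] at hx
    exact map_mem_wt θ.symm (fun i ↦ by rw [← hθh, LieEquiv.symm_apply_apply]) hx
  have hcyc : ∀ x ∈ wt (F := F) h 0, θ (θ x) + θ x + x = 0 := fun x hx ↦ by
    obtain ⟨c, hc⟩ := hh.exists_eigenvalue hx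
    have h1 : ∀ v, ∀ y ∈ wt (F := F) h v, ⁅θ x, y⁆ = c (rot (rot v)) • y := fun v y hy ↦ by
      have := hc _ _ (hθs (rot (rot v)) y (by rwa [rot_rot_rot]))
      have := congrArg θ this
      rwa [LieEquiv.map_lie, LieEquiv.apply_symm_apply, map_smul, LieEquiv.apply_symm_apply] at this
    have h2 : ∀ v, ∀ y ∈ wt (F := F) h v, ⁅θ (θ x), y⁆ = c (rot v) • y := fun v y hy ↦ by
      have := h1 _ _ (hθs (rot (rot v)) y (by rwa [rot_rot_rot]))
      have := congrArg θ this
      rwa [LieEquiv.map_lie, LieEquiv.apply_symm_apply, map_smul, LieEquiv.apply_symm_apply,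
        rot_rot_rot] at this
    refine hh.eq_zero_of_forall_lie fun v y hy ↦ ?_
    rw [add_lie, add_lie, hc v y hy, h1 v y hy, h2 v y hy, ← add_smul, ← add_smul, ← map_add,
      ← map_add, add_comm (rot v), rot_rot_add, map_zero, zero_smul]
  refine ⟨h, hh, θ, hθ, ?_, hcyc⟩
  have hid : (θ.trans θ).trans θ = LieEquiv.refl := by
    refine hh.lieEquiv_ext he he0 (fun i ↦ ?_) fun i ↦ ?_
    · have h1 := hcyc (h i) (hh.mem_wt_zero i)
      have h2 := congrArg θ h1
      rw [map_add, map_add, map_zero] at h2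
      change θ (θ (θ (h i))) = h i
      rw [← sub_eq_zero, ← sub_eq_zero.mpr (h2.trans h1.symm)]
      abel
    · have hr := single_mem_roots i
      have h1 := hθ _ _ (he i)
      have h2 := hθ _ _ h1
      have h3 := hθ _ _ h2
      rw [rot_rot_rot] at h3
      obtain ⟨t, ht⟩ := hh.exists_eq_smul hr (he i) (he0 i) h3
      have h4 := lie_mem_wt (he i) h1
      have hne : ⁅e i, θ (e i)⁆ ≠ 0 := hh.lie_ne_zero _ hr _ (rot_mem_roots _ hr)
        (add_rot_mem_roots _ hr) _ (he i) _ h1 (he0 i) (by simpa using he0 i)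
      have hneg : rot (rot (Pi.single i 1)) = -(Pi.single i 1 + rot (Pi.single i 1)) := by
        rw [eq_neg_iff_add_eq_zero, ← rot_rot_add (Pi.single i 1)]
        abel
      have hk := hh.killingForm_ne_zero (add_rot_mem_roots _ hr) h4 hne (y := θ (θ (e i)))
        (by rwa [← hneg]) (by simpa using he0 i)
      have h5 := LieAlgebra.killingForm_of_equiv_apply θ ⁅e i, θ (e i)⁆ (θ (θ (e i)))
      rw [ht, LieEquiv.map_lie, map_smul, LieModule.traceForm_comm,
        ← LieModule.traceForm_apply_lie_apply] at h5
      have h6 : t = 1 := mul_right_cancel₀ hk (h5.trans (one_mul _).symm)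
      change θ (θ (θ (e i))) = e i
      rw [ht, h6, one_smul]
  exact fun x ↦ congrArg (fun φ : L ≃ₗ⁅F⁆ L ↦ φ x) hid

end Frame

end JordanF4

namespace JordanF4

section Linear

open Module

theorem iSupIndep_inf {F V ι κ : Type*} [Field F] [AddCommGroup V] [Module F V]
    {p : ι → Submodule F V} {q : κ → Submodule F V} (hp : iSupIndep p) (hq : iSupIndep q) :
    iSupIndep fun x : ι × κ ↦ p x.1 ⊓ q x.2 := by
  classical
  rw [iSupIndep_iff_finsetSum_eq_zero_imp_eq_zero] at hp hq ⊢
  rintro s v hv hs ⟨i, k⟩ hik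
  have h0 := (Finset.sum_fiberwise_of_maps_to
    (fun x hx ↦ Finset.mem_image_of_mem Prod.fst hx) v).trans hs
  have h1 := hp (s.image Prod.fst) (fun i ↦ ∑ x ∈ s with x.1 = i, v x)
    (fun i _ ↦ Submodule.sum_mem _ fun x hx ↦ by
      rw [← (Finset.mem_filter.mp hx).2]
      exact (hv x (Finset.mem_filter.mp hx).1).1)
    h0 i (Finset.mem_image_of_mem Prod.fst hik)
  have hi : ∀ x ∈ s.filter fun x ↦ x.1 = i, x = (i, x.2) := fun x hx ↦
    Prod.ext (Finset.mem_filter.mp hx).2 rfl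
  have h2 : ∀ k ∈ ((s.filter fun x ↦ x.1 = i).image Prod.snd), v (i, k) ∈ q k := by
    intro k hk
    obtain ⟨x, hx, rfl⟩ := Finset.mem_image.mp hk
    rw [← hi x hx]
    exact (hv x (Finset.mem_filter.mp hx).1).2
  have h3 : ∑ k ∈ ((s.filter fun x ↦ x.1 = i).image Prod.snd), v (i, k) = 0 := by
    rw [Finset.sum_image fun x hx y hy hxy ↦ by rw [hi x hx, hi y hy, hxy]]
    rw [← h1]
    exact Finset.sum_congr rfl fun x hx ↦ by rw [← hi x hx]
  have h4 : (i, k).2 ∈ (s.filter fun x ↦ x.1 = i).image Prod.snd :=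
    Finset.mem_image_of_mem Prod.snd (Finset.mem_filter.mpr ⟨hik, rfl⟩)
  exact hq _ _ h2 h3 k h4

theorem isInternal_of_two_le_finrank {F V : Type*} [Field F] [AddCommGroup V] [Module F V]
    [FiniteDimensional F V] (hdim : finrank F V = 52) {p : (Fin 3 → ZMod 3) → Submodule F V}
    (hp : iSupIndep p) (h2 : ∀ a ≠ 0, 2 ≤ finrank F (p a)) :
    DirectSum.IsInternal p ∧ ∀ a ≠ 0, finrank F (p a) = 2 := by
  have hinj : Function.Injective (DirectSum.coeLinearMap p) := hp.dfinsupp_lsum_injective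
  have hsum : finrank F (DirectSum _ fun a ↦ p a) = ∑ a, finrank F (p a) :=
    finrank_directSum (R := F) _
  have hle := LinearMap.finrank_le_finrank_of_injective hinj
  have hle2 : ∀ a ∈ Finset.univ, (if a = 0 then 0 else 2) ≤ finrank F (p a) := fun a _ ↦ by
    split_ifs with h
    exacts [Nat.zero_le _, h2 a h]
  have h52 : ∑ a : Fin 3 → ZMod 3, (if a = 0 then 0 else 2) = 52 := by decide +kernel
  have heq : ∑ a : Fin 3 → ZMod 3, (if a = 0 then 0 else 2) = ∑ a, finrank F (p a) :=
    le_antisymm (Finset.sum_le_sum hle2) (by rwa [h52, ← hsum, ← hdim])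
  refine ⟨⟨hinj, ?_⟩, fun a ha ↦ ?_⟩
  · exact (LinearMap.injective_iff_surjective_of_finrank_eq_finrank
      (by rw [hsum, ← heq, h52, hdim])).mp hinj
  · rw [← (Finset.sum_eq_sum_iff_of_le hle2).mp heq a (Finset.mem_univ a), if_neg ha]

theorem two_le_finrank {F V : Type*} [Field F] [AddCommGroup V] [Module F V]
    [FiniteDimensional F V] {p : Submodule F V} {x y : V} (hx : x ∈ p) (hy : y ∈ p)
    (f g : V →ₗ[F] F) (hfx : f x ≠ 0) (hfy : f y = 0) (hgx : g x = 0) (hgy : g y ≠ 0) :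
    2 ≤ finrank F p := by
  have h1 : LinearIndependent F ![(⟨x, hx⟩ : p), ⟨y, hy⟩] := by
    refine LinearIndependent.pair_iff.mpr fun s t hst ↦ ?_
    have h2 : s • x + t • y = 0 := congrArg Subtype.val hst
    have h3 := congrArg f h2
    have h4 := congrArg g h2
    simp only [map_add, map_smul, hfy, hgx, smul_eq_mul, mul_zero, add_zero, zero_add,
      map_zero, mul_eq_zero, hfx, hgy, or_false] at h3 h4
    exact ⟨h3, h4⟩
  simpa using h1.fintype_card_le_finrank

end Linear

/-- The class of a weight in the quotient of the weight lattice by the image of `rot - 1`. -/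
def cls (v : Fin 4 → ℤ) : ZMod 3 × ZMod 3 := (v 0 + v 2 + v 3, v 1)

theorem cls_add (u v : Fin 4 → ℤ) : cls (u + v) = cls u + cls v := by
  ext
  · simp [cls]; ring
  · simp [cls]

theorem cls_rot (v : Fin 4 → ℤ) : cls (rot v) = cls v := by
  have h3 : (3 : ZMod 3) = 0 := rfl
  ext
  · simp only [cls, rot, Matrix.cons_val]
    push_cast
    linear_combination (-3 * (v 0 : ZMod 3) + v 1 - v 3) * h3
  · simp only [cls, rot, Matrix.cons_val]
    push_cast
    linear_combination (-v 0 : ZMod 3) * h3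

theorem rot_ne_self : ∀ v ∈ roots, rot v ≠ v := by decide +kernel

theorem exists_roots_of_cls : ∀ c : ZMod 3 × ZMod 3, c ≠ 0 → ∃ u ∈ roots, ∃ v ∈ roots,
    cls u = c ∧ cls v = c ∧ u ≠ v ∧ rot u ≠ v ∧ rot (rot u) ≠ v := by
  decide +kernel

end JordanF4

namespace JordanF4

section Character

variable {F : Type*} [Field F]

theorem addChar_pow_three (χ : AddChar (ZMod 3) F) (c : ZMod 3) : χ c ^ 3 = 1 := by
  rw [← AddChar.map_nsmul_eq_pow, show 3 • c = 0 from by decide +revert, AddChar.map_zero_eq_one]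

theorem addChar_add_neg (χ : AddChar (ZMod 3) F) (hχ : Function.Injective χ) (c : ZMod 3)
    (hc : c ≠ 0) : χ c + χ (-c) = -1 := by
  have h1 : χ c - 1 ≠ 0 := fun h ↦ hc (hχ ((sub_eq_zero.mp h).trans χ.map_zero_eq_one.symm))
  have h2 : χ (-c) = χ c ^ 2 := by
    rw [← AddChar.map_nsmul_eq_pow, (by decide : ∀ c : ZMod 3, 2 • c = -c) c]
  rw [h2]
  refine mul_left_cancel₀ h1 ?_
  linear_combination addChar_pow_three χ c

theorem exists_addChar_injective [IsAlgClosed F] [CharZero F] :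
    ∃ χ : AddChar (ZMod 3) F, Function.Injective χ := by
  obtain ⟨ω, hω⟩ := IsAlgClosed.exists_eval₂_eq_zero (RingHom.id F)
    (Polynomial.X ^ 2 + Polynomial.X + 1) (by
      rw [show (Polynomial.X ^ 2 + Polynomial.X + 1 : Polynomial F).degree = 2 from by
        compute_degree!]
      decide)
  have hω : ω ^ 2 + ω + 1 = 0 := by simpa using hω
  have h3 : ω ^ 3 = 1 := by linear_combination (ω - 1) * hω
  have key : ∀ c : ZMod 3, c ≠ 0 → AddChar.zmodChar 3 h3 c ≠ 1 := fun c hc h1 ↦ by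
    have h2 : AddChar.zmodChar 3 h3 (c.val • c) = 1 := by
      rw [AddChar.map_nsmul_eq_pow, h1, one_pow]
    rw [(by decide : ∀ c : ZMod 3, c ≠ 0 → c.val • c = 1) c hc, AddChar.zmodChar_apply,
      show (1 : ZMod 3).val = 1 from rfl, pow_one] at h2
    rw [h2] at hω
    norm_num at hω
  refine ⟨AddChar.zmodChar 3 h3, fun a b hab ↦ ?_⟩
  by_contra hne
  refine key (a - b) (sub_ne_zero.mpr hne) ?_
  rw [AddChar.map_sub_eq_div, hab, div_self]
  intro h4
  have := addChar_pow_three (AddChar.zmodChar 3 h3) b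
  norm_num [h4] at this

end Character

section Projection

variable {F V : Type*} [Field F] [AddCommGroup V] [Module F V]

theorem add_mem_eigenspace (χ : AddChar (ZMod 3) F) (θ : V →ₗ[F] V) {x : V}
    (hx : θ (θ (θ x)) = x) (c : ZMod 3) :
    x + χ (-c) • θ x + χ (-c) ^ 2 • θ (θ x) ∈ Module.End.eigenspace θ (χ c) := by
  rw [Module.End.mem_eigenspace_iff, map_add, map_add, map_smul, map_smul, hx]
  have h1 : χ c * χ (-c) = 1 := by
    rw [← AddChar.map_add_eq_mul, add_neg_cancel, AddChar.map_zero_eq_one]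
  have h2 : χ (-c) ^ 2 = χ c := by
    linear_combination χ c * addChar_pow_three χ (-c) - χ (-c) ^ 2 * h1
  rw [h2, smul_add, smul_add, smul_smul, smul_smul, h1, ← sq,
    show χ c ^ 2 = χ (-c) by linear_combination χ (-c) * addChar_pow_three χ c - χ c ^ 2 * h1]
  module

end Projection

section Grading

open Module

variable {F L : Type*} [Field F] [LieRing L] [LieAlgebra F L]

/-- The common refinement of the coarsening of a weight decomposition by `cls` and of the
eigenspace decomposition of an automorphism. -/
def gradingOf (h : Fin 4 → L) (θ : L ≃ₗ⁅F⁆ L) (χ : AddChar (ZMod 3) F) (a : Fin 3 → ZMod 3) :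
    Submodule F L :=
  (⨆ v, ⨆ _ : cls v = (a 0, a 1), wt h v) ⊓
    Module.End.eigenspace θ.toLinearEquiv.toLinearMap (χ (a 2))

variable {h : Fin 4 → L} {θ : L ≃ₗ⁅F⁆ L} {χ : AddChar (ZMod 3) F}

theorem iSupIndep_gradingOf [CharZero F] (hχ : Function.Injective χ) :
    iSupIndep (gradingOf h θ χ) :=
  (iSupIndep_inf (iSupIndep_fiber (iSupIndep_wt (F := F) h) cls)
    ((Module.End.eigenspaces_iSupIndep θ.toLinearEquiv.toLinearMap).comp hχ)).comp
    (f := fun a : Fin 3 → ZMod 3 ↦ ((a 0, a 1), a 2)) fun a b hab ↦ by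
      simp only [Prod.mk.injEq] at hab
      ext i
      fin_cases i
      exacts [hab.1.1, hab.1.2, hab.2]

theorem lie_mem_gradingOf {a b : Fin 3 → ZMod 3} {x y : L} (hx : x ∈ gradingOf h θ χ a)
    (hy : y ∈ gradingOf h θ χ b) : ⁅x, y⁆ ∈ gradingOf h θ χ (a + b) := by
  obtain ⟨hx1, hx2⟩ := hx
  obtain ⟨hy1, hy2⟩ := hy
  refine ⟨?_, ?_⟩
  · clear hx2 hy2
    induction hx1 using Submodule.iSup_induction' with
    | mem v x hx =>
      by_cases hv : cls v = (a 0, a 1)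
      · rw [iSup_pos hv] at hx
        induction hy1 using Submodule.iSup_induction' with
        | mem u y hy =>
          by_cases hu : cls u = (b 0, b 1)
          · rw [iSup_pos hu] at hy
            refine Submodule.mem_iSup_of_mem (v + u) ?_
            rw [iSup_pos (by rw [cls_add, hv, hu]; rfl)]
            exact lie_mem_wt hx hy
          · rw [iSup_neg hu, Submodule.mem_bot] at hy
            rw [hy, lie_zero]
            exact Submodule.zero_mem _
        | zero => rw [lie_zero]; exact Submodule.zero_mem _
        | add y z _ _ hy hz => rw [lie_add]; exact Submodule.add_mem _ hy hz
      · rw [iSup_neg hv, Submodule.mem_bot] at hx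
        rw [hx, zero_lie]
        exact Submodule.zero_mem _
    | zero => rw [zero_lie]; exact Submodule.zero_mem _
    | add y z _ _ hy hz => rw [add_lie]; exact Submodule.add_mem _ hy hz
  · have h1 : θ x = χ (a 2) • x := Module.End.mem_eigenspace_iff.mp hx2
    have h2 : θ y = χ (b 2) • y := Module.End.mem_eigenspace_iff.mp hy2
    refine Module.End.mem_eigenspace_iff.mpr ?_
    change θ ⁅x, y⁆ = _
    rw [LieEquiv.map_lie, h1, h2, smul_lie, lie_smul, smul_smul, Pi.add_apply,
      AddChar.map_add_eq_mul]

theorem add_mem_gradingOf (hθ : ∀ v, ∀ x ∈ wt (F := F) h v, θ x ∈ wt (F := F) h (rot v))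
    (h3 : ∀ x, θ (θ (θ x)) = x) {v : Fin 4 → ℤ} {x : L} (hx : x ∈ wt (F := F) h v)
    {a : Fin 3 → ZMod 3} (ha : cls v = (a 0, a 1)) :
    x + χ (-a 2) • θ x + χ (-a 2) ^ 2 • θ (θ x) ∈ gradingOf h θ χ a := by
  refine ⟨?_, add_mem_eigenspace χ θ.toLinearEquiv.toLinearMap (h3 x) (a 2)⟩
  have key : ∀ u, cls u = (a 0, a 1) → wt (F := F) h u ≤ ⨆ v, ⨆ _ : cls v = (a 0, a 1), wt h v :=
    fun u hu ↦ le_iSup₂_of_le u hu le_rfl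
  have h1 := hθ _ _ hx
  exact add_mem (add_mem (key v ha hx)
    (Submodule.smul_mem _ _ (key _ (by rw [cls_rot, ha]) h1)))
    (Submodule.smul_mem _ _ (key _ (by rw [cls_rot, cls_rot, ha]) (hθ _ _ h1)))

theorem IsFrame.finrank_wt_zero (hh : IsFrame F h) : finrank F (wt (F := F) h 0) = 4 := by
  rw [hh.wt_zero, finrank_span_eq_card hh.linInd, Fintype.card_fin]

namespace IsFrame

variable [CharZero F] [FiniteDimensional F L] [LieAlgebra.IsKilling F L] (hh : IsFrame F h)

include hh

theorem finrank_wt_zero_inf_eigenspace_le {c d : F} (hc : c * c ≠ 1)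
    (hsup : wt (F := F) h 0 ≤ (wt h 0 ⊓ Module.End.eigenspace θ.toLinearEquiv.toLinearMap c) ⊔
      (wt h 0 ⊓ Module.End.eigenspace θ.toLinearEquiv.toLinearMap d)) :
    finrank F (wt (F := F) h 0 ⊓ Module.End.eigenspace θ.toLinearEquiv.toLinearMap c :) ≤
      finrank F (wt (F := F) h 0 ⊓ Module.End.eigenspace θ.toLinearEquiv.toLinearMap d :) := by
  set P := wt (F := F) h 0 ⊓ Module.End.eigenspace θ.toLinearEquiv.toLinearMap c
  set Q := wt (F := F) h 0 ⊓ Module.End.eigenspace θ.toLinearEquiv.toLinearMap d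
  rw [← Subspace.dual_finrank_eq (K := F) (V := Q)]
  refine LinearMap.finrank_le_finrank_of_injective
    (f := (killingForm F L).domRestrict₁₂ P Q) ?_
  rw [← LinearMap.ker_eq_bot, LinearMap.ker_eq_bot']
  rintro ⟨x, hx⟩ h0
  have hxQ : ∀ y ∈ Q, killingForm F L x y = 0 := fun y hy ↦
    LinearMap.congr_fun h0 ⟨y, hy⟩
  have hxP : ∀ y ∈ P, killingForm F L x y = 0 := fun y hy ↦ by
    have h1 : θ x = c • x := Module.End.mem_eigenspace_iff.mp hx.2
    have h2 : θ y = c • y := Module.End.mem_eigenspace_iff.mp hy.2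
    have h4 := LieAlgebra.killingForm_of_equiv_apply θ x y
    rw [h1, h2, map_smul, map_smul, LinearMap.smul_apply, smul_smul, smul_eq_mul] at h4
    exact (mul_eq_zero.mp (show (c * c - 1) * killingForm F L x y = 0 by
      linear_combination h4)).resolve_left (sub_ne_zero.mpr hc)
  refine Subtype.ext (eq_zero_of_killingForm (F := F) fun z ↦ ?_)
  induction z using hh.induction_on with
  | h0 z hz =>
    obtain ⟨y, hy, w, hw, rfl⟩ := Submodule.mem_sup.mp (hsup hz)
    rw [map_add, hxP y hy, hxQ w hw, add_zero]
  | hr u hu z hz =>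
    refine killingForm_eq_zero_of_mem_wt ?_ hx.1 hz
    rw [zero_add]
    exact fun h ↦ zero_notMem_roots (h ▸ hu)
  | hadd a b ha hb => rw [map_add, ha, hb, add_zero]

variable (hθ : ∀ v, ∀ x ∈ wt (F := F) h v, θ x ∈ wt (F := F) h (rot v))
  (h3 : ∀ x, θ (θ (θ x)) = x)

include hθ h3

theorem two_le_finrank_gradingOf {a : Fin 3 → ZMod 3} (ha : (a 0, a 1) ≠ 0) :
    2 ≤ finrank F (gradingOf h θ χ a) := by
  obtain ⟨u, hu, v, hv, hua, hva, h1, h2, h3'⟩ := exists_roots_of_cls _ ha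
  have hpair : ∀ w z : Fin 4 → ℤ, ∀ x ∈ wt (F := F) h w, ∀ y ∈ wt (F := F) h (-z), w ≠ z →
      killingForm F L y x = 0 := fun w z x hx y hy hwz ↦
    killingForm_eq_zero_of_mem_wt (by simpa [neg_add_eq_zero] using hwz.symm) hy hx
  have hrr : ∀ w ∈ roots, rot (rot w) ≠ w := fun w hw he ↦ rot_ne_self w hw (by
    have h4 := congrArg rot he
    rwa [rot_rot_rot, eq_comm] at h4)
  obtain ⟨x, hx, hx0⟩ := hh.exists_ne_zero hu
  obtain ⟨y, hy, hy0⟩ := hh.exists_ne_zero hv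
  obtain ⟨x', hx', hx0'⟩ := hh.exists_ne_zero (neg_mem_roots u hu)
  obtain ⟨y', hy', hy0'⟩ := hh.exists_ne_zero (neg_mem_roots v hv)
  refine two_le_finrank (add_mem_gradingOf hθ h3 hx hua) (add_mem_gradingOf hθ h3 hy hva)
    (killingForm F L x') (killingForm F L y') ?_ ?_ ?_ ?_ <;>
    simp only [map_add, map_smul]
  · rw [hpair _ _ _ (hθ _ _ hx) _ hx' (rot_ne_self u hu),
      hpair _ _ _ (hθ _ _ (hθ _ _ hx)) _ hx' (hrr u hu), smul_zero, smul_zero, add_zero, add_zero,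
      LieModule.traceForm_comm]
    exact hh.killingForm_ne_zero hu hx hx0 hx' hx0'
  · rw [hpair _ _ _ hy _ hx' h1.symm, hpair _ _ _ (hθ _ _ hy) _ hx' fun he ↦ h3' (by
      rw [← he, rot_rot_rot]), hpair _ _ _ (hθ _ _ (hθ _ _ hy)) _ hx' fun he ↦ h2 (by
      rw [← he, rot_rot_rot]), smul_zero, smul_zero, add_zero, add_zero]
  · rw [hpair _ _ _ hx _ hy' h1, hpair _ _ _ (hθ _ _ hx) _ hy' h2,
      hpair _ _ _ (hθ _ _ (hθ _ _ hx)) _ hy' h3', smul_zero, smul_zero, add_zero, add_zero]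
  · rw [hpair _ _ _ (hθ _ _ hy) _ hy' (rot_ne_self v hv),
      hpair _ _ _ (hθ _ _ (hθ _ _ hy)) _ hy' (hrr v hv), smul_zero, smul_zero, add_zero, add_zero,
      LieModule.traceForm_comm]
    exact hh.killingForm_ne_zero hv hy hy0 hy' hy0'

theorem two_le_finrank_wt_zero_inf_eigenspace (hχ : Function.Injective χ)
    (h1 : ∀ x ∈ wt (F := F) h 0, θ (θ x) + θ x + x = 0) {c : ZMod 3} (hc : c ≠ 0) :
    2 ≤ finrank F (wt (F := F) h 0 ⊓
      Module.End.eigenspace θ.toLinearEquiv.toLinearMap (χ c) :) := by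
  have hne : ∀ c : ZMod 3, c ≠ 0 → χ c * χ c ≠ 1 := fun c hc h ↦ by
    rw [← AddChar.map_add_eq_mul, ← χ.map_zero_eq_one] at h
    have := hχ h
    exact (by decide : ∀ c : ZMod 3, c ≠ 0 → c + c ≠ 0) c hc this
  have hsup : ∀ c : ZMod 3, c ≠ 0 → wt (F := F) h 0 ≤
      (wt h 0 ⊓ Module.End.eigenspace θ.toLinearEquiv.toLinearMap (χ c)) ⊔
      (wt h 0 ⊓ Module.End.eigenspace θ.toLinearEquiv.toLinearMap (χ (-c))) := by
    intro c hc x hx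
    have hx1 := hθ _ _ hx
    have hx2 := hθ _ _ hx1
    rw [show rot 0 = 0 from by decide] at hx1 hx2
    have hP : ∀ c, (3 : F)⁻¹ • (x + χ (-c) • θ x + χ (-c) ^ 2 • θ (θ x)) ∈ wt (F := F) h 0 ⊓
        Module.End.eigenspace θ.toLinearEquiv.toLinearMap (χ c) := fun c ↦
      ⟨Submodule.smul_mem _ _ (add_mem (add_mem hx (Submodule.smul_mem _ _ hx1))
        (Submodule.smul_mem _ _ hx2)), Submodule.smul_mem _ _
        (add_mem_eigenspace χ θ.toLinearEquiv.toLinearMap (h3 x) c)⟩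
    convert Submodule.add_mem_sup (hP c) (hP (-c)) using 1
    have hs := addChar_add_neg χ hχ c hc
    have h4 : χ (-c) ^ 2 + χ c ^ 2 = -1 := by
      rw [← AddChar.map_nsmul_eq_pow, ← AddChar.map_nsmul_eq_pow,
        (by decide : ∀ c : ZMod 3, 2 • -c = c) c, (by decide : ∀ c : ZMod 3, 2 • c = -c) c, hs]
    rw [neg_neg, ← smul_add]
    have h5 : x + χ (-c) • θ x + χ (-c) ^ 2 • θ (θ x) + (x + χ c • θ x + χ c ^ 2 • θ (θ x)) =
        (2 : F) • x + (χ c + χ (-c)) • θ x + (χ (-c) ^ 2 + χ c ^ 2) • θ (θ x) := by module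
    have h6 : (2 : F) • x + (-1 : F) • θ x + (-1 : F) • θ (θ x) =
        (3 : F) • x - (θ (θ x) + θ x + x) := by module
    rw [h5, hs, h4, h6, h1 x hx, sub_zero, smul_smul, inv_mul_cancel₀ (by norm_num), one_smul]
  have h4 := (Submodule.finrank_mono (hsup c hc)).trans
    (Submodule.finrank_add_le_finrank_add_finrank _ _)
  rw [hh.finrank_wt_zero] at h4
  have h5 := hh.finrank_wt_zero_inf_eigenspace_le (hne (-c) (neg_ne_zero.mpr hc))
    (hsup (-c) (neg_ne_zero.mpr hc))
  rw [neg_neg] at h5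
  omega

end IsFrame

theorem exists_grading [IsAlgClosed F] [CharZero F] [FiniteDimensional F L]
    [LieAlgebra.IsSimple F L] (hdim : finrank F L = 52) :
    ∃ gr : (Fin 3 → ZMod 3) → Submodule F L,
      (DirectSum.IsInternal gr ∧ ∀ a b, ∀ x ∈ gr a, ∀ y ∈ gr b, ⁅x, y⁆ ∈ gr (a + b)) ∧
      ∀ a ≠ 0, finrank F (gr a) = 2 := by
  obtain ⟨χ, hχ⟩ := exists_addChar_injective (F := F)
  obtain ⟨h, hh, θ, hθ, h3, h1⟩ := exists_rot_equiv (F := F) (L := L) hdim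
  obtain ⟨h4, h5⟩ := isInternal_of_two_le_finrank hdim (iSupIndep_gradingOf (h := h) (θ := θ) hχ)
    fun a ha ↦ by
      by_cases h01 : (a 0, a 1) = 0
      · refine (hh.two_le_finrank_wt_zero_inf_eigenspace hθ h3 hχ h1 (c := a 2) fun h2 ↦
          ha ?_).trans (Submodule.finrank_mono (inf_le_inf_right _ ?_))
        · rw [Prod.mk_eq_zero] at h01
          ext i
          fin_cases i
          exacts [h01.1, h01.2, h2]
        · exact le_iSup₂_of_le 0 (by rw [h01]; rfl) le_rfl
      · exact hh.two_le_finrank_gradingOf hθ h3 h01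
  exact ⟨_, ⟨h4, fun _ _ _ hx _ hy ↦ lie_mem_gradingOf hx hy⟩, h5⟩

end Grading

end JordanF4

namespace JordanF4

section Diagonal

variable {F V W ι : Type*} [Field F] [AddCommGroup V] [Module F V] [AddCommGroup W] [Module F W]

theorem linearMap_ext_of_iSup {p : ι → Submodule F V} (hp : ⨆ i, p i = ⊤) {f g : V →ₗ[F] W}
    (h : ∀ i, ∀ x ∈ p i, f x = g x) : f = g := by
  refine LinearMap.ext fun x ↦ ?_
  have hx : x ∈ ⨆ i, p i := hp ▸ Submodule.mem_top
  induction hx using Submodule.iSup_induction' with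
  | mem i x hx => exact h i x hx
  | zero => rw [map_zero, map_zero]
  | add x y _ _ hx hy => rw [map_add, map_add, hx, hy]

theorem exists_linearMap_eq_smul {p : ι → Submodule F V} (hp : iSupIndep p)
    (hp' : ⨆ i, p i = ⊤) (f : ι → F) : ∃ D : V →ₗ[F] V, ∀ i, ∀ x ∈ p i, D x = f i • x := by
  classical
  have hi := (DirectSum.isInternal_submodule_iff_iSupIndep_and_iSup_eq_top p).mpr ⟨hp, hp'⟩
  let e := LinearEquiv.ofBijective (DirectSum.coeLinearMap p) hi
  refine ⟨(DirectSum.toModule F ι V fun i ↦ f i • (p i).subtype) ∘ₗ e.symm.toLinearMap,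
    fun i x hx ↦ ?_⟩
  have h1 : e.symm x = DirectSum.lof F ι (fun i ↦ p i) i ⟨x, hx⟩ := by
    rw [LinearEquiv.symm_apply_eq]
    exact (DirectSum.coeLinearMap_lof p i ⟨x, hx⟩).symm
  rw [LinearMap.comp_apply, LinearEquiv.coe_coe, h1, DirectSum.toModule_lof]
  rfl

end Diagonal

section JordanDecomposition

open Module

variable {F L : Type*} [Field F] [LieRing L] [LieAlgebra F L] [FiniteDimensional F L]

theorem isNilpotent_sub_of_eq_smul [IsAlgClosed F] {T D : End F L}
    (hD : ∀ μ, ∀ y ∈ T.maxGenEigenspace μ, D y = μ • y) : IsNilpotent (T - D) := by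
  refine ⟨finrank F L, linearMap_ext_of_iSup T.iSup_maxGenEigenspace_eq_top fun μ y hy ↦ ?_⟩
  have h1 : ∀ n : ℕ, ((T - D) ^ n) y = ((T - μ • (1 : End F L)) ^ n) y ∧
      ((T - μ • (1 : End F L)) ^ n) y ∈ T.maxGenEigenspace μ := fun n ↦ by
    induction n with
    | zero => exact ⟨rfl, hy⟩
    | succ n ih =>
      rw [pow_succ', pow_succ', Module.End.mul_apply, Module.End.mul_apply, ih.1]
      refine ⟨?_, ?_⟩
      · rw [LinearMap.sub_apply, hD μ _ ih.2]
        rfl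
      · exact sub_mem (End.mapsTo_maxGenEigenspace_of_comm (Commute.refl T) μ ih.2)
          (Submodule.smul_mem _ _ ih.2)
  rw [(h1 _).1]
  rw [End.maxGenEigenspace_eq_genEigenspace_finrank, End.mem_genEigenspace_nat] at hy
  exact hy

variable [LieAlgebra.IsKilling F L]

theorem exists_lie_eq_smul [IsAlgClosed F] (x : L) :
    ∃ z : L, ∀ μ, ∀ y ∈ (LieAlgebra.ad F L x).maxGenEigenspace μ, ⁅z, y⁆ = μ • y := by
  have htop := (LieAlgebra.ad F L x).iSup_maxGenEigenspace_eq_top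
  obtain ⟨D, hD⟩ := exists_linearMap_eq_smul (LieAlgebra.ad F L x).independent_maxGenEigenspace
    htop id
  have hleib : ∀ a b, D ⁅a, b⁆ = ⁅a, D b⁆ - ⁅b, D a⁆ := fun a b ↦ by
    have ha : a ∈ ⨆ μ, (LieAlgebra.ad F L x).maxGenEigenspace μ := htop ▸ Submodule.mem_top
    have hb : b ∈ ⨆ μ, (LieAlgebra.ad F L x).maxGenEigenspace μ := htop ▸ Submodule.mem_top
    induction ha using Submodule.iSup_induction' with
    | mem μ a ha =>
      induction hb using Submodule.iSup_induction' with
      | mem ν b hb =>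
        rw [hD _ _ ha, hD _ _ hb, hD _ _ (LieModule.lie_mem_maxGenEigenspace_toEnd ha hb),
          lie_smul, lie_smul, ← lie_skew b a]
        simp only [id_eq]
        module
      | zero => simp
      | add b c _ _ hb hc => rw [lie_add, map_add, map_add, hb, hc, lie_add, add_lie]; abel
    | zero => simp
    | add a c _ _ ha hc => rw [add_lie, map_add, map_add, ha, hc, lie_add, add_lie]; abel
  obtain ⟨z, hz⟩ := LieDerivation.IsKilling.exists_eq_ad (R := F) (L := L) ⟨D, hleib⟩
  refine ⟨z, fun μ y hy ↦ ?_⟩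
  rw [← id_eq μ, ← hD μ y hy]
  have h1 := congrArg (fun d : LieDerivation F L L ↦ d y) hz
  rwa [LieDerivation.ad_apply_apply] at h1

end JordanDecomposition

end JordanF4

namespace JordanF4

section Cartan

variable {F L : Type*} [Field F] [LieRing L] [LieAlgebra F L] [FiniteDimensional F L]

theorem exists_cartan_of_commute [Infinite F] {S : Set L} (hS : ∀ x ∈ S, ∀ y ∈ S, ⁅x, y⁆ = 0)
    (hss : ∀ x ∈ S, ∀ y : L, ⁅x, ⁅x, y⁆⁆ = 0 → ⁅x, y⁆ = 0) :
    ∃ K : LieSubalgebra F L, K.IsCartanSubalgebra ∧ S ⊆ K := by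
  let N : LieSubalgebra F L :=
    { carrier := {y | ∀ x ∈ S, ⁅x, y⁆ = 0}
      add_mem' := fun {a b} ha hb x hx ↦ by rw [lie_add, ha x hx, hb x hx, add_zero]
      zero_mem' := fun x _ ↦ lie_zero x
      smul_mem' := fun c a ha x hx ↦ by rw [lie_smul, ha x hx, smul_zero]
      lie_mem' := fun {a b} ha hb x hx ↦ by
        rw [leibniz_lie, ha x hx, hb x hx, zero_lie, lie_zero, add_zero] }
  obtain ⟨z, hz⟩ := LieAlgebra.exists_isCartanSubalgebra_engel F N
  let C := LieSubalgebra.engel F z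
  let K := C.map N.incl
  have hSK : S ⊆ K := fun x hx ↦ by
    have hxN : x ∈ N := fun y hy ↦ hS y hy x hx
    refine ⟨⟨x, hxN⟩, ?_, rfl⟩
    refine (LieSubalgebra.mem_engel_iff F z _).mpr ⟨1, Subtype.ext ?_⟩
    change ⁅(z : L), x⁆ = 0
    rw [← lie_skew, z.2 x hx, neg_zero]
  have hKN : ∀ y ∈ K, y ∈ N := by
    rintro _ ⟨y, -, rfl⟩
    exact y.2
  refine ⟨K, ⟨?_, ?_⟩, hSK⟩
  · have hinj : Function.Injective N.incl := Subtype.val_injective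
    have h1 : LieRing.IsNilpotent C := hz.nilpotent
    exact (LieEquiv.nilpotent_iff_equiv_nilpotent
      (C.equivMapOfInjective _ hinj)).mp h1
  · refine le_antisymm (fun y hy ↦ ?_) (LieSubalgebra.le_normalizer K)
    rw [LieSubalgebra.mem_normalizer_iff'] at hy
    have hyN : y ∈ N := fun x hx ↦ hss x hx y (hKN _ (hy x (hSK hx)) x hx)
    have h1 : (⟨y, hyN⟩ : N) ∈ C.normalizer := by
      rw [LieSubalgebra.mem_normalizer_iff']
      intro w hw
      obtain ⟨u, hu, hu'⟩ := hy w ⟨w, hw, rfl⟩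
      have : u = ⁅w, ⟨y, hyN⟩⁆ := Subtype.ext hu'
      exact this ▸ hu
    rw [hz.self_normalizing] at h1
    exact ⟨_, h1, rfl⟩

end Cartan

end JordanF4

namespace JordanF4

section Linear

variable {F V ι : Type*} [Field F] [AddCommGroup V] [Module F V]

theorem eq_of_le_of_iSupIndep {p q : ι → Submodule F V} (hpq : ∀ i, p i ≤ q i)
    (hp : ⨆ i, p i = ⊤) (hq : iSupIndep q) (i : ι) : p i = q i := by
  refine le_antisymm (hpq i) fun x hx ↦ ?_
  have h1 : (⊤ : Submodule F V) ≤ p i ⊔ ⨆ j, ⨆ _ : j ≠ i, q j := by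
    rw [← hp]
    refine iSup_le fun j ↦ ?_
    by_cases hj : j = i
    · exact hj ▸ le_sup_left
    · exact (hpq j).trans
        ((le_iSup₂_of_le (f := fun j (_ : j ≠ i) ↦ q j) j hj le_rfl).trans le_sup_right)
  obtain ⟨y, hy, z, hz, hyz⟩ := Submodule.mem_sup.mp (h1 (Submodule.mem_top (x := x)))
  have h2 : z = x - y := by rw [← hyz, add_sub_cancel_left]
  have h3 : z = 0 := (Submodule.disjoint_def.mp (hq i)) z
    (h2 ▸ sub_mem hx (hpq i hy)) hz
  rwa [← hyz, h3, add_zero]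

end Linear

open Module

/-- A grading by `(ZMod 3)³` with zero neutral component and all others two-dimensional. -/
structure IsJordanGrading (F : Type*) {L : Type*} [Field F] [LieRing L] [LieAlgebra F L]
    (gr : (Fin 3 → ZMod 3) → Submodule F L) : Prop where
  indep : iSupIndep gr
  iSup_eq_top : ⨆ a, gr a = ⊤
  lie_mem : ∀ a b, ∀ x ∈ gr a, ∀ y ∈ gr b, ⁅x, y⁆ ∈ gr (a + b)
  finrank_eq_two : ∀ a ≠ 0, finrank F (gr a) = 2
  zero_eq_bot : gr 0 = ⊥

section Grading

variable {F L : Type*} [Field F] [LieRing L] [LieAlgebra F L]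

theorem isJordanGrading_of_isInternal [FiniteDimensional F L] (hdim : finrank F L = 52)
    {gr : (Fin 3 → ZMod 3) → Submodule F L} (hi : DirectSum.IsInternal gr)
    (hlie : ∀ a b, ∀ x ∈ gr a, ∀ y ∈ gr b, ⁅x, y⁆ ∈ gr (a + b))
    (h2 : ∀ a ≠ 0, finrank F (gr a) = 2) : IsJordanGrading F gr := by
  obtain ⟨h3, h4⟩ := (DirectSum.isInternal_submodule_iff_iSupIndep_and_iSup_eq_top gr).mp hi
  refine ⟨h3, h4, hlie, h2, ?_⟩
  have hsum : ∑ a, finrank F (gr a) = 52 := by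
    rw [← hdim, ← finrank_directSum (R := F)]
    exact (LinearEquiv.ofBijective (DirectSum.coeLinearMap gr) hi).finrank_eq
  rw [← Finset.add_sum_erase _ _ (Finset.mem_univ 0), Finset.sum_congr rfl fun a ha ↦
    h2 a (Finset.ne_of_mem_erase ha), Finset.sum_const,
    show (Finset.univ.erase (0 : Fin 3 → ZMod 3)).card = 26 by decide +kernel] at hsum
  rw [← Submodule.finrank_eq_zero]
  simpa using hsum

namespace IsJordanGrading

variable {gr : (Fin 3 → ZMod 3) → Submodule F L} (hg : IsJordanGrading F gr)

include hg

theorem exists_lieEquiv (ψ : AddChar (Fin 3 → ZMod 3) F) :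
    ∃ θ : L ≃ₗ⁅F⁆ L, ∀ a, ∀ x ∈ gr a, θ x = ψ a • x := by
  obtain ⟨T, hT⟩ := exists_linearMap_eq_smul hg.indep hg.iSup_eq_top ψ
  obtain ⟨S, hS⟩ := exists_linearMap_eq_smul hg.indep hg.iSup_eq_top fun a ↦ ψ (-a)
  have hψ : ∀ a, ψ a * ψ (-a) = 1 := fun a ↦ by
    rw [← AddChar.map_add_eq_mul, add_neg_cancel, AddChar.map_zero_eq_one]
  have hTS : T ∘ₗ S = LinearMap.id := linearMap_ext_of_iSup hg.iSup_eq_top fun a x hx ↦ by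
    rw [LinearMap.comp_apply, hS a x hx, map_smul, hT a x hx, smul_smul, mul_comm, hψ, one_smul]
    rfl
  have hST : S ∘ₗ T = LinearMap.id := linearMap_ext_of_iSup hg.iSup_eq_top fun a x hx ↦ by
    rw [LinearMap.comp_apply, hT a x hx, map_smul, hS a x hx, smul_smul, hψ, one_smul]
    rfl
  refine ⟨{ T with
    map_lie' := fun {x y} ↦ ?_
    invFun := S
    left_inv := LinearMap.congr_fun hST
    right_inv := LinearMap.congr_fun hTS }, fun a x hx ↦ hT a x hx⟩
  change T ⁅x, y⁆ = ⁅T x, T y⁆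
  have hx : x ∈ ⨆ a, gr a := hg.iSup_eq_top ▸ Submodule.mem_top
  have hy : y ∈ ⨆ a, gr a := hg.iSup_eq_top ▸ Submodule.mem_top
  induction hx using Submodule.iSup_induction' with
  | mem a x hx =>
    induction hy using Submodule.iSup_induction' with
    | mem b y hy =>
      rw [hT a x hx, hT b y hy, hT _ _ (hg.lie_mem a b x hx y hy), smul_lie, lie_smul, smul_smul,
        AddChar.map_add_eq_mul]
    | zero => simp
    | add y z _ _ hy hz => rw [lie_add, map_add, map_add, hy, hz, lie_add]
  | zero => simp
  | add x z _ _ hx hz => rw [add_lie, map_add, map_add, hx, hz, add_lie]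

theorem exists_mem_iff {χ : AddChar (ZMod 3) F} (hχ : Function.Injective χ) :
    ∃ θ : Fin 3 → L ≃ₗ⁅F⁆ L, ∀ a x, x ∈ gr a ↔ ∀ i, θ i x = χ (a i) • x := by
  choose θ hθ using fun i ↦ hg.exists_lieEquiv
    (χ.compAddMonoidHom (Pi.evalAddMonoidHom (fun _ : Fin 3 ↦ ZMod 3) i))
  let q : (Fin 3 → ZMod 3) → Submodule F L := fun a ↦
    { carrier := {x | ∀ i, θ i x = χ (a i) • x}
      add_mem' := fun {x y} hx hy i ↦ by rw [map_add, hx i, hy i, smul_add]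
      zero_mem' := fun i ↦ by rw [map_zero, smul_zero]
      smul_mem' := fun c x hx i ↦ by rw [map_smul, hx i, smul_comm] }
  have hq : iSupIndep q := iSupIndep_of_eigen (fun i ↦ (θ i).toLinearEquiv.toLinearMap)
    (fun (a : Fin 3 → ZMod 3) i ↦ χ (a i)) (fun a b hab ↦ funext fun i ↦ hχ (congrFun hab i)) q
    fun _ i _ hx ↦ hx i
  have h1 := eq_of_le_of_iSupIndep (fun a x hx i ↦ hθ i a x hx : ∀ a, gr a ≤ q a)
    hg.iSup_eq_top hq
  exact ⟨θ, fun a x ↦ by rw [h1]; rfl⟩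

theorem lie_neg_eq_zero {a : Fin 3 → ZMod 3} {x y : L} (hx : x ∈ gr a) (hy : y ∈ gr (-a)) :
    ⁅x, y⁆ = 0 := by
  have h1 := hg.lie_mem _ _ x hx y hy
  rwa [add_neg_cancel, hg.zero_eq_bot, Submodule.mem_bot] at h1

variable [IsAlgClosed F] [CharZero F]

theorem killingForm_eq_zero {a b : Fin 3 → ZMod 3} (hab : a + b ≠ 0) {x y : L} (hx : x ∈ gr a)
    (hy : y ∈ gr b) : killingForm F L x y = 0 := by
  obtain ⟨χ, hχ⟩ := exists_addChar_injective (F := F)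
  obtain ⟨θ, hθ⟩ := hg.exists_mem_iff hχ
  obtain ⟨i, hi⟩ := Function.ne_iff.mp hab
  have h1 := LieAlgebra.killingForm_of_equiv_apply (θ i) x y
  rw [(hθ a x).mp hx, (hθ b y).mp hy, map_smul, map_smul, LinearMap.smul_apply, smul_smul,
    ← AddChar.map_add_eq_mul, smul_eq_mul] at h1
  have h2 : χ (b i + a i) - 1 ≠ 0 := fun h ↦ hi <| by
    have h3 := hχ ((sub_eq_zero.mp h).trans χ.map_zero_eq_one.symm)
    rwa [add_comm] at h3
  exact (mul_eq_zero.mp (show (χ (b i + a i) - 1) * killingForm F L x y = 0 by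
    linear_combination h1)).resolve_left h2

variable [LieAlgebra.IsKilling F L]

theorem eq_zero_of_killingForm {a : Fin 3 → ZMod 3} {x : L} (hx : x ∈ gr a)
    (h : ∀ y ∈ gr (-a), killingForm F L x y = 0) : x = 0 := by
  refine JordanF4.eq_zero_of_killingForm (F := F) fun y ↦ ?_
  have hy : y ∈ ⨆ a, gr a := hg.iSup_eq_top ▸ Submodule.mem_top
  induction hy using Submodule.iSup_induction' with
  | mem b y hy =>
    by_cases hab : a + b = 0
    · rw [← neg_eq_of_add_eq_zero_right hab] at hy
      exact h y hy
    · exact hg.killingForm_eq_zero hab hx hy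
  | zero => exact map_zero _
  | add y z _ _ hy hz => rw [map_add, hy, hz, add_zero]

theorem lie_self_eq_zero {a : Fin 3 → ZMod 3} (ha : a ≠ 0) {x y : L} (hx : x ∈ gr a)
    (hy : y ∈ gr a) : ⁅x, y⁆ = 0 := by
  have h1 := hg.lie_mem _ _ x hx y hy
  refine hg.eq_zero_of_killingForm h1 fun z hz ↦ ?_
  have hz : z ∈ gr a := by
    rwa [show -(a + a) = a from funext fun i ↦ (by decide : ∀ c : ZMod 3, -(c + c) = c) _] at hz
  by_cases hli : LinearIndependent F ![(⟨x, hx⟩ : gr a), ⟨y, hy⟩]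
  · have h2 := hli.span_eq_top_of_card_eq_finrank (by rw [hg.finrank_eq_two a ha]; rfl)
    have h3 : (⟨z, hz⟩ : gr a) ∈ Submodule.span F (Set.range ![(⟨x, hx⟩ : gr a), ⟨y, hy⟩]) :=
      h2 ▸ Submodule.mem_top
    rw [Matrix.range_cons_cons_empty, Submodule.mem_span_pair] at h3
    obtain ⟨s, t, hst⟩ := h3
    have hst : s • x + t • y = z := congrArg Subtype.val hst
    have h4 : killingForm F L ⁅x, y⁆ y = 0 := by
      rw [LieModule.traceForm_apply_lie_apply, lie_self, map_zero]
    have h5 : killingForm F L ⁅x, y⁆ x = 0 := by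
      rw [LieModule.traceForm_comm, ← LieModule.traceForm_apply_lie_apply, lie_self, map_zero,
        LinearMap.zero_apply]
    rw [← hst, map_add, map_smul, map_smul, h4, h5, smul_zero, smul_zero, add_zero]
  · rw [LinearIndependent.pair_iff] at hli
    push Not at hli
    obtain ⟨s, t, hst, hne⟩ := hli
    have hst : s • x + t • y = 0 := congrArg Subtype.val hst
    have h4 : t • ⁅x, y⁆ = 0 := by
      rw [← lie_smul, eq_neg_of_add_eq_zero_right hst, lie_neg, lie_smul, lie_self, smul_zero,
        neg_zero]
    have h5 : s • ⁅x, y⁆ = 0 := by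
      rw [← smul_lie, eq_neg_of_add_eq_zero_left hst, neg_lie, smul_lie, lie_self, smul_zero,
        neg_zero]
    by_cases hs : s = 0
    · rw [(smul_eq_zero.mp h4).resolve_left (hne hs), map_zero, LinearMap.zero_apply]
    · rw [(smul_eq_zero.mp h5).resolve_left hs, map_zero, LinearMap.zero_apply]

end IsJordanGrading

end Grading

end JordanF4

namespace JordanF4

open Module LieAlgebra

section Grading

variable {F L : Type*} [Field F] [LieRing L] [LieAlgebra F L]

theorem mem_maxGenEigenspace_of_lieEquiv (θ : L ≃ₗ⁅F⁆ L) {x y : L} {c μ : F} (hc : c ≠ 0)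
    (hx : θ x = c • x) (hy : y ∈ (ad F L x).maxGenEigenspace μ) :
    θ y ∈ (ad F L x).maxGenEigenspace (c⁻¹ * μ) := by
  rw [End.mem_maxGenEigenspace] at hy ⊢
  obtain ⟨k, hk⟩ := hy
  refine ⟨k, ?_⟩
  have h1 : ∀ n : ℕ, c ^ n • ((ad F L x - (c⁻¹ * μ) • (1 : End F L)) ^ n) (θ y) =
      θ (((ad F L x - μ • (1 : End F L)) ^ n) y) := fun n ↦ by
    induction n with
    | zero => simp
    | succ n ih =>
      rw [pow_succ', pow_succ', pow_succ', Module.End.mul_apply, Module.End.mul_apply, mul_smul,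
        ← map_smul, ih]
      simp only [LinearMap.sub_apply, LinearMap.smul_apply, Module.End.one_apply, ad_apply,
        map_sub, map_smul, LieEquiv.map_lie, hx, smul_lie, smul_sub, smul_smul]
      rw [mul_inv_cancel_left₀ hc]
  have h2 := h1 k
  rw [hk, map_zero] at h2
  exact (smul_eq_zero.mp h2).resolve_left (pow_ne_zero _ hc)

variable {gr : (Fin 3 → ZMod 3) → Submodule F L}

namespace IsJordanGrading

variable (hg : IsJordanGrading F gr)

include hg

theorem finrank_sup_neg [FiniteDimensional F L] {a : Fin 3 → ZMod 3} (ha : a ≠ 0) :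
    finrank F ↥(gr a ⊔ gr (-a)) = 4 := by
  have hne : a ≠ -a := fun h ↦ ha <| funext fun i ↦
    (by decide : ∀ c : ZMod 3, c = -c → c = 0) _ (congrFun h i)
  have h1 := Submodule.finrank_sup_add_finrank_inf_eq (gr a) (gr (-a))
  rwa [(hg.indep.pairwiseDisjoint hne).eq_bot, finrank_bot, hg.finrank_eq_two a ha,
    hg.finrank_eq_two (-a) (neg_ne_zero.mpr ha)] at h1

variable [IsAlgClosed F] [CharZero F] [FiniteDimensional F L] [IsKilling F L]

theorem lie_eq_smul_of_mem {a : Fin 3 → ZMod 3} {x : L} (hx : x ∈ gr a)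
    {μ : F} {y : L} (hy : y ∈ (ad F L x).maxGenEigenspace μ) : ⁅x, y⁆ = μ • y := by
  obtain ⟨χ, hχ⟩ := exists_addChar_injective (F := F)
  obtain ⟨θ, hθ⟩ := hg.exists_mem_iff hχ
  obtain ⟨z, hz⟩ := exists_lie_eq_smul (F := F) x
  have hza : z ∈ gr a := (hθ a z).mpr fun i ↦ by
    have hc : χ (a i) ≠ 0 := fun h ↦ by
      have h1 := addChar_pow_three χ (a i)
      rw [h] at h1
      norm_num at h1
    have h1 : ad F L (θ i z - χ (a i) • z) = 0 := by
      refine linearMap_ext_of_iSup (ad F L x).iSup_maxGenEigenspace_eq_top fun μ y hy ↦ ?_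
      have h2 : (θ i).symm x = (χ (a i))⁻¹ • x := by
        rw [LieEquiv.symm_apply_eq]
        rw [map_smul, (hθ a x).mp hx i, smul_smul, inv_mul_cancel₀ hc, one_smul]
      have h3 := mem_maxGenEigenspace_of_lieEquiv (θ i).symm (inv_ne_zero hc) h2 hy
      have h4 := congrArg (θ i) (hz _ _ h3)
      rw [LieEquiv.map_lie, map_smul, LieEquiv.apply_symm_apply, inv_inv] at h4
      rw [ad_apply, sub_lie, smul_lie, h4, hz _ _ hy, smul_smul, sub_self, LinearMap.zero_apply]
    rw [← sub_eq_zero]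
    refine JordanF4.eq_zero_of_killingForm (F := F) fun y ↦ ?_
    rw [killingForm_apply_apply, h1, LinearMap.zero_comp, map_zero]
  have hw : x - z = 0 := by
    refine hg.eq_zero_of_killingForm (sub_mem hx hza) fun y hy ↦ ?_
    have h1 : Commute (ad F L y) (ad F L x) := LinearMap.ext fun w ↦ by
      have := leibniz_lie y x w
      rwa [← lie_skew y x, hg.lie_neg_eq_zero hx hy, neg_zero, zero_lie, zero_add] at this
    have h2 : Commute (ad F L x - ad F L z) (ad F L y) := by
      refine (h1.symm.sub_left ?_)
      refine linearMap_ext_of_iSup (ad F L x).iSup_maxGenEigenspace_eq_top fun μ w hw ↦ ?_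
      rw [Module.End.mul_apply, Module.End.mul_apply, ad_apply F L z w, hz _ _ hw, map_smul,
        ad_apply F L z]
      exact hz _ _ (End.mapsTo_maxGenEigenspace_of_comm h1.symm μ hw)
    rw [killingForm_apply_apply, map_sub, ← Module.End.mul_eq_comp]
    exact (LinearMap.isNilpotent_trace_of_isNilpotent
      (h2.isNilpotent_mul_right (isNilpotent_sub_of_eq_smul hz))).eq_zero
  rw [sub_eq_zero.mp hw]
  exact hz μ y hy

theorem lie_eq_zero_of_lie_lie {a : Fin 3 → ZMod 3} {x : L} (hx : x ∈ gr a) {y : L}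
    (hy : ⁅x, ⁅x, y⁆⁆ = 0) : ⁅x, y⁆ = 0 := by
  have h1 := hg.lie_eq_smul_of_mem hx (μ := 0) (y := y) <| by
    rw [End.mem_maxGenEigenspace]
    refine ⟨2, ?_⟩
    rw [zero_smul, sub_zero, pow_two]
    exact hy
  rwa [zero_smul] at h1

theorem exists_cartan [IsSimple F L] (hdim : finrank F L = 52) {a : Fin 3 → ZMod 3} (ha : a ≠ 0) :
    ∃ K : LieSubalgebra F L, K.IsCartanSubalgebra ∧ K.toSubmodule = gr a ⊔ gr (-a) := by
  obtain ⟨K, hK, hS⟩ := exists_cartan_of_commute (F := F) (S := (gr a : Set L) ∪ gr (-a))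
    (by
      rintro x (hx | hx) y (hy | hy)
      · exact hg.lie_self_eq_zero ha hx hy
      · exact hg.lie_neg_eq_zero hx hy
      · rw [← lie_skew, hg.lie_neg_eq_zero hy hx, neg_zero]
      · exact hg.lie_self_eq_zero (neg_ne_zero.mpr ha) hx hy)
    (by
      rintro x (hx | hx) y hy
      · exact hg.lie_eq_zero_of_lie_lie hx hy
      · exact hg.lie_eq_zero_of_lie_lie hx hy)
  refine ⟨K, hK, (Submodule.eq_of_le_of_finrank_eq (sup_le (fun x hx ↦ hS (.inl hx))
    fun x hx ↦ hS (.inr hx)) ?_).symm⟩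
  obtain ⟨α, hα⟩ := exists_quad_cartan (H := K) hdim
  rw [hg.finrank_sup_neg ha]
  exact (finrank_cartan_eq_four hdim hα).symm

theorem exists_isFrame [IsSimple F L] (hdim : finrank F L = 52) {a : Fin 3 → ZMod 3} (ha : a ≠ 0)
    {θ : L ≃ₗ⁅F⁆ L} {s t : F} (hs : s * s + s + 1 = 0) (ht : t * t + t + 1 = 0)
    (hθ : ∀ x ∈ gr a, θ x = s • x) (hθ' : ∀ x ∈ gr (-a), θ x = t • x) :
    ∃ h : Fin 4 → L, IsFrame F h ∧ wt (F := F) h 0 = gr a ⊔ gr (-a) ∧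
      ∀ v, ∀ x ∈ wt (F := F) h v, θ x ∈ wt (F := F) h (rot v) := by
  obtain ⟨K, hK, hKa⟩ := hg.exists_cartan hdim ha
  have hmem : ∀ x ∈ K.toSubmodule, θ x ∈ K.toSubmodule := fun x hx ↦ by
    rw [hKa] at hx ⊢
    obtain ⟨y, hy, z, hz, rfl⟩ := Submodule.mem_sup.mp hx
    rw [map_add, hθ y hy, hθ' z hz]
    exact Submodule.add_mem_sup (Submodule.smul_mem _ _ hy) (Submodule.smul_mem _ _ hz)
  let T : K →ₗ[F] K := θ.toLinearEquiv.toLinearMap.restrict hmem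
  have hT : ∀ y : K, (T y : L) = θ y := fun y ↦ rfl
  obtain ⟨h, h1, h2, h3⟩ := exists_isFrame_map hdim θ T hT fun y ↦ by
    refine Subtype.ext ?_
    change θ (θ y) + θ y + y = (0 : L)
    have hy : (y : L) ∈ K.toSubmodule := y.2
    rw [hKa] at hy
    obtain ⟨p, hp, q, hq, hpq⟩ := Submodule.mem_sup.mp hy
    rw [← hpq, map_add, hθ p hp, hθ' q hq, map_add, map_smul, map_smul, hθ p hp, hθ' q hq]
    have h1 : (s * s + s + 1) • p + (t * t + t + 1) • q = 0 := by
      rw [hs, ht, zero_smul, zero_smul, add_zero]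
    rw [← h1]
    module
  exact ⟨h, h1, h1.wt_zero.trans (h2.trans hKa), h3⟩

end IsJordanGrading

end Grading

end JordanF4

namespace JordanF4

open Module

section Normalised

variable {F L : Type*} [Field F] [LieRing L] [LieAlgebra F L]

theorem lie_map_h {h : Fin 4 → L} {θ : L ≃ₗ⁅F⁆ L}
    (hθ : ∀ v, ∀ x ∈ wt (F := F) h v, θ x ∈ wt (F := F) h (rot v)) (hθ3 : ∀ x, θ (θ (θ x)) = x)
    (i : Fin 4) {v : Fin 4 → ℤ} {y : L}
    (hy : y ∈ wt (F := F) h v) : ⁅θ (h i), y⁆ = (cartanInt (rot (rot v)) i : F) • y := by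
  have h1 := congrArg θ (hθ _ _ (hθ _ _ hy) i)
  rwa [LieEquiv.map_lie, map_smul, hθ3] at h1

/-- Simple root vectors `e` adapted to an order three automorphism `θ` lifting `rot`. -/
structure IsAdapted (F : Type*) {L : Type*} [Field F] [LieRing L] [LieAlgebra F L]
    (h : Fin 4 → L) (θ : L ≃ₗ⁅F⁆ L) (e : Fin 4 → L) : Prop where
  mem : ∀ i, e i ∈ wt (F := F) h (Pi.single i 1)
  ne_zero : ∀ i, e i ≠ 0
  killing_one : killingForm F L ⁅e 1, θ (e 1)⁆ (θ (θ (e 1))) = 1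
  killing_two : killingForm F L ⁅e 2, θ (e 2)⁆ (θ (θ (e 2))) = 1
  map_one : θ (e 1) = ⁅⁅⁅e 0, e 1⁆, e 2⁆, e 2⁆
  map_two : θ (e 2) = e 3

namespace IsFrame

theorem lie_triple_ne_zero {h : Fin 4 → L} (hh : IsFrame F h) {x y z : L}
    (hx0 : x ≠ 0) (hy0 : y ≠ 0) (hz0 : z ≠ 0)
    (hx : x ∈ wt (F := F) h (Pi.single 0 1)) (hy : y ∈ wt (F := F) h (Pi.single 1 1))
    (hz : z ∈ wt (F := F) h (Pi.single 2 1)) : ⁅⁅⁅x, y⁆, z⁆, z⁆ ≠ 0 := by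
  have h1 := hh.lie_ne_zero _ (single_mem_roots 0) _ (single_mem_roots 1) (by decide +kernel)
    _ hx _ hy hx0 hy0
  have h2 := hh.lie_ne_zero _ (by decide +kernel) _ (single_mem_roots 2) (by decide +kernel)
    _ (lie_mem_wt hx hy) _ hz h1 hz0
  exact hh.lie_ne_zero _ (by decide +kernel) _ (single_mem_roots 2) (by decide +kernel)
    _ (lie_mem_wt (lie_mem_wt hx hy) hz) _ hz h2 hz0

variable [CharZero F] {h h' : Fin 4 → L} {θ θ' : L ≃ₗ⁅F⁆ L}

theorem map_rot_rot_eq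
    (hθ : ∀ v, ∀ x ∈ wt (F := F) h v, θ x ∈ wt (F := F) h (rot v))
    (hh' : IsFrame F h') (hθ' : ∀ v, ∀ x ∈ wt (F := F) h' v, θ' x ∈ wt (F := F) h' (rot v))
    {φ : L ≃ₗ⁅F⁆ L} (hφ : ∀ i, φ (h i) = h' i) {v : Fin 4 → ℤ}
    (hv : v ∈ roots) {x x' : L} (hx : x ∈ wt (F := F) h v) (hx' : x' ∈ wt (F := F) h' v)
    (h1 : killingForm F L ⁅x, θ x⁆ (θ (θ x)) = 1)
    (h1' : killingForm F L ⁅x', θ' x'⁆ (θ' (θ' x')) = 1) (h2 : φ x = x')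
    (h3 : φ (θ x) = θ' x') : φ (θ (θ x)) = θ' (θ' x') := by
  have hx0 : θ' (θ' x') ≠ 0 := fun h0 ↦ by
    rw [h0, map_zero] at h1'
    exact zero_ne_one h1'
  obtain ⟨t, ht⟩ := hh'.exists_eq_smul (rot_mem_roots _ (rot_mem_roots _ hv))
    (hθ' _ _ (hθ' _ _ hx')) hx0 (map_mem_wt φ hφ (hθ _ _ (hθ _ _ hx)))
  have h4 := LieAlgebra.killingForm_of_equiv_apply φ ⁅x, θ x⁆ (θ (θ x))
  rw [LieEquiv.map_lie, h2, h3, ht, map_smul, h1', h1, smul_eq_mul, mul_one] at h4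
  rw [ht, h4, one_smul]

variable [LieAlgebra.IsKilling F L]
  (hh : IsFrame F h) (hθ : ∀ v, ∀ x ∈ wt (F := F) h v, θ x ∈ wt (F := F) h (rot v))

include hh hθ

theorem killingForm_rot_ne_zero {v : Fin 4 → ℤ} (hv : v ∈ roots) {x : L}
    (hx : x ∈ wt (F := F) h v) (hx0 : x ≠ 0) :
    killingForm F L ⁅x, θ x⁆ (θ (θ x)) ≠ 0 := by
  have h1 := hθ _ _ hx
  have h2 := hθ _ _ h1
  have hne : ⁅x, θ x⁆ ≠ 0 := hh.lie_ne_zero _ hv _ (rot_mem_roots _ hv)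
    (add_rot_mem_roots _ hv) _ hx _ h1 hx0 (by simpa using hx0)
  have hneg : rot (rot v) = -(v + rot v) := by
    rw [eq_neg_iff_add_eq_zero, ← rot_rot_add v]
    abel
  exact hh.killingForm_ne_zero (add_rot_mem_roots _ hv) (lie_mem_wt hx h1) hne
    (by rwa [← hneg]) (by simpa using hx0)

theorem exists_killingForm_rot_eq_one [IsAlgClosed F] {v : Fin 4 → ℤ} (hv : v ∈ roots) :
    ∃ x ∈ wt (F := F) h v, x ≠ 0 ∧ killingForm F L ⁅x, θ x⁆ (θ (θ x)) = 1 := by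
  obtain ⟨x, hx, hx0⟩ := hh.exists_ne_zero hv
  have h1 := hh.killingForm_rot_ne_zero hθ hv hx hx0
  obtain ⟨t, ht⟩ := IsAlgClosed.exists_pow_nat_eq (killingForm F L ⁅x, θ x⁆ (θ (θ x)))⁻¹
    (n := 3) (by norm_num)
  have ht0 : t ≠ 0 := fun h0 ↦ by
    rw [h0, zero_pow (by norm_num)] at ht
    exact inv_ne_zero h1 ht.symm
  refine ⟨t • x, Submodule.smul_mem _ t hx, smul_ne_zero ht0 hx0, ?_⟩
  simp only [map_smul, smul_lie, lie_smul, LinearMap.smul_apply, smul_eq_mul]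
  rw [← inv_mul_cancel₀ h1, ← ht]
  ring

theorem exists_isAdapted [IsAlgClosed F] : ∃ e, IsAdapted F h θ e := by
  obtain ⟨x, hx, hx0, hx1⟩ := hh.exists_killingForm_rot_eq_one hθ (single_mem_roots 1)
  obtain ⟨y, hy, hy0, hy1⟩ := hh.exists_killingForm_rot_eq_one hθ (single_mem_roots 2)
  obtain ⟨z, hz, hz0⟩ := hh.exists_ne_zero (single_mem_roots 0)
  have h1 := hh.lie_triple_ne_zero hz0 hx0 hy0 hz hx hy
  obtain ⟨c, hc⟩ := hh.exists_eq_smul (by decide +kernel)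
    (lie_mem_wt (lie_mem_wt (lie_mem_wt hz hx) hy) hy) h1 (y := θ x) (by
      rw [show Pi.single 0 1 + Pi.single 1 1 + Pi.single 2 1 + Pi.single 2 1 =
        rot (Pi.single 1 1) by decide +kernel]
      exact hθ _ _ hx)
  have hc0 : c ≠ 0 := fun h0 ↦ hx0 (by rwa [h0, zero_smul, EmbeddingLike.map_eq_zero_iff] at hc)
  refine ⟨![c • z, x, y, θ y], fun i ↦ ?_, fun i ↦ ?_, hx1, hy1, ?_, rfl⟩
  · fin_cases i
    · exact Submodule.smul_mem _ c hz
    · exact hx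
    · exact hy
    · exact (by decide +kernel : rot (Pi.single 2 1) = Pi.single 3 1) ▸ hθ _ _ hy
  · fin_cases i
    · exact smul_ne_zero hc0 hz0
    · exact hx0
    · exact hy0
    · exact fun h0 ↦ hy0 ((EmbeddingLike.map_eq_zero_iff (f := θ)).mp h0)
  · change θ x = ⁅⁅⁅c • z, x⁆, y⁆, y⁆
    rw [hc, smul_lie, smul_lie, smul_lie]

variable (hh' : IsFrame F h') (hθ' : ∀ v, ∀ x ∈ wt (F := F) h' v, θ' x ∈ wt (F := F) h' (rot v))

include hh' hθ'

theorem exists_lieEquiv_comm [FiniteDimensional F L] [LieAlgebra.IsSimple F L] [IsAlgClosed F]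
    (hθ3 : ∀ x, θ (θ (θ x)) = x) (hθ3' : ∀ x, θ' (θ' (θ' x)) = x) :
    ∃ φ : L ≃ₗ⁅F⁆ L, (∀ i, φ (h i) = h' i) ∧ ∀ x, φ (θ x) = θ' (φ x) := by
  obtain ⟨e, he⟩ := hh.exists_isAdapted hθ
  obtain ⟨e', he'⟩ := hh'.exists_isAdapted hθ'
  obtain ⟨φ, hφ, hφe⟩ := hh.exists_lieEquiv hh' he.mem he.ne_zero he'.mem he'.ne_zero
  have hφs : ∀ i, φ.symm (h' i) = h i := fun i ↦ by rw [← hφ, LieEquiv.symm_apply_apply]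
  have h1 : φ (θ (e 1)) = θ' (e' 1) := by
    rw [he.map_one, he'.map_one]
    simp only [LieEquiv.map_lie, hφe]
  have h2 : φ (θ (e 2)) = θ' (e' 2) := by rw [he.map_two, he'.map_two, hφe]
  have h11 := map_rot_rot_eq hθ hh' hθ' hφ (single_mem_roots 1) (he.mem 1) (he'.mem 1)
    he.killing_one he'.killing_one (hφe 1) h1
  have h3 : φ (θ (e 3)) = θ' (e' 3) := by
    rw [← he.map_two, ← he'.map_two]
    exact map_rot_rot_eq hθ hh' hθ' hφ (single_mem_roots 2) (he.mem 2) (he'.mem 2)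
      he.killing_two he'.killing_two (hφe 2) h2
  have h0 : φ (θ (e 0)) = θ' (e' 0) := by
    rw [← sub_eq_zero]
    by_contra hne
    have h4 : θ' (θ' (φ (θ (e 0)) - θ' (e' 0))) ∈ wt (F := F) h' (Pi.single 0 1) := by
      rw [← rot_rot_rot (Pi.single 0 1)]
      exact hθ' _ _ (hθ' _ _ (sub_mem (map_mem_wt φ hφ (hθ _ _ (he.mem 0))) (hθ' _ _ (he'.mem 0))))
    have hne' : θ' (θ' (φ (θ (e 0)) - θ' (e' 0))) ≠ 0 := by
      rwa [Ne, EmbeddingLike.map_eq_zero_iff, EmbeddingLike.map_eq_zero_iff]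
    refine hh'.lie_triple_ne_zero hne' (he'.ne_zero 1) (he'.ne_zero 2) h4
      (he'.mem 1) (he'.mem 2) ((EmbeddingLike.map_eq_zero_iff (f := θ')).mp ?_)
    have h5 := congrArg (φ ∘ θ) he.map_one
    have h6 := congrArg θ' he'.map_one
    simp only [Function.comp_apply, LieEquiv.map_lie, h11, h1, h2] at h5 h6
    simp only [LieEquiv.map_lie, hθ3', sub_lie]
    rw [← h5, ← h6, sub_self]
  refine ⟨φ, hφ, fun x ↦ congrArg (fun ψ : L ≃ₗ⁅F⁆ L ↦ ψ x) (hh.lieEquiv_ext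
    (φ := θ.trans φ) (ψ := φ.trans θ') he.mem he.ne_zero (fun i ↦ ?_) fun i ↦ ?_)⟩
  · change φ (θ (h i)) = θ' (φ (h i))
    rw [← sub_eq_zero]
    refine hh'.eq_zero_of_forall_lie fun v y hy ↦ ?_
    have h4 := congrArg φ (lie_map_h hθ hθ3 i (map_mem_wt φ.symm hφs hy))
    rw [LieEquiv.map_lie, map_smul, LieEquiv.apply_symm_apply] at h4
    rw [sub_lie, h4, hφ, lie_map_h hθ' hθ3' i hy, sub_self]
  · change φ (θ (e i)) = θ' (φ (e i))
    rw [hφe]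
    fin_cases i
    exacts [h0, h1, h2, h3]

end IsFrame

end Normalised

end JordanF4

namespace JordanF4

open Module

theorem exists_eq_cls {κ : (Fin 4 → ℤ) → ZMod 3}
    (hadd : ∀ u ∈ roots, ∀ v ∈ roots, u + v ∈ roots → κ (u + v) = κ u + κ v)
    (hrot : ∀ v ∈ roots, κ (rot v) = κ v) :
    ∃ f : ZMod 3 × ZMod 3 →+ ZMod 3, ∀ v ∈ roots, κ v = f (cls v) := by
  have h3 : (3 : ZMod 3) = 0 := rfl
  refine ⟨(AddMonoidHom.mulLeft (κ (Pi.single 2 1))).coprod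
    (AddMonoidHom.mulLeft (κ (Pi.single 1 1))), ?_⟩
  simp only [AddMonoidHom.coprod_apply, AddMonoidHom.coe_mulLeft, cls]
  have h2 := hrot _ (single_mem_roots 2)
  rw [show rot (Pi.single 2 1) = Pi.single 3 1 by decide +kernel] at h2
  have h1 := hrot _ (single_mem_roots 1)
  rw [show rot (Pi.single 1 1) = Pi.single 0 1 + Pi.single 1 1 + Pi.single 2 1 + Pi.single 2 1 by
    decide +kernel, hadd _ (by decide +kernel) _ (single_mem_roots 2) (by decide +kernel),
    hadd _ (by decide +kernel) _ (single_mem_roots 2) (by decide +kernel),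
    hadd _ (single_mem_roots 0) _ (single_mem_roots 1) (by decide +kernel)] at h1
  have h0 : κ (Pi.single 0 1) = κ (Pi.single 2 1) := by
    linear_combination h1 - κ (Pi.single 2 1) * h3
  have hpos : ∀ v ∈ posRoots, κ v = κ (Pi.single 2 1) * (v 0 + v 2 + v 3) +
      κ (Pi.single 1 1) * v 1 := by
    have hs : ∀ m, κ (Pi.single m 1) = κ (Pi.single 2 1) * ((Pi.single m 1 : Fin 4 → ℤ) 0 +
        (Pi.single m 1 : Fin 4 → ℤ) 2 + (Pi.single m 1 : Fin 4 → ℤ) 3) +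
        κ (Pi.single 1 1) * (Pi.single m 1 : Fin 4 → ℤ) 1 := fun m ↦ by
      fin_cases m <;> simp [h0, h2]
    refine posRoots_induction hs fun u hu m hum ih ↦ ?_
    rw [hadd u (List.mem_append_left _ hu) _ (single_mem_roots m) (List.mem_append_left _ hum),
      ih, hs m]
    simp only [Pi.add_apply]
    push_cast
    ring
  intro v hv
  obtain hv | hv := List.mem_append.mp hv
  · exact hpos v hv
  obtain ⟨u, hu, rfl⟩ := List.mem_map.mp hv
  have hur : u ∈ roots := List.mem_append_left _ hu
  have hneg : -u = rot (rot u) + rot u := by rw [neg_eq_iff_add_eq_zero, add_comm, rot_rot_add]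
  have hk : κ (-u) = -κ u := by
    rw [hneg, hadd _ (rot_mem_roots _ (rot_mem_roots u hur)) _ (rot_mem_roots u hur)
      (hneg ▸ neg_mem_roots u hur), hrot _ (rot_mem_roots u hur), hrot u hur]
    linear_combination κ u * h3
  rw [hk, hpos u hu]
  simp only [Pi.neg_apply]
  push_cast
  ring

section Frame

variable {F L : Type*} [Field F] [LieRing L] [LieAlgebra F L]

theorem exists_addChar_eq {χ : AddChar (ZMod 3) F} (hχ : Function.Injective χ) {c : F}
    (hc : c ^ 3 = 1) : ∃ k, χ k = c := by
  have h1 := addChar_add_neg χ hχ 1 one_ne_zero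
  have h2 : χ 1 * χ (-1) = 1 := by
    rw [← AddChar.map_add_eq_mul, add_neg_cancel, AddChar.map_zero_eq_one]
  have h3 : (c - χ 0) * ((c - χ 1) * (c - χ (-1))) = 0 := by
    rw [χ.map_zero_eq_one]
    linear_combination hc - (c - 1) * c * h1 + (c - 1) * h2
  obtain h | h := mul_eq_zero.mp h3
  · exact ⟨0, (sub_eq_zero.mp h).symm⟩
  obtain h | h := mul_eq_zero.mp h
  · exact ⟨1, (sub_eq_zero.mp h).symm⟩
  · exact ⟨-1, (sub_eq_zero.mp h).symm⟩

namespace IsFrame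

variable [CharZero F] {h : Fin 4 → L} (hh : IsFrame F h)

include hh

theorem exists_addChar_cls {χ : AddChar (ZMod 3) F} (hχ : Function.Injective χ) {θ η : L ≃ₗ⁅F⁆ L}
    (hθ : ∀ v, ∀ x ∈ wt (F := F) h v, θ x ∈ wt (F := F) h (rot v))
    (hη : ∀ x ∈ wt (F := F) h 0, η x = x) (hη3 : ∀ x, η (η (η x)) = x)
    (hηθ : ∀ x, η (θ x) = θ (η x)) :
    ∃ f : ZMod 3 × ZMod 3 →+ ZMod 3, ∀ v, ∀ x ∈ wt (F := F) h v, η x = χ (f (cls v)) • x := by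
  have h1 : ∀ v ∈ roots, ∃ k, ∀ x ∈ wt (F := F) h v, η x = χ k • x := fun v hv ↦ by
    obtain ⟨x, hx, hx0⟩ := hh.exists_ne_zero hv
    obtain ⟨c, hc⟩ := hh.exists_eq_smul hv hx hx0
      (map_mem_wt η (fun i ↦ hη _ (hh.mem_wt_zero i)) hx)
    have h2 := hη3 x
    rw [hc, map_smul, hc, map_smul, map_smul, hc, smul_smul, smul_smul] at h2
    obtain ⟨k, hk⟩ := exists_addChar_eq hχ (c := c) (by
      rw [← sub_eq_zero]
      refine (smul_eq_zero.mp ?_).resolve_right hx0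
      rw [sub_smul, pow_three, ← mul_assoc, h2, one_smul, sub_self])
    refine ⟨k, fun y hy ↦ ?_⟩
    obtain ⟨t, rfl⟩ := hh.exists_eq_smul hv hx hx0 hy
    rw [map_smul, hc, hk, smul_comm]
  choose! κ hκ using h1
  have huniq : ∀ v ∈ roots, ∀ k, ∀ x ∈ wt (F := F) h v, x ≠ 0 → η x = χ k • x → κ v = k :=
    fun v hv k x hx hx0 hk ↦ hχ (smul_left_injective F hx0 ((hκ v hv x hx).symm.trans hk))
  obtain ⟨f, hf⟩ := exists_eq_cls (κ := κ)
    (fun u hu v hv huv ↦ by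
      obtain ⟨x, hx, hx0⟩ := hh.exists_ne_zero hu
      obtain ⟨y, hy, hy0⟩ := hh.exists_ne_zero hv
      refine huniq _ huv _ _ (lie_mem_wt hx hy) (hh.lie_ne_zero u hu v hv huv x hx y hy hx0 hy0) ?_
      rw [LieEquiv.map_lie, hκ u hu x hx, hκ v hv y hy, smul_lie, lie_smul, smul_smul,
        AddChar.map_add_eq_mul])
    (fun v hv ↦ by
      obtain ⟨x, hx, hx0⟩ := hh.exists_ne_zero hv
      refine huniq _ (rot_mem_roots v hv) _ _ (hθ _ _ hx) (by simpa using hx0) ?_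
      rw [hηθ, hκ v hv x hx, map_smul])
  refine ⟨f, fun v x hx ↦ ?_⟩
  by_cases hv : v ∈ roots
  · rw [← hf v hv, hκ v hv x hx]
  by_cases hv0 : v = 0
  · subst hv0
    rw [show cls 0 = 0 by decide, map_zero, AddChar.map_zero_eq_one, one_smul, hη x hx]
  · rw [hh.wt_eq_bot hv hv0, Submodule.mem_bot] at hx
    rw [hx, map_zero, smul_zero]

end IsFrame

end Frame

end JordanF4

namespace JordanF4

open Module

section Uniqueness

variable {F L : Type*} [Field F] [IsAlgClosed F] [CharZero F] [LieRing L] [LieAlgebra F L]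
  [FiniteDimensional F L] [LieAlgebra.IsKilling F L] [LieAlgebra.IsSimple F L]

theorem IsJordanGrading.exists_frame {gr : (Fin 3 → ZMod 3) → Submodule F L}
    (hg : IsJordanGrading F gr) (hdim : finrank F L = 52) {χ : AddChar (ZMod 3) F}
    (hχ : Function.Injective χ) :
    ∃ (h : Fin 4 → L) (θ : L ≃ₗ⁅F⁆ L) (K : ZMod 3 × ZMod 3 → Submodule F L)
      (f : ZMod 3 × ZMod 3 → ZMod 3 × ZMod 3),
      IsFrame F h ∧ (∀ v, ∀ x ∈ wt (F := F) h v, θ x ∈ wt (F := F) h (rot v)) ∧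
      (∀ x, θ (θ (θ x)) = x) ∧ iSupIndep K ∧ (∀ v, wt h v ≤ K (cls v)) ∧
      Function.Bijective f ∧
      ∀ c k x, x ∈ gr ![(f c).1, (f c).2, k] ↔ x ∈ K c ∧ θ x = χ k • x := by
  obtain ⟨θ, hθ⟩ := hg.exists_mem_iff hχ
  have hθ3 : ∀ i x, θ i (θ i (θ i x)) = x := fun i x ↦ by
    refine LinearMap.congr_fun (linearMap_ext_of_iSup (F := F) hg.iSup_eq_top
      (f := (θ i).toLinearEquiv.toLinearMap ∘ₗ (θ i).toLinearEquiv.toLinearMap ∘ₗ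
        (θ i).toLinearEquiv.toLinearMap) (g := LinearMap.id) fun a x hx ↦ ?_) x
    change θ i (θ i (θ i x)) = x
    rw [(hθ a x).mp hx i, map_smul, (hθ a x).mp hx i, map_smul, map_smul, (hθ a x).mp hx i,
      smul_smul, smul_smul, ← pow_two, ← pow_succ, addChar_pow_three, one_smul]
  have hcomm : ∀ i j x, θ i (θ j x) = θ j (θ i x) := fun i j x ↦ by
    refine LinearMap.congr_fun (linearMap_ext_of_iSup (F := F) hg.iSup_eq_top
      (f := (θ i).toLinearEquiv.toLinearMap ∘ₗ (θ j).toLinearEquiv.toLinearMap)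
      (g := (θ j).toLinearEquiv.toLinearMap ∘ₗ (θ i).toLinearEquiv.toLinearMap)
      fun a x hx ↦ ?_) x
    change θ i (θ j x) = θ j (θ i x)
    rw [(hθ a x).mp hx i, (hθ a x).mp hx j, map_smul, map_smul, (hθ a x).mp hx i,
      (hθ a x).mp hx j, smul_comm]
  have hroot : ∀ c : ZMod 3, c ≠ 0 → χ c * χ c + χ c + 1 = 0 := fun c hc ↦ by
    have h1 := addChar_add_neg χ hχ c hc
    have h2 : χ c * χ (-c) = 1 := by
      rw [← AddChar.map_add_eq_mul, add_neg_cancel, AddChar.map_zero_eq_one]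
    linear_combination χ c * h1 - h2
  obtain ⟨h, hh, hh0, hrot⟩ := hg.exists_isFrame hdim (a := ![0, 0, 1]) (by decide)
    (hroot 1 (by decide)) (hroot (-1) (by decide)) (fun x hx ↦ (hθ _ x).mp hx 2)
    (fun x hx ↦ (hθ _ x).mp hx 2)
  have hfix : ∀ i : Fin 3, i ≠ 2 → ∀ x ∈ wt (F := F) h 0, θ i x = x := fun i hi x hx ↦ by
    have h1 : (![0, 0, 1] : Fin 3 → ZMod 3) i = 0 :=
      (by decide : ∀ i : Fin 3, i ≠ 2 → (![0, 0, 1] : Fin 3 → ZMod 3) i = 0) i hi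
    rw [hh0] at hx
    obtain ⟨y, hy, z, hz, rfl⟩ := Submodule.mem_sup.mp hx
    rw [map_add, (hθ _ y).mp hy, (hθ _ z).mp hz, Pi.neg_apply, h1, neg_zero,
      AddChar.map_zero_eq_one, one_smul, one_smul]
  obtain ⟨f₀, hf₀⟩ := hh.exists_addChar_cls hχ hrot (hfix 0 (by decide)) (hθ3 0) (hcomm 0 2)
  obtain ⟨f₁, hf₁⟩ := hh.exists_addChar_cls hχ hrot (hfix 1 (by decide)) (hθ3 1) (hcomm 1 2)
  let q : ZMod 3 × ZMod 3 → Submodule F L := fun b ↦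
    End.eigenspace (θ 0).toLinearEquiv.toLinearMap (χ b.1) ⊓
      End.eigenspace (θ 1).toLinearEquiv.toLinearMap (χ b.2)
  have hq : ∀ b x, x ∈ q b ↔ θ 0 x = χ b.1 • x ∧ θ 1 x = χ b.2 • x := fun b x ↦ by
    rw [Submodule.mem_inf, End.mem_eigenspace_iff, End.mem_eigenspace_iff]
    rfl
  have hqi : iSupIndep q := iSupIndep_of_eigen
    (fun i : Fin 2 ↦ (θ (i.castSucc)).toLinearEquiv.toLinearMap)
    (fun (b : ZMod 3 × ZMod 3) i ↦ χ (![b.1, b.2] i))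
    (fun a b hab ↦ Prod.ext (hχ (congrFun hab 0)) (hχ (congrFun hab 1))) q fun b i x hx ↦ by
      fin_cases i
      · exact ((hq b x).mp hx).1
      · exact ((hq b x).mp hx).2
  have hmem : ∀ b k x, x ∈ gr ![b.1, b.2, k] ↔ x ∈ q b ∧ θ 2 x = χ k • x := fun b k x ↦ by
    rw [hθ, hq, and_assoc]
    simp [Fin.forall_fin_succ]
  have hle : ∀ v, wt h v ≤ q (f₀.prod f₁ (cls v)) := fun v x hx ↦
    (hq _ _).mpr ⟨hf₀ v x hx, hf₁ v x hx⟩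
  have hq0 : q 0 = wt h 0 := by
    let p : ZMod 3 × ZMod 3 → Submodule F L := fun b ↦ ⨆ k, gr ![b.1, b.2, k]
    refine le_antisymm ?_ ((hle 0).trans_eq (by rw [show cls 0 = 0 by decide, map_zero]))
    have h1 : p 0 = q 0 := eq_of_le_of_iSupIndep
      (fun b ↦ iSup_le fun k x hx ↦ ((hmem b k x).mp hx).1) (by
        rw [← top_le_iff, ← hg.iSup_eq_top]
        refine iSup_le fun a ↦ ?_
        refine le_trans ?_ (le_iSup _ (a 0, a 1))
        refine le_trans (le_of_eq ?_) (le_iSup _ (a 2))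
        congr 1
        ext i
        fin_cases i <;> rfl) hqi 0
    rw [← h1, hh0]
    refine iSup_le fun k ↦ ?_
    obtain rfl | rfl | rfl := (by decide : ∀ k : ZMod 3, k = 0 ∨ k = 1 ∨ k = -1) k
    · rw [show ![(0 : ZMod 3 × ZMod 3).1, (0 : ZMod 3 × ZMod 3).2, 0] = 0 by decide,
        hg.zero_eq_bot]
      exact bot_le
    · exact le_sup_left
    · exact le_sup_of_le_right (le_of_eq (congrArg gr (by decide)))
  have hinj : Function.Injective (f₀.prod f₁) := by
    rw [injective_iff_map_eq_zero]
    intro c hc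
    by_contra hc0
    obtain ⟨u, hu, -, -, huc, -⟩ := exists_roots_of_cls c hc0
    obtain ⟨x, hx, hx0⟩ := hh.exists_ne_zero hu
    have h1 := hle u hx
    rw [huc, hc, hq0] at h1
    refine hx0 (Submodule.disjoint_def.mp ((iSupIndep_wt h).pairwiseDisjoint
      (show u ≠ 0 from fun h0 ↦ zero_notMem_roots (h0 ▸ hu))) x hx h1)
  exact ⟨h, θ 2, fun c ↦ q (f₀.prod f₁ c), f₀.prod f₁, hh, hrot, hθ3 2, hqi.comp hinj, hle,
    Finite.injective_iff_bijective.mp hinj, fun c k x ↦ hmem _ k x⟩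

theorem IsJordanGrading.exists_map_eq {gr gr' : (Fin 3 → ZMod 3) → Submodule F L}
    (hg : IsJordanGrading F gr) (hg' : IsJordanGrading F gr') (hdim : finrank F L = 52) :
    ∃ φ : L ≃ₗ⁅F⁆ L, ∀ a, gr a ≠ ⊥ → ∃ b, (gr a).map φ.toLinearEquiv.toLinearMap = gr' b := by
  obtain ⟨χ, hχ⟩ := exists_addChar_injective (F := F)
  obtain ⟨h, θ, K, f, hh, hrot, hθ3, hK, hle, hf, hmem⟩ := hg.exists_frame hdim hχ
  obtain ⟨h', θ', K', f', hh', hrot', hθ3', hK', hle', hf', hmem'⟩ := hg'.exists_frame hdim hχ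
  obtain ⟨φ, hφ, hφθ⟩ := hh.exists_lieEquiv_comm hrot hh' hrot' hθ3 hθ3'
  have hφK : ∀ c, K c ≤ (K' c).comap φ.toLinearEquiv.toLinearMap := fun c ↦ by
    rw [← eq_of_le_of_iSupIndep (p := fun c ↦ K c ⊓ (K' c).comap φ.toLinearEquiv.toLinearMap)
      (fun c ↦ inf_le_left) ?_ hK c]
    · exact inf_le_right
    · have h1 : ∀ v, wt (F := F) h v ≤
          ⨆ c, K c ⊓ (K' c).comap φ.toLinearEquiv.toLinearMap := fun v ↦
        le_iSup_of_le (cls v) (le_inf (hle v) fun x hx ↦ hle' v (map_mem_wt φ hφ hx))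
      rw [← top_le_iff, ← hh.iSup_wt]
      exact sup_le (h1 0) (iSup₂_le fun v _ ↦ h1 v)
  refine ⟨φ, fun a ha ↦ ?_⟩
  obtain ⟨c, hc⟩ := hf.surjective (a 0, a 1)
  have hac : a = ![(f c).1, (f c).2, a 2] := by
    rw [hc]
    ext i
    fin_cases i <;> rfl
  have ha0 : a ≠ 0 := fun h0 ↦ ha (h0 ▸ hg.zero_eq_bot)
  refine ⟨![(f' c).1, (f' c).2, a 2], Submodule.eq_of_le_of_finrank_le ?_ ?_⟩
  · rintro _ ⟨x, hx, rfl⟩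
    rw [hac] at hx
    obtain ⟨h1, h2⟩ := (hmem c _ x).mp hx
    refine (hmem' c _ _).mpr ⟨hφK c h1, ?_⟩
    change θ' (φ x) = _ • φ x
    rw [← hφθ, h2, map_smul]
  · rw [LinearEquiv.finrank_map_eq, hg.finrank_eq_two a ha0]
    by_cases hb : ![(f' c).1, (f' c).2, a 2] = 0
    · rw [hb, hg'.zero_eq_bot, finrank_bot]
      exact Nat.zero_le 2
    · rw [hg'.finrank_eq_two _ hb]

end Uniqueness

end JordanF4

theorem jordan_grading_F4 (F : Type*) [Field F] [IsAlgClosed F] [CharZero F]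
    (L : Type*) [LieRing L] [LieAlgebra F L] [FiniteDimensional F L]
    [LieAlgebra.IsSimple F L] (hdim : finrank F L = 52) :
    (∃ gr : (Fin 3 → ZMod 3) → Submodule F L, IsLieGrading F gr ∧
      ∀ a : Fin 3 → ZMod 3, a ≠ 0 → finrank F (gr a) = 2) ∧
    ∀ gr gr' : (Fin 3 → ZMod 3) → Submodule F L,
      IsLieGrading F gr → (∀ a : Fin 3 → ZMod 3, a ≠ 0 → finrank F (gr a) = 2) →
      IsLieGrading F gr' → (∀ a : Fin 3 → ZMod 3, a ≠ 0 → finrank F (gr' a) = 2) →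
      GradingsEquiv F gr gr' := by
  refine ⟨JordanF4.exists_grading hdim, fun gr gr' hgr hgr2 hgr' hgr2' ↦ ?_⟩
  exact (JordanF4.isJordanGrading_of_isInternal hdim hgr.1 hgr.2 hgr2).exists_map_eq
    (JordanF4.isJordanGrading_of_isInternal hdim hgr'.1 hgr'.2 hgr2') hdim
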